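/- Let d ≥ 1, let G be a convex body in ℝ^{2d} containing the origin, and let 2 < q < ∞. Let 1 < p1, p2 < ∞ and 1/2 < p < ∞ with 1/p = 1/p1 + 1/p2. Then there exists a constant C = C(p1, p2, q, d, G) such that for all f1 ∈ ℓ^{p1}(ℤ^d) and f2 ∈ ℓ^{p2}(ℤ^d), the discrete bilinear averages A_t^{G,disc}(f1,f2)(j) = (#(G_t ∩ ℤ^{2d}))^{-1} Σ_{(k,m) ∈ G_t ∩ ℤ^{2d}} f1(j−k) f2(j−m), for t > 0 and j ∈ ℤ^d, satisfy ‖ j ↦ V_q(A_t^{G,disc}(f1,f2)(j) : t>0) ‖_{ℓ^p(ℤ^d)} ≤ C ‖f1‖_{ℓ^{p1}} ‖f2‖_{ℓ^{p2}}. -/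

import Mathlib

open MeasureTheory Filter
open scoped ENNReal Topology

noncomputable section

/-- The `q`-variation seminorm of the family `(a t)_{t > 0}`, valued in `ℝ≥0∞`. -/
def vqVar (q : ℝ) (a : ℝ → ℝ) : ℝ≥0∞ :=
  ⨆ (u : ℕ → ℝ) (_ : StrictMono u) (_ : 0 < u 0),
    (∑' k : ℕ, ENNReal.ofReal |a (u (k + 1)) - a (u k)| ^ q) ^ (1 / q)

/-- A convex body: a nonempty bounded open convex set. -/
def IsConvexBody {E : Type*} [NormedAddCommGroup E] [NormedSpace ℝ E] (G : Set E) : Prop :=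
  Convex ℝ G ∧ IsOpen G ∧ Bornology.IsBounded G ∧ G.Nonempty

/-- The dilate `G_t = {z | t⁻¹ • z ∈ G}`. -/
def dilate {E : Type*} [SMul ℝ E] (G : Set E) (t : ℝ) : Set E := {z | t⁻¹ • z ∈ G}

/-- The bilinear averaging operator over the dilates of `G ⊆ ℝ^d × ℝ^d`. -/
def biAvg (d : ℕ) (G : Set ((Fin d → ℝ) × (Fin d → ℝ)))
    (f1 f2 : (Fin d → ℝ) → ℝ) (t : ℝ) (x : Fin d → ℝ) : ℝ :=
  (volume (dilate G t)).toReal⁻¹ * ∫ y in dilate G t, f1 (x + y.1) * f2 (x + y.2)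

/-- The dyadic cube of generation `j` (side `2^j`) containing `x`. -/
def dyadicPiece (d : ℕ) (j : ℤ) (x : Fin d → ℝ) : Set (Fin d → ℝ) :=
  {y | ∀ i, ⌊(2:ℝ) ^ (-j) * y i⌋ = ⌊(2:ℝ) ^ (-j) * x i⌋}

/-- The dyadic conditional expectation `E_j f`. -/
def dyadicCE (d : ℕ) (j : ℤ) (f : (Fin d → ℝ) → ℝ) (x : Fin d → ℝ) : ℝ :=
  ((2:ℝ) ^ (j * (d:ℤ)))⁻¹ * ∫ y in dyadicPiece d j x, f y

/-- The dyadic cube of generation `j` with lower-left corner `2^j • m`. -/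
def dyadicCube (d : ℕ) (j : ℤ) (m : Fin d → ℤ) : Set (Fin d → ℝ) :=
  {y | ∀ i, (2:ℝ) ^ j * (m i) ≤ y i ∧ y i < (2:ℝ) ^ j * (m i + 1)}

/-- The (axis-parallel, half-open) cube with corner `a` and side `l`. -/
def cube (d : ℕ) (a : Fin d → ℝ) (l : ℝ) : Set (Fin d → ℝ) :=
  {y | ∀ i, a i ≤ y i ∧ y i < a i + l}

/-- The Euclidean norm on `ℝ^d`. -/
def euclNorm (d : ℕ) (x : Fin d → ℝ) : ℝ := Real.sqrt (∑ i, x i ^ 2)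

/-- The lattice points of `ℤ^{2d}` lying in the dilate `G_t`. -/
def latticePts (d : ℕ) (G : Set ((Fin d → ℝ) × (Fin d → ℝ))) (t : ℝ) :
    Set ((Fin d → ℤ) × (Fin d → ℤ)) :=
  {km | ((fun i => ((km.1 i : ℝ))), (fun i => ((km.2 i : ℝ)))) ∈ dilate G t}

/-- The discrete bilinear averaging operator
`A_t^{G,disc}(f1,f2)(j) = #(G_t ∩ ℤ^{2d})⁻¹ Σ_{(k,m) ∈ G_t ∩ ℤ^{2d}} f1(j-k) f2(j-m)`. -/
def discAvg (d : ℕ) (G : Set ((Fin d → ℝ) × (Fin d → ℝ)))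
    (f1 f2 : (Fin d → ℤ) → ℝ) (t : ℝ) (j : Fin d → ℤ) : ℝ :=
  (∑' km : (Fin d → ℤ) × (Fin d → ℤ),
      Set.indicator (latticePts d G t) (fun _ => (1:ℝ)) km)⁻¹ *
    ∑' km : (Fin d → ℤ) × (Fin d → ℤ),
      Set.indicator (latticePts d G t) (fun km => f1 (j - km.1) * f2 (j - km.2)) km

namespace LatticeVariation

variable {d : ℕ}

/-- The dyadic cube of `ℤ^d` of side `2^n` containing `x`. -/
def dyCube (n : ℕ) (x : Fin d → ℤ) : Finset (Fin d → ℤ) :=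
  Fintype.piFinset fun i => Finset.Ico (x i / 2 ^ n * 2 ^ n) (x i / 2 ^ n * 2 ^ n + 2 ^ n)

lemma mem_dyCube {n : ℕ} {x y : Fin d → ℤ} :
    y ∈ dyCube n x ↔ ∀ i, y i / 2 ^ n = x i / 2 ^ n := by
  simp only [dyCube, Fintype.mem_piFinset, Finset.mem_Ico]
  refine forall_congr' fun i => ?_
  have h2 : (0 : ℤ) < 2 ^ n := by positivity
  rw [Int.ediv_eq_iff_of_pos h2]

lemma card_dyCube (n : ℕ) (x : Fin d → ℤ) : (dyCube n x).card = 2 ^ (n * d) := by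
  simp [dyCube, Fintype.card_piFinset, pow_mul]
  rfl

lemma self_mem_dyCube (n : ℕ) (x : Fin d → ℤ) : x ∈ dyCube n x := by simp [mem_dyCube]

lemma mem_dyCube_comm {n : ℕ} {x y : Fin d → ℤ} : y ∈ dyCube n x ↔ x ∈ dyCube n y := by
  simp only [mem_dyCube, eq_comm]

lemma dyCube_eq {n : ℕ} {x y : Fin d → ℤ} (h : y ∈ dyCube n x) : dyCube n y = dyCube n x := by
  rw [mem_dyCube] at h
  ext z
  simp [mem_dyCube, h]

lemma mem_dyCube_mono {m n : ℕ} (hmn : m ≤ n) {x y : Fin d → ℤ} (h : y ∈ dyCube m x) :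
    y ∈ dyCube n x := by
  rw [mem_dyCube] at h ⊢
  intro i
  obtain ⟨k, rfl⟩ := Nat.exists_eq_add_of_le hmn
  rw [pow_add, ← Int.ediv_ediv_of_nonneg (by positivity), ← Int.ediv_ediv_of_nonneg (by positivity),
    h i]

lemma abs_sub_lt_of_mem_dyCube {n : ℕ} {x y : Fin d → ℤ} (h : y ∈ dyCube n x) (i : Fin d) :
    |x i - y i| < 2 ^ n := by
  simp only [dyCube, Fintype.mem_piFinset, Finset.mem_Ico] at h
  have h1 := h i
  have h2 : (0 : ℤ) < 2 ^ n := by positivity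
  have h3 := Int.ediv_mul_le (x i) h2.ne'
  have h4 := Int.lt_ediv_add_one_mul_self (x i) h2
  rw [abs_lt]
  constructor <;> linarith

lemma dyCube_zero (x : Fin d → ℤ) : dyCube 0 x = {x} := by
  ext y
  simp [mem_dyCube, funext_iff]

/-- A function is `n`-measurable if it is constant on dyadic cubes of side `2^n`. -/
def DyMeas {α : Type*} (n : ℕ) (g : (Fin d → ℤ) → α) : Prop :=
  ∀ x y, y ∈ dyCube n x → g y = g x

lemma DyMeas.mono {α : Type*} {m n : ℕ} (hmn : m ≤ n) {g : (Fin d → ℤ) → α} (h : DyMeas n g) :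
    DyMeas m g := fun x y hy => h x y (mem_dyCube_mono hmn hy)

/-- Dyadic conditional expectation of an extended nonnegative function. -/
def eExp (n : ℕ) (h : (Fin d → ℤ) → ℝ≥0∞) (x : Fin d → ℤ) : ℝ≥0∞ :=
  (2 ^ (n * d))⁻¹ * ∑ y ∈ dyCube n x, h y

/-- Dyadic conditional expectation of a real function. -/
def cExp (n : ℕ) (h : (Fin d → ℤ) → ℝ) (x : Fin d → ℤ) : ℝ :=
  (2 ^ (n * d))⁻¹ * ∑ y ∈ dyCube n x, h y

lemma eExp_meas (n : ℕ) (h : (Fin d → ℤ) → ℝ≥0∞) : DyMeas n (eExp n h) := by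
  intro x y hy
  simp only [eExp, dyCube_eq hy]

lemma cExp_meas (n : ℕ) (h : (Fin d → ℤ) → ℝ) : DyMeas n (cExp n h) := by
  intro x y hy
  simp only [cExp, dyCube_eq hy]

lemma cExp_zero (h : (Fin d → ℤ) → ℝ) : cExp 0 h = h := by
  ext x; simp [cExp, dyCube_zero]

lemma eExp_zero (h : (Fin d → ℤ) → ℝ≥0∞) : eExp 0 h = h := by
  ext x; simp [eExp, dyCube_zero]

lemma two_pow_inv_mul_self (k : ℕ) : ((2 : ℝ≥0∞) ^ k)⁻¹ * 2 ^ k = 1 :=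
  ENNReal.inv_mul_cancel (by positivity) (by simp)

lemma eExp_of_meas {n : ℕ} {g : (Fin d → ℤ) → ℝ≥0∞} (hg : DyMeas n g) : eExp n g = g := by
  ext x
  rw [eExp, Finset.sum_congr rfl (fun y hy => hg x y hy), Finset.sum_const, card_dyCube,
    nsmul_eq_mul, ← mul_assoc]
  push_cast
  rw [two_pow_inv_mul_self, one_mul]

lemma sum_dyCube_eq (n : ℕ) (h : (Fin d → ℤ) → ℝ) (x : Fin d → ℤ) :
    ∑ y ∈ dyCube n x, h y = 2 ^ (n * d) * cExp n h x := by
  rw [cExp, ← mul_assoc, mul_inv_cancel₀ (by positivity), one_mul]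

/-- Sums over cubes in symmetric form. -/
lemma tsum_sum_symm {K : (Fin d → ℤ) → Finset (Fin d → ℤ)} (hK : ∀ x y, y ∈ K x ↔ x ∈ K y)
    (g h : (Fin d → ℤ) → ℝ≥0∞) :
    ∑' x, (∑ y ∈ K x, h y) * g x = ∑' x, h x * ∑ y ∈ K x, g y := by
  classical
  have e1 : ∀ x, (∑ y ∈ K x, h y) * g x = ∑' y, if y ∈ K x then h y * g x else 0 := by
    intro x
    rw [Finset.sum_mul, tsum_eq_sum (s := K x)]
    · exact Finset.sum_congr rfl fun y hy => by simp [hy]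
    · intro y hy; simp [hy]
  have e2 : ∀ x, h x * (∑ y ∈ K x, g y) = ∑' y, if x ∈ K y then h x * g y else 0 := by
    intro x
    rw [Finset.mul_sum, tsum_eq_sum (s := K x)]
    · exact Finset.sum_congr rfl fun y hy => by simp [(hK x y).1 hy]
    · intro y hy; rw [hK] at hy; simp [hy]
  simp_rw [e1, e2]
  rw [ENNReal.tsum_comm]

lemma tsum_eExp_mul (n : ℕ) (g h : (Fin d → ℤ) → ℝ≥0∞) :
    ∑' x, eExp n h x * g x = ∑' x, h x * eExp n g x := by
  have := tsum_sum_symm (K := fun x => dyCube n x) (fun _ _ => mem_dyCube_comm) g h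
  simp only [eExp, mul_assoc, mul_left_comm _ ((2 ^ (n * d))⁻¹ : ℝ≥0∞)]
  rw [ENNReal.tsum_mul_left, ENNReal.tsum_mul_left, this]

lemma tsum_mul_meas (n : ℕ) {g h : (Fin d → ℤ) → ℝ≥0∞} (hg : DyMeas n g) :
    ∑' x, h x * g x = ∑' x, eExp n h x * g x := by
  rw [tsum_eExp_mul, eExp_of_meas hg]

/-- Comparison of weighted sums from comparison on every dyadic cube. -/
lemma tsum_ofReal_mul_le {n : ℕ} {N : (Fin d → ℤ) → ℝ≥0∞} (hN : DyMeas n N)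
    {φ ψ : (Fin d → ℤ) → ℝ} (hφ : ∀ x, 0 ≤ φ x) (hψ : ∀ x, 0 ≤ ψ x)
    (h : ∀ x, ∑ y ∈ dyCube n x, φ y ≤ ∑ y ∈ dyCube n x, ψ y) :
    ∑' x, ENNReal.ofReal (φ x) * N x ≤ ∑' x, ENNReal.ofReal (ψ x) * N x := by
  rw [tsum_mul_meas n (h := fun x => ENNReal.ofReal (φ x)) hN,
    tsum_mul_meas n (h := fun x => ENNReal.ofReal (ψ x)) hN]
  refine ENNReal.tsum_le_tsum fun x => ?_
  gcongr
  unfold eExp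
  rw [← ENNReal.ofReal_sum_of_nonneg fun y _ => hφ y,
    ← ENNReal.ofReal_sum_of_nonneg fun y _ => hψ y]
  gcongr _ * ENNReal.ofReal ?_
  exact h x

lemma sum_dyCube_tower {M : Type*} [AddCommMonoid M] {m n : ℕ} (hmn : m ≤ n)
    (h : (Fin d → ℤ) → M) (x : Fin d → ℤ) :
    ∑ y ∈ dyCube n x, ∑ z ∈ dyCube m y, h z = 2 ^ (m * d) • ∑ y ∈ dyCube n x, h y := by
  rw [Finset.sum_comm' (t' := dyCube n x) (s' := fun z => dyCube m z)]
  · simp [card_dyCube, Finset.smul_sum]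
  · intro y z
    constructor
    · rintro ⟨hy, hz⟩
      refine ⟨mem_dyCube_comm.1 hz, ?_⟩
      rw [← dyCube_eq hy]
      exact mem_dyCube_mono hmn hz
    · rintro ⟨hy, hz⟩
      refine ⟨?_, mem_dyCube_comm.1 hy⟩
      rw [← dyCube_eq hz]
      exact mem_dyCube_mono hmn hy

lemma cExp_cExp {m n : ℕ} (hmn : m ≤ n) (h : (Fin d → ℤ) → ℝ) (x : Fin d → ℤ) :
    cExp n (cExp m h) x = cExp n h x := by
  simp only [cExp, ← Finset.mul_sum]
  rw [sum_dyCube_tower hmn, nsmul_eq_mul]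
  push_cast
  rw [← mul_assoc ((2 ^ (m * d))⁻¹ : ℝ), inv_mul_cancel₀ (by positivity), one_mul]

lemma sum_dyCube_cExp {m n : ℕ} (hmn : m ≤ n) (h : (Fin d → ℤ) → ℝ) (x : Fin d → ℤ) :
    ∑ y ∈ dyCube n x, cExp m h y = ∑ y ∈ dyCube n x, h y := by
  rw [sum_dyCube_eq, sum_dyCube_eq, cExp_cExp hmn]

lemma cExp_pos {f : (Fin d → ℤ) → ℝ} (hf : ∀ x, 0 < f x) (n : ℕ) (x : Fin d → ℤ) :
    0 < cExp n f x := by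
  unfold cExp
  have := Finset.sum_pos (fun y _ => hf y) ⟨x, self_mem_dyCube n x⟩
  positivity

lemma ofReal_cExp {f : (Fin d → ℤ) → ℝ} (hf : ∀ x, 0 ≤ f x) (n : ℕ) (x : Fin d → ℤ) :
    ENNReal.ofReal (cExp n f x) = eExp n (fun y => ENNReal.ofReal (f y)) x := by
  unfold cExp eExp
  rw [ENNReal.ofReal_mul (by positivity), ENNReal.ofReal_sum_of_nonneg fun y _ => hf y,
    ENNReal.ofReal_inv_of_pos (by positivity), ENNReal.ofReal_pow (by norm_num)]
  simp

lemma dyCube_subset {m n : ℕ} (hmn : m ≤ n) (x : Fin d → ℤ) : dyCube m x ⊆ dyCube n x :=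
  fun _ hy => mem_dyCube_mono hmn hy

lemma cExp_le_succ {f : (Fin d → ℤ) → ℝ} (hf : ∀ x, 0 ≤ f x) (n : ℕ) (x : Fin d → ℤ) :
    cExp n f x ≤ 2 ^ d * cExp (n + 1) f x := by
  unfold cExp
  have h1 : ∑ y ∈ dyCube n x, f y ≤ ∑ y ∈ dyCube (n + 1) x, f y :=
    Finset.sum_le_sum_of_subset_of_nonneg (dyCube_subset (by omega) x) fun y _ _ => hf y
  have h2 : (2 : ℝ) ^ d * (2 ^ ((n + 1) * d))⁻¹ = (2 ^ (n * d))⁻¹ := by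
    rw [add_mul, pow_add, one_mul]; field_simp
  rw [← mul_assoc, h2]
  gcongr

lemma eExp_le_succ (f : (Fin d → ℤ) → ℝ≥0∞) (n : ℕ) (x : Fin d → ℤ) :
    eExp n f x ≤ 2 ^ d * eExp (n + 1) f x := by
  unfold eExp
  have h1 : ∑ y ∈ dyCube n x, f y ≤ ∑ y ∈ dyCube (n + 1) x, f y :=
    Finset.sum_le_sum_of_subset (dyCube_subset (by omega) x)
  have h2 : (2 : ℝ≥0∞) ^ d * (2 ^ ((n + 1) * d))⁻¹ = (2 ^ (n * d))⁻¹ := by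
    rw [add_mul, pow_add, one_mul, ENNReal.mul_inv (by simp) (by simp), mul_left_comm,
      ENNReal.mul_inv_cancel (by positivity) (by simp), mul_one]
  rw [← mul_assoc, h2]
  gcongr

/-- Hölder's inequality for unconditional sums. -/
lemma tsum_mul_le_Lp_mul_Lq {α : Type*} {p q : ℝ} (hpq : p.HolderConjugate q) (f g : α → ℝ≥0∞) :
    ∑' x, f x * g x ≤ (∑' x, f x ^ p) ^ (1 / p) * (∑' x, g x ^ q) ^ (1 / q) := by
  let _ : MeasurableSpace α := ⊤
  have := ENNReal.lintegral_mul_le_Lp_mul_Lq (Measure.count (α := α)) hpq (f := f) (g := g)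
    (measurable_from_top).aemeasurable (measurable_from_top).aemeasurable
  simpa [lintegral_count] using this

/-- Monotone convergence for sums. -/
lemma tsum_iSup_le_of_monotone {α : Type*} {g : ℕ → α → ℝ≥0∞} (hg : Monotone g) {B : ℝ≥0∞}
    (h : ∀ n, ∑' x, g n x ≤ B) : ∑' x, (⨆ n, g n x) ≤ B := by
  let _ : MeasurableSpace α := ⊤
  have := lintegral_iSup (μ := Measure.count (α := α)) (f := g) (fun n => measurable_from_top) hg
  simp only [lintegral_count] at this
  rw [this]
  exact iSup_le h

lemma iSup_rpow {ι : Sort*} (g : ι → ℝ≥0∞) {p : ℝ} (hp : 0 < p) :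
    (⨆ i, g i) ^ p = ⨆ i, g i ^ p :=
  (ENNReal.orderIsoRpow p hp).map_iSup g

lemma tsum_iSup_rpow_le {α : Type*} {g : ℕ → α → ℝ≥0∞} (hg : Monotone g) {p : ℝ} (hp : 0 < p)
    {B : ℝ≥0∞} (h : ∀ n, ∑' x, g n x ^ p ≤ B) : ∑' x, (⨆ n, g n x) ^ p ≤ B := by
  simp_rw [iSup_rpow _ hp]
  refine tsum_iSup_le_of_monotone (g := fun n x => g n x ^ p) (fun m n hmn x => ?_) h
  exact ENNReal.rpow_le_rpow (hg hmn x) hp.le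

/-- If `∑ N^p ≤ C ∑ N^(p-1) h` and the left side is finite then `∑ N^p ≤ C^p ∑ h^p`. -/
lemma tsum_rpow_le_of_self_bound {α : Type*} {p : ℝ} (hp : 1 < p) {N h : α → ℝ≥0∞} {C : ℝ≥0∞}
    (hfin : ∑' x, N x ^ p ≠ ∞) (hN : ∑' x, N x ^ p ≤ C * ∑' x, N x ^ (p - 1) * h x) :
    ∑' x, N x ^ p ≤ C ^ p * ∑' x, h x ^ p := by
  have hp0 : 0 < p := by linarith
  have hpq : (p / (p - 1)).HolderConjugate p := (Real.HolderConjugate.conjExponent hp).symm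
  have h1 := tsum_mul_le_Lp_mul_Lq hpq (fun x => N x ^ (p - 1)) h
  have h2 : ∀ x, (N x ^ (p - 1)) ^ (p / (p - 1)) = N x ^ p := fun x => by
    rw [← ENNReal.rpow_mul, mul_div_cancel₀]; linarith
  simp_rw [h2] at h1
  set A := ∑' x, N x ^ p
  set B := ∑' x, h x ^ p
  rcases eq_or_ne A 0 with hA | hA
  · simp [hA]
  have h3 : A ^ (1 / p) ≤ C * B ^ (1 / p) := by
    have h4 : A ^ (1 / p) * A ^ (1 / (p / (p - 1))) ≤ C * B ^ (1 / p) * A ^ (1 / (p / (p - 1))) := by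
      rw [← ENNReal.rpow_add _ _ hA hfin]
      have : 1 / p + 1 / (p / (p - 1)) = 1 := by
        have : p - 1 ≠ 0 := by linarith
        field_simp; ring
      rw [this, ENNReal.rpow_one]
      calc A ≤ _ := hN
        _ ≤ C * (A ^ (1 / (p / (p - 1))) * B ^ (1 / p)) := by gcongr
        _ = _ := by ring
    refine (ENNReal.mul_le_mul_iff_left ?_ ?_).1 h4
    · simp [ENNReal.rpow_eq_zero_iff, hA, hfin]
    · refine ENNReal.rpow_ne_top_of_nonneg ?_ hfin
      have : 0 < p - 1 := by linarith
      positivity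
  calc A = (A ^ (1 / p)) ^ p := by rw [← ENNReal.rpow_mul, one_div_mul_cancel hp0.ne', ENNReal.rpow_one]
    _ ≤ (C * B ^ (1 / p)) ^ p := by gcongr
    _ = _ := by
      rw [ENNReal.mul_rpow_of_nonneg _ _ hp0.le, ← ENNReal.rpow_mul, one_div_mul_cancel hp0.ne',
        ENNReal.rpow_one]

/-- Jensen's inequality for uniform averages. -/
lemma avg_rpow_le {α : Type*} {s : Finset α} {k : ℕ} (hs : s.card = 2 ^ k) {p : ℝ} (hp : 1 ≤ p)
    (h : α → ℝ≥0∞) :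
    ((2 ^ k)⁻¹ * ∑ y ∈ s, h y) ^ p ≤ (2 ^ k)⁻¹ * ∑ y ∈ s, h y ^ p := by
  rw [Finset.mul_sum, Finset.mul_sum]
  refine ENNReal.rpow_arith_mean_le_arith_mean_rpow s (fun _ => (2 ^ k)⁻¹) h ?_ hp
  rw [Finset.sum_const, hs, nsmul_eq_mul, mul_comm]
  push_cast
  exact two_pow_inv_mul_self k

lemma eExp_rpow_le (n : ℕ) {p : ℝ} (hp : 1 ≤ p) (h : (Fin d → ℤ) → ℝ≥0∞) (x : Fin d → ℤ) :
    eExp n h x ^ p ≤ eExp n (fun y => h y ^ p) x :=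
  avg_rpow_le (card_dyCube n x) hp h

lemma tsum_eExp (n : ℕ) (h : (Fin d → ℤ) → ℝ≥0∞) : ∑' x, eExp n h x = ∑' x, h x := by
  have := tsum_eExp_mul n (fun _ => 1) h
  rw [eExp_of_meas (g := fun _ => (1 : ℝ≥0∞)) (fun _ _ _ => rfl)] at this
  simpa using this

/-- The dyadic maximal function over the scales `k, …, S`. -/
def dyMax (S k : ℕ) (h : (Fin d → ℤ) → ℝ≥0∞) (x : Fin d → ℤ) : ℝ≥0∞ :=
  (Finset.Icc k S).sup fun j => eExp j h x

lemma eExp_le_dyMax {S j : ℕ} (hj : j ≤ S) (h : (Fin d → ℤ) → ℝ≥0∞) (x : Fin d → ℤ) :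
    eExp j h x ≤ dyMax S 0 h x :=
  Finset.le_sup (f := fun j => eExp j h x) (by simp [hj])

lemma dyMax_eq_max {S k : ℕ} (hk : k ≤ S) (h : (Fin d → ℤ) → ℝ≥0∞) (x : Fin d → ℤ) :
    dyMax S k h x = max (eExp k h x) (dyMax S (k + 1) h x) := by
  unfold dyMax
  rw [← Finset.insert_Icc_add_one_left_eq_Icc hk, Finset.sup_insert]

lemma dyMax_meas (S k : ℕ) (h : (Fin d → ℤ) → ℝ≥0∞) : DyMeas k (dyMax S k h) := by
  intro x y hy
  refine Finset.sup_congr rfl fun j hj => ?_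
  exact (eExp_meas j h).mono (Finset.mem_Icc.1 hj).1 x y hy

lemma rpow_step_le {p : ℝ} (hp : 1 < p) {x y : ℝ≥0∞} (hxy : y ≤ x) (hx : x ≠ ∞) :
    x ^ p ≤ y ^ p + ENNReal.ofReal (p / (p - 1)) * ((x ^ (p - 1) - y ^ (p - 1)) * x) := by
  have hp0 : 0 < p := by linarith
  have hp1 : 0 < p - 1 := by linarith
  have hy : y ≠ ∞ := ne_top_of_le_ne_top hx hxy
  lift x to NNReal using hx
  lift y to NNReal using hy
  have hxy' : (y : ℝ) ≤ x := by exact_mod_cast hxy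
  have hx0 : (0 : ℝ) ≤ x := x.coe_nonneg
  have hy0 : (0 : ℝ) ≤ y := y.coe_nonneg
  have h1 : (x : ℝ) ^ p ≤ y ^ p + p / (p - 1) * (((x : ℝ) ^ (p - 1) - y ^ (p - 1)) * x) := by
    have hY := Real.young_inequality_of_nonneg hx0 (Real.rpow_nonneg hy0 (p - 1))
      (Real.HolderConjugate.conjExponent hp)
    unfold Real.conjExponent at hY
    rw [← Real.rpow_mul hy0, mul_div_cancel₀ _ hp1.ne'] at hY
    have e : (x : ℝ) ^ p = x ^ (p - 1) * x := by
      rcases eq_or_lt_of_le hx0 with h | h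
      · rw [← h, Real.zero_rpow hp0.ne', mul_zero]
      · rw [Real.rpow_sub_one h.ne', div_mul_cancel₀ _ h.ne']
    have e2 : p / (p - 1) * (((x : ℝ) ^ (p - 1) - y ^ (p - 1)) * x)
        = p / (p - 1) * x ^ p - p / (p - 1) * (x * y ^ (p - 1)) := by rw [e]; ring
    rw [e2]
    have h3 : p / (p - 1) * (x * (y : ℝ) ^ (p - 1)) ≤ p / (p - 1) * (x ^ p / p + y ^ p / (p / (p - 1))) := by
      gcongr
    have h4 : p / (p - 1) * ((x : ℝ) ^ p / p + y ^ p / (p / (p - 1))) = x ^ p / (p - 1) + y ^ p := by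
      field_simp
    have h5 : p / (p - 1) * (x : ℝ) ^ p = x ^ p / (p - 1) + x ^ p := by field_simp; ring
    linarith
  have h6 : (0 : ℝ) ≤ (x : ℝ) ^ (p - 1) - y ^ (p - 1) := by
    have := Real.rpow_le_rpow hy0 hxy' hp1.le
    linarith [this]
  have h7 := ENNReal.ofReal_le_ofReal h1
  have hx' : (x : ℝ≥0∞) = ENNReal.ofReal x := by simp
  have hy' : (y : ℝ≥0∞) = ENNReal.ofReal y := by simp
  rw [hx', hy', ENNReal.ofReal_rpow_of_nonneg hx0 hp0.le, ENNReal.ofReal_rpow_of_nonneg hy0 hp0.le,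
    ENNReal.ofReal_rpow_of_nonneg hx0 hp1.le, ENNReal.ofReal_rpow_of_nonneg hy0 hp1.le,
    ← ENNReal.ofReal_sub _ (Real.rpow_nonneg hy0 _), ← ENNReal.ofReal_mul h6,
    ← ENNReal.ofReal_mul (by positivity), ← ENNReal.ofReal_add (by positivity)]
  · exact h7
  · have := mul_nonneg h6 hx0
    positivity

lemma sum_range_tsub_le (a : ℕ → ℝ≥0∞) (ha : Antitone a) (n : ℕ) :
    (∑ k ∈ Finset.range n, (a k - a (k + 1))) + a n = a 0 := by
  induction n with
  | zero => simp
  | succ n ih =>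
    rw [Finset.sum_range_succ, add_assoc, tsub_add_cancel_of_le (ha (by omega)), ih]

lemma dyMax_anti (S : ℕ) (h : (Fin d → ℤ) → ℝ≥0∞) (x : Fin d → ℤ) :
    Antitone fun k => dyMax S k h x :=
  fun _ _ hab => Finset.sup_mono (Finset.Icc_subset_Icc_left hab)

/-- Doob's maximal inequality. -/
theorem tsum_dyMax_rpow_le {p : ℝ} (hp : 1 < p) (S : ℕ) (h : (Fin d → ℤ) → ℝ≥0∞) :
    ∑' x, dyMax S 0 h x ^ p ≤ ENNReal.ofReal (p / (p - 1)) ^ p * ∑' x, h x ^ p := by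
  have hp0 : 0 < p := by linarith
  have hp1 : 0 < p - 1 := by linarith
  set c := ENNReal.ofReal (p / (p - 1)) with hc
  have hc0 : c ^ p ≠ 0 := by
    rw [Ne, ENNReal.rpow_eq_zero_iff, not_or]
    constructor
    · rintro ⟨h, -⟩
      rw [hc, ENNReal.ofReal_eq_zero] at h
      have : 0 < p / (p - 1) := by positivity
      linarith
    · rintro ⟨h, -⟩; simp [hc] at h
  by_cases hfin : ∑' x, h x ^ p = ∞
  · rw [hfin, ENNReal.mul_top hc0]; exact le_top
  have hE : ∀ k, ∑' x, eExp k h x ^ p ≤ ∑' x, h x ^ p := fun k => by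
    rw [← tsum_eExp k (fun x => h x ^ p)]
    exact ENNReal.tsum_le_tsum fun x => eExp_rpow_le k hp.le h x
  have hEfin : ∀ k x, eExp k h x ≠ ∞ := by
    intro k x hx
    refine hfin (top_le_iff.1 (le_trans ?_ (hE k)))
    refine le_trans ?_ (ENNReal.le_tsum x)
    rw [hx, ENNReal.top_rpow_of_pos hp0]
  have hNfin : ∀ k x, dyMax S k h x ≠ ∞ := by
    intro k x
    rw [← lt_top_iff_ne_top, dyMax, Finset.sup_lt_iff (by simp)]
    exact fun j _ => lt_top_iff_ne_top.2 (hEfin j x)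
  refine tsum_rpow_le_of_self_bound hp ?_ ?_
  · have h1 : ∀ x, dyMax S 0 h x ^ p ≤ ∑ k ∈ Finset.Icc 0 S, eExp k h x ^ p := by
      intro x
      obtain ⟨j, hj, hj'⟩ := Finset.exists_mem_eq_sup (Finset.Icc 0 S) (by simp)
        (fun j => eExp j h x)
      rw [dyMax, hj']
      exact Finset.single_le_sum (f := fun k => eExp k h x ^ p) (by simp) hj
    refine ne_top_of_le_ne_top ?_ (ENNReal.tsum_le_tsum h1)
    rw [Summable.tsum_finsetSum fun _ _ => ENNReal.summable]
    exact ENNReal.sum_ne_top.2 fun k _ => ne_top_of_le_ne_top hfin (hE k)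
  · have h1 : ∀ x, ∀ n ≤ S + 1, dyMax S 0 h x ^ p ≤ ∑ k ∈ Finset.range n,
        c * ((dyMax S k h x ^ (p - 1) - dyMax S (k + 1) h x ^ (p - 1)) * eExp k h x)
          + dyMax S n h x ^ p := by
      intro x n
      induction n with
      | zero => simp
      | succ n ih =>
        intro hn
        refine (ih (by omega)).trans ?_
        rw [Finset.sum_range_succ, add_assoc]
        gcongr
        have hm := dyMax_eq_max (S := S) (k := n) (by omega) h x
        rcases le_total (eExp n h x) (dyMax S (n + 1) h x) with h2 | h2
        · rw [max_eq_right h2] at hm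
          rw [hm]; exact le_add_self
        · rw [max_eq_left h2] at hm
          rw [add_comm]
          have := rpow_step_le hp (h2.trans_eq hm.symm) (hNfin n x)
          rwa [← hm]
    have h2 : ∀ x, dyMax S 0 h x ^ p ≤ ∑ k ∈ Finset.range (S + 1),
        c * ((dyMax S k h x ^ (p - 1) - dyMax S (k + 1) h x ^ (p - 1)) * eExp k h x) := by
      intro x
      have := h1 x (S + 1) le_rfl
      rwa [show dyMax S (S + 1) h x = 0 by simp [dyMax], ENNReal.zero_rpow_of_pos hp0,
        add_zero] at this
    calc ∑' x, dyMax S 0 h x ^ p ≤ _ := ENNReal.tsum_le_tsum h2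
      _ = ∑ k ∈ Finset.range (S + 1), c * ∑' x,
          h x * (dyMax S k h x ^ (p - 1) - dyMax S (k + 1) h x ^ (p - 1)) := by
        rw [Summable.tsum_finsetSum fun _ _ => ENNReal.summable]
        refine Finset.sum_congr rfl fun k _ => ?_
        rw [ENNReal.tsum_mul_left, tsum_mul_meas k (h := h)]
        · simp_rw [mul_comm]
        · intro x y hy
          beta_reduce
          rw [dyMax_meas S k h x y hy, (dyMax_meas S (k + 1) h).mono (Nat.le_succ k) x y hy]
      _ = c * ∑' x, h x * ∑ k ∈ Finset.range (S + 1),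
          (dyMax S k h x ^ (p - 1) - dyMax S (k + 1) h x ^ (p - 1)) := by
        rw [← Finset.mul_sum, ← Summable.tsum_finsetSum fun _ _ => ENNReal.summable]
        simp_rw [Finset.mul_sum]
      _ ≤ _ := by
        simp_rw [mul_comm (h _)]
        gcongr with x
        rw [← sum_range_tsub_le (fun k => dyMax S k h x ^ (p - 1))
          (fun a b hab => ENNReal.rpow_le_rpow (dyMax_anti S h x hab) hp1.le) (S + 1)]
        exact le_self_add

/-- The cube of sidelength about `2^(n+3)` centred at `x`. -/
def ctrCube (n : ℕ) (x : Fin d → ℤ) : Finset (Fin d → ℤ) :=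
  Fintype.piFinset fun i => Finset.Icc (x i - 2 ^ (n + 2)) (x i + 2 ^ (n + 2))

lemma mem_ctrCube {n : ℕ} {x y : Fin d → ℤ} :
    y ∈ ctrCube n x ↔ ∀ i, |y i - x i| ≤ 2 ^ (n + 2) := by
  simp only [ctrCube, Fintype.mem_piFinset, Finset.mem_Icc, abs_le]
  refine forall_congr' fun i => ?_
  constructor <;> rintro ⟨h1, h2⟩ <;> constructor <;> linarith

lemma mem_ctrCube_comm {n : ℕ} {x y : Fin d → ℤ} : y ∈ ctrCube n x ↔ x ∈ ctrCube n y := by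
  simp only [mem_ctrCube, abs_sub_comm]

lemma dyCube_subset_ctrCube (n : ℕ) (x : Fin d → ℤ) : dyCube n x ⊆ ctrCube n x := by
  intro y hy
  rw [mem_ctrCube]
  intro i
  have h1 := abs_sub_lt_of_mem_dyCube hy i
  rw [abs_sub_comm] at h1
  refine h1.le.trans ?_
  exact pow_le_pow_right₀ (by norm_num) (by omega)

/-- Averages over centred cubes. -/
def ctrAvg (n : ℕ) (h : (Fin d → ℤ) → ℝ≥0∞) (x : Fin d → ℤ) : ℝ≥0∞ :=
  (2 ^ (n * d))⁻¹ * ∑ y ∈ ctrCube n x, h y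

/-- The centred Hardy–Littlewood maximal function at dyadic scales. -/
def maxFn (h : (Fin d → ℤ) → ℝ≥0∞) (x : Fin d → ℤ) : ℝ≥0∞ := ⨆ n, ctrAvg n h x

lemma eExp_le_ctrAvg (n : ℕ) (h : (Fin d → ℤ) → ℝ≥0∞) (x : Fin d → ℤ) :
    eExp n h x ≤ ctrAvg n h x := by
  unfold eExp ctrAvg
  gcongr
  exact dyCube_subset_ctrCube n x

lemma ctrAvg_le_maxFn (n : ℕ) (h : (Fin d → ℤ) → ℝ≥0∞) (x : Fin d → ℤ) :
    ctrAvg n h x ≤ maxFn h x := le_iSup (fun n => ctrAvg n h x) n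

lemma eExp_le_maxFn (n : ℕ) (h : (Fin d → ℤ) → ℝ≥0∞) (x : Fin d → ℤ) :
    eExp n h x ≤ maxFn h x := (eExp_le_ctrAvg n h x).trans (ctrAvg_le_maxFn n h x)

lemma le_maxFn (h : (Fin d → ℤ) → ℝ≥0∞) (x : Fin d → ℤ) : h x ≤ maxFn h x := by
  have := eExp_le_maxFn 0 h x
  rwa [eExp_zero] at this

lemma maxFn_mono {g h : (Fin d → ℤ) → ℝ≥0∞} (hgh : ∀ x, g x ≤ h x) (x : Fin d → ℤ) :
    maxFn g x ≤ maxFn h x := by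
  unfold maxFn ctrAvg
  gcongr
  exact hgh _

lemma tsum_ctrAvg_mul (n : ℕ) (g h : (Fin d → ℤ) → ℝ≥0∞) :
    ∑' x, ctrAvg n h x * g x = ∑' x, h x * ctrAvg n g x := by
  have := tsum_sum_symm (K := fun x => ctrCube n x) (fun _ _ => mem_ctrCube_comm) g h
  simp only [ctrAvg, mul_assoc, mul_left_comm _ ((2 ^ (n * d))⁻¹ : ℝ≥0∞)]
  rw [ENNReal.tsum_mul_left, ENNReal.tsum_mul_left, this]

lemma exists_three_mul_add_one (i : ℕ) : ∃ c : ℤ, 0 ≤ c ∧ 3 * c + 1 = 4 ^ i := by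
  induction i with
  | zero => exact ⟨0, by norm_num⟩
  | succ i ih =>
    obtain ⟨c, hc0, hc⟩ := ih
    exact ⟨4 * c + 1, by omega, by rw [pow_succ, ← hc]; ring⟩

/-- The one-third trick in one dimension. -/
lemma one_third_trick {u : ℤ} {K n j : ℕ} (hu : 3 * u + 1 = 4 ^ K) (hj : j ≤ K)
    (h1 : n + 5 ≤ 2 * j) (a : ℤ) :
    (∀ b, |b - a| ≤ 2 ^ (n + 2) → (b + 0) / 2 ^ (2 * j) = (a + 0) / 2 ^ (2 * j)) ∨
    (∀ b, |b - a| ≤ 2 ^ (n + 2) → (b + u) / 2 ^ (2 * j) = (a + u) / 2 ^ (2 * j)) := by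
  obtain ⟨w, hw0, hw⟩ := exists_three_mul_add_one j
  obtain ⟨c, hc0, hc⟩ := exists_three_mul_add_one (K - j)
  have hL : (2 : ℤ) ^ (2 * j) = 4 ^ j := by rw [pow_mul]; norm_num
  rw [hL]
  have hR : (8 : ℤ) * 2 ^ (n + 2) ≤ 4 ^ j := by
    rw [← hL, show (8 : ℤ) = 2 ^ 3 by norm_num, ← pow_add]
    exact pow_le_pow_right₀ (by norm_num) (by omega)
  have hK : (4 : ℤ) ^ K = 4 ^ j * 4 ^ (K - j) := by rw [← pow_add]; congr 1; omega
  have hR0 : (0 : ℤ) < 2 ^ (n + 2) := by positivity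
  have huw : u = 4 ^ j * c + w := by
    rw [hK, ← hc] at hu
    linarith
  set R : ℤ := 2 ^ (n + 2)
  set L : ℤ := 4 ^ j
  have hL0 : 0 < L := by linarith
  have key : ∀ s r e : ℤ, 0 ≤ r → r < L → (L * s + r) / L = s := by
    intro s r e h0 h1
    rw [Int.ediv_eq_iff_of_pos hL0]
    constructor <;> linarith
  have ha := Int.mul_ediv_add_emod a L
  have hr0 := Int.emod_nonneg a hL0.ne'
  have hr1 := Int.emod_lt_of_pos a hL0
  set s := a / L
  set r := a % L
  by_cases hin : R ≤ r ∧ r + R < L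
  · left
    intro b hb
    rw [abs_le] at hb
    rw [show b + 0 = L * s + (r + (b - a)) by linarith, show a + 0 = L * s + r by linarith,
      key _ _ 0 (by linarith) (by linarith), key _ _ 0 (by linarith) (by linarith)]
  · right
    intro b hb
    rw [abs_le] at hb
    by_cases hr : R ≤ r
    · have h3 : L ≤ r + R := by
        by_contra h; exact hin ⟨hr, by linarith⟩
      rw [show b + u = L * (s + c + 1) + (r - L + w + (b - a)) by rw [huw]; linarith,
        show a + u = L * (s + c + 1) + (r - L + w) by rw [huw]; linarith,
        key _ _ 0 (by linarith) (by linarith), key _ _ 0 (by linarith) (by linarith)]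
    · rw [show b + u = L * (s + c) + (r + w + (b - a)) by rw [huw]; linarith,
        show a + u = L * (s + c) + (r + w) by rw [huw]; linarith,
        key _ _ 0 (by linarith) (by linarith), key _ _ 0 (by linarith) (by linarith)]

lemma ctrAvg_le_sum_shift {u : ℤ} {K n : ℕ} (hu : 3 * u + 1 = 4 ^ K) (hn : n + 6 ≤ 2 * K)
    (h : (Fin d → ℤ) → ℝ≥0∞) (x : Fin d → ℤ) :
    ∃ v ∈ Fintype.piFinset (fun _ : Fin d => ({0, u} : Finset ℤ)),
      ctrAvg n h x ≤ 64 ^ d * dyMax (2 * K) 0 (fun y => h (y - v)) (x + v) := by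
  classical
  obtain ⟨j, hj1, hj2⟩ : ∃ j, n + 5 ≤ 2 * j ∧ 2 * j ≤ n + 6 := ⟨(n + 6) / 2, by omega, by omega⟩
  have hv : ∀ i : Fin d, ∃ v : ℤ, v ∈ ({0, u} : Finset ℤ) ∧
      ∀ b, |b - x i| ≤ 2 ^ (n + 2) → (b + v) / 2 ^ (2 * j) = (x i + v) / 2 ^ (2 * j) := by
    intro i
    rcases one_third_trick hu (by omega) hj1 (x i) with h | h
    · exact ⟨0, by simp, h⟩
    · exact ⟨u, by simp, h⟩
  choose v hv1 hv2 using hv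
  refine ⟨v, by simpa [Fintype.mem_piFinset] using hv1, ?_⟩
  calc ctrAvg n h x ≤ 64 ^ d * eExp (2 * j) (fun y => h (y - v)) (x + v) := by
        unfold ctrAvg eExp
        have h1 : ∑ y ∈ ctrCube n x, h y ≤ ∑ y ∈ dyCube (2 * j) (x + v), h (y - v) := by
          have : ∑ y ∈ ctrCube n x, h y
              = ∑ y ∈ (ctrCube n x).map (Equiv.addRight v).toEmbedding, h (y - v) := by
            simp
          rw [this]
          refine Finset.sum_le_sum_of_subset fun y hy => ?_
          simp only [Finset.mem_map_equiv] at hy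
          rw [mem_ctrCube] at hy
          rw [mem_dyCube]
          intro i
          have := hv2 i _ (hy i)
          simpa using this
        have h2 : ((2 : ℝ≥0∞) ^ (n * d))⁻¹ ≤ 64 ^ d * (2 ^ (2 * j * d))⁻¹ := by
          rw [← div_eq_mul_inv, ENNReal.le_div_iff_mul_le (by simp) (by simp), mul_comm,
            ← div_eq_mul_inv, ENNReal.div_le_iff_le_mul (by simp) (by simp),
            show (64 : ℝ≥0∞) = 2 ^ 6 by norm_num, ← pow_mul, ← pow_add, ← add_mul]
          exact pow_le_pow_right₀ (by norm_num) (by gcongr; omega)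
        rw [← mul_assoc]
        gcongr
    _ ≤ _ := by gcongr; exact eExp_le_dyMax (by omega) _ _

/-- The Hardy–Littlewood maximal inequality. -/
theorem exists_tsum_maxFn_rpow_le (d : ℕ) {p : ℝ} (hp : 1 < p) :
    ∃ C : ℝ≥0∞, C ≠ ∞ ∧ ∀ h : (Fin d → ℤ) → ℝ≥0∞,
      ∑' x, maxFn h x ^ p ≤ C * ∑' x, h x ^ p := by
  have hp0 : 0 < p := by linarith
  refine ⟨2 ^ d * ((64 ^ d) ^ p * ENNReal.ofReal (p / (p - 1)) ^ p), ?_, fun h => ?_⟩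
  · refine ENNReal.mul_ne_top (by simp) (ENNReal.mul_ne_top ?_ ?_)
    · exact ENNReal.rpow_ne_top_of_nonneg hp0.le (by simp)
    · exact ENNReal.rpow_ne_top_of_nonneg hp0.le (by simp)
  have e : ∀ x, maxFn h x = ⨆ n, (Finset.range (n + 1)).sup fun k => ctrAvg k h x := by
    intro x
    apply le_antisymm
    · exact iSup_le fun n => le_iSup_of_le n
        (Finset.le_sup (f := fun k => ctrAvg k h x) (Finset.self_mem_range_succ n))
    · exact iSup_le fun n => Finset.sup_le fun k _ => ctrAvg_le_maxFn k h x
  simp_rw [e]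
  refine tsum_iSup_rpow_le (g := fun n x => (Finset.range (n + 1)).sup fun k => ctrAvg k h x)
    (fun m n hmn x => Finset.sup_mono (Finset.range_subset_range.2 (by omega))) hp0 fun n₀ => ?_
  set K := n₀ + 6
  obtain ⟨u, -, hu⟩ := exists_three_mul_add_one K
  set V := Fintype.piFinset (fun _ : Fin d => ({0, u} : Finset ℤ)) with hV
  have h1 : ∀ x, ((Finset.range (n₀ + 1)).sup fun k => ctrAvg k h x) ^ p ≤
      ∑ v ∈ V, (64 ^ d) ^ p * dyMax (2 * K) 0 (fun y => h (y - v)) (x + v) ^ p := by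
    intro x
    obtain ⟨k, hk, hk'⟩ := Finset.exists_mem_eq_sup (Finset.range (n₀ + 1)) (by simp)
      (fun k => ctrAvg k h x)
    rw [hk']
    obtain ⟨v, hv, hv'⟩ := ctrAvg_le_sum_shift (n := k) hu
      (by have := Finset.mem_range.1 hk; omega) h x
    refine le_trans ?_ (Finset.single_le_sum (by simp) hv)
    rw [← ENNReal.mul_rpow_of_nonneg _ _ hp0.le]
    exact ENNReal.rpow_le_rpow hv' hp0.le
  refine (ENNReal.tsum_le_tsum h1).trans ?_
  rw [Summable.tsum_finsetSum fun _ _ => ENNReal.summable]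
  have h2 : ∀ v ∈ V, ∑' x, (64 ^ d) ^ p * dyMax (2 * K) 0 (fun y => h (y - v)) (x + v) ^ p
      ≤ (64 ^ d) ^ p * ENNReal.ofReal (p / (p - 1)) ^ p * ∑' x, h x ^ p := by
    intro v _
    rw [ENNReal.tsum_mul_left, mul_assoc]
    gcongr
    have e1 := (Equiv.addRight v).tsum_eq fun x => dyMax (2 * K) 0 (fun y => h (y - v)) x ^ p
    have e2 := (Equiv.subRight v).tsum_eq fun x => h x ^ p
    simp only [Equiv.coe_addRight, Equiv.subRight_apply] at e1 e2
    rw [e1, ← e2]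
    exact tsum_dyMax_rpow_le hp _ _
  refine (Finset.sum_le_sum h2).trans ?_
  rw [Finset.sum_const, nsmul_eq_mul, ← mul_assoc]
  gcongr
  have : V.card ≤ 2 ^ d := by
    rw [hV, Fintype.card_piFinset]
    simpa using Finset.prod_le_pow_card (Finset.univ : Finset (Fin d))
      (fun _ => ({0, u} : Finset ℤ).card) 2 fun _ _ => Finset.card_le_two
  exact_mod_cast this

/-- Weighted estimates imply norm estimates. -/
theorem tsum_rpow_le_of_weighted {α : Type*} {r r' : ℝ} (hr : r.HolderConjugate r')
    {F H : α → ℝ≥0∞} {W : (α → ℝ≥0∞) → α → ℝ≥0∞} {C C' : ℝ≥0∞}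
    (h1 : ∀ w : α → ℝ≥0∞, ∑' x, F x * w x ≤ C * ∑' x, H x * W w x)
    (h2 : ∀ w : α → ℝ≥0∞, ∑' x, W w x ^ r' ≤ C' * ∑' x, w x ^ r') :
    ∑' x, F x ^ r ≤ (C * C' ^ (1 / r')) ^ r * ∑' x, H x ^ r := by
  classical
  have hr1 := hr.lt
  have hr0 := hr.pos
  have hr'0 := hr.symm.pos
  have e : ∀ x, F x = ⨆ L : ℕ, min (F x) L := fun x => by
    rw [← inf_iSup_eq, ENNReal.iSup_natCast, inf_top_eq]
  conv_lhs => enter [1, x]; rw [e x]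
  refine tsum_iSup_rpow_le (g := fun (L : ℕ) x => min (F x) L)
    (fun m n hmn x => min_le_min_left _ (by exact_mod_cast hmn)) hr0 fun L => ?_
  rw [ENNReal.tsum_eq_iSup_sum]
  refine iSup_le fun T => ?_
  set w : α → ℝ≥0∞ := fun x => if x ∈ T then min (F x) L ^ (r - 1) else 0 with hw
  set A := ∑ x ∈ T, min (F x) L ^ r with hA
  set B := ∑' x, H x ^ r
  have hpow : ∀ a : ℝ≥0∞, a ^ r = a * a ^ (r - 1) := fun a => by
    conv_rhs => rw [← ENNReal.rpow_one a, ← ENNReal.rpow_mul, one_mul,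
      ← ENNReal.rpow_add_of_nonneg _ _ zero_le_one (by linarith)]
    congr 1; ring
  have hAw : A ≤ ∑' x, F x * w x := by
    rw [hA]
    refine le_trans (Finset.sum_le_sum fun x hx => ?_) (ENNReal.sum_le_tsum T)
    rw [hw]
    simp only [hx, if_true]
    rw [hpow]
    gcongr
    exact min_le_left _ _
  have hwr : ∑' x, w x ^ r' = A := by
    rw [tsum_eq_sum (s := T)]
    · refine Finset.sum_congr rfl fun x hx => ?_
      simp only [hw, hx, if_true]
      rw [← ENNReal.rpow_mul, hr.sub_one_mul_conj]
    · intro x hx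
      simp [hw, hx, hr'0]
  have hAfin : A ≠ ∞ := ENNReal.sum_ne_top.2 fun x _ =>
    ENNReal.rpow_ne_top_of_nonneg hr0.le (ne_top_of_le_ne_top (by simp) (min_le_right _ _))
  rcases eq_or_ne A 0 with hA0 | hA0
  · simp [hA0]
  have h3 : A ≤ C * (B ^ (1 / r) * (C' ^ (1 / r') * A ^ (1 / r'))) := by
    refine hAw.trans ((h1 w).trans ?_)
    gcongr
    refine (tsum_mul_le_Lp_mul_Lq hr _ _).trans ?_
    gcongr
    rw [← ENNReal.mul_rpow_of_nonneg _ _ (by positivity)]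
    gcongr
    rw [← hwr]
    exact h2 w
  have h4 : A ^ (1 / r) ≤ C * C' ^ (1 / r') * B ^ (1 / r) := by
    have h4 : A ^ (1 / r) * A ^ (1 / r') ≤ C * C' ^ (1 / r') * B ^ (1 / r) * A ^ (1 / r') := by
      rw [← ENNReal.rpow_add _ _ hA0 hAfin]
      have : 1 / r + 1 / r' = 1 := by simpa using hr.inv_add_inv_eq_one
      rw [this, ENNReal.rpow_one]
      refine h3.trans_eq (by ring)
    refine (ENNReal.mul_le_mul_iff_left ?_ ?_).1 h4
    · simp [ENNReal.rpow_eq_zero_iff, hA0, hAfin]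
    · exact ENNReal.rpow_ne_top_of_nonneg (by positivity) hAfin
  calc A = (A ^ (1 / r)) ^ r := by
        rw [← ENNReal.rpow_mul, one_div_mul_cancel hr0.ne', ENNReal.rpow_one]
    _ ≤ (C * C' ^ (1 / r') * B ^ (1 / r)) ^ r := by gcongr
    _ = _ := by
      rw [ENNReal.mul_rpow_of_nonneg _ _ hr0.le, ← ENNReal.rpow_mul, one_div_mul_cancel hr0.ne',
        ENNReal.rpow_one]

lemma one_add_mul_le_rpow {ε Λ y : ℝ} (h0 : 0 < ε) (h1 : ε < 1) (hy : 1 ≤ y) (hyΛ : y ≤ Λ) :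
    1 + ε / Λ * (y - 1) ≤ y ^ ε := by
  have hy0 : 0 < y := by linarith
  have h2 := rpow_one_add_le_one_add_mul_self (s := y⁻¹ - 1) (p := ε)
    (by have : 0 < y⁻¹ := by positivity
        linarith) h0.le h1.le
  rw [show 1 + (y⁻¹ - 1) = y⁻¹ by ring, Real.inv_rpow hy0.le] at h2
  have h3 : 0 < y ^ ε := by positivity
  have h4 : 1 ≤ (1 + ε * (y⁻¹ - 1)) * y ^ ε := by
    have := mul_le_mul_of_nonneg_right h2 h3.le
    rwa [inv_mul_cancel₀ h3.ne'] at this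
  have h5 : 0 ≤ ε * (1 - y⁻¹) := by
    have : y⁻¹ ≤ 1 := inv_le_one_of_one_le₀ hy
    have : 0 ≤ 1 - y⁻¹ := by linarith
    positivity
  have h6 : ε / Λ * (y - 1) ≤ ε * (1 - y⁻¹) := by
    have : ε * (1 - y⁻¹) = ε / y * (y - 1) := by field_simp
    rw [this]
    have : 0 ≤ y - 1 := by linarith
    gcongr
  have h7 : 1 ≤ y ^ ε := Real.one_le_rpow hy h0.le
  nlinarith

lemma rpow_sub_one_sub_ge {κ Λ y : ℝ} (h1 : 1 < κ) (h2 : κ < 2) (hΛ : 1 ≤ Λ) (hy0 : 0 ≤ y)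
    (hyΛ : y ≤ Λ) :
    κ * (κ - 1) / (2 * Λ) * (y - 1) ^ 2 ≤ y ^ κ - 1 - κ * (y - 1) := by
  set c := κ * (κ - 1) / (2 * Λ) with hc
  have hΛ0 : 0 < Λ := by linarith
  have hc' : 2 * c = κ * ((κ - 1) / Λ) := by rw [hc]; field_simp
  set g : ℝ → ℝ := fun y => y ^ κ - 1 - κ * (y - 1) - c * (y - 1) ^ 2 with hg
  have hd : ∀ z, HasDerivAt g (κ * z ^ (κ - 1) - κ - 2 * c * (z - 1)) z := by
    intro z
    have e1 := (Real.hasDerivAt_rpow_const (x := z) (p := κ) (Or.inr h1.le)).sub_const 1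
    have e2 := ((hasDerivAt_id z).sub_const 1).const_mul κ
    have e3 := (((hasDerivAt_id z).sub_const 1).pow 2).const_mul c
    have e4 : HasDerivAt g _ z := (e1.sub e2).sub e3
    exact e4.congr_deriv (by simp; ring)
  have hcont : Continuous g := continuous_iff_continuousAt.2 fun z => (hd z).continuousAt
  have g1 : g 1 = 0 := by simp [hg]
  have goal : 0 ≤ g y := by
    rcases le_total 1 y with hy | hy
    · have := monotoneOn_of_deriv_nonneg (convex_Icc 1 Λ) hcont.continuousOn
        (fun z _ => (hd z).differentiableAt.differentiableWithinAt) (fun z hz => by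
          rw [interior_Icc] at hz
          rw [(hd z).deriv, hc']
          have := one_add_mul_le_rpow (ε := κ - 1) (Λ := Λ) (y := z) (by linarith) (by linarith)
            hz.1.le hz.2.le
          nlinarith)
      have h3 := this (Set.left_mem_Icc.2 hΛ) ⟨hy, hyΛ⟩ hy
      rwa [g1] at h3
    · have := antitoneOn_of_deriv_nonpos (convex_Icc 0 1) hcont.continuousOn
        (fun z _ => (hd z).differentiableAt.differentiableWithinAt) (fun z hz => by
          rw [interior_Icc] at hz
          rw [(hd z).deriv, hc']
          have h3 := rpow_one_add_le_one_add_mul_self (s := z - 1) (p := κ - 1)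
            (by linarith [hz.1]) (by linarith) (by linarith)
          rw [show 1 + (z - 1) = z by ring] at h3
          have h4 : (κ - 1) / Λ ≤ κ - 1 := div_le_self (by linarith) hΛ
          have h5 : (κ - 1) / Λ * (1 - z) ≤ (κ - 1) * (1 - z) :=
            mul_le_mul_of_nonneg_right h4 (by linarith [hz.2])
          nlinarith)
      have h3 := this ⟨hy0, hy⟩ (Set.right_mem_Icc.2 zero_le_one) hy
      rwa [g1] at h3
  simp only [hg] at goal
  linarith

/-- Quantitative strict convexity of `y ↦ y^κ`. -/
lemma rpow_convexity {κ Λ x y : ℝ} (h1 : 1 < κ) (h2 : κ < 2) (hΛ : 1 ≤ Λ) (hx : 0 < x)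
    (hy0 : 0 ≤ y) (hyΛ : y ≤ Λ * x) :
    κ * (κ - 1) / (2 * Λ) * ((y - x) ^ 2 * x ^ (κ - 2)) + x ^ κ + κ * x ^ (κ - 1) * (y - x)
      ≤ y ^ κ := by
  have h3 := rpow_sub_one_sub_ge h1 h2 hΛ (y := y / x) (by positivity) (by rwa [div_le_iff₀ hx])
  have hxk : 0 < x ^ κ := by positivity
  have h4 := mul_le_mul_of_nonneg_right h3 hxk.le
  have e1 : (y / x) ^ κ * x ^ κ = y ^ κ := by
    rw [Real.div_rpow hy0 hx.le, div_mul_cancel₀ _ hxk.ne']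
  have e2 : x ^ (κ - 1) = x ^ κ / x := Real.rpow_sub_one hx.ne' κ
  have e3 : x ^ (κ - 2) = x ^ κ / x ^ 2 := by
    rw [show κ - 2 = κ - (2 : ℕ) by norm_num, Real.rpow_sub_natCast hx.ne']
  rw [e2, e3]
  have e4 : (y / x - 1) ^ 2 * x ^ κ = (y - x) ^ 2 * (x ^ κ / x ^ 2) := by field_simp
  have e5 : (y / x - 1) * x ^ κ = x ^ κ / x * (y - x) := by field_simp
  calc _ = κ * (κ - 1) / (2 * Λ) * ((y / x - 1) ^ 2 * x ^ κ) + x ^ κ + κ * ((y / x - 1) * x ^ κ) := by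
        rw [e4, e5]; ring
    _ ≤ _ := by linarith

/-- Dyadic martingale differences. -/
def dDiff (s : ℕ) (f : (Fin d → ℤ) → ℝ) (x : Fin d → ℤ) : ℝ := cExp s f x - cExp (s + 1) f x

lemma dDiff_meas (s : ℕ) (f : (Fin d → ℤ) → ℝ) : DyMeas s (dDiff s f) := by
  intro x y hy
  rw [dDiff, dDiff, cExp_meas s f x y hy, (cExp_meas (s + 1) f).mono (Nat.le_succ s) x y hy]

/-- The square function density `|D_s f|² f_{s+1}^{κ-2}`. -/
def sqDens (κ : ℝ) (s : ℕ) (f : (Fin d → ℤ) → ℝ) (x : Fin d → ℤ) : ℝ :=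
  dDiff s f x ^ 2 * cExp (s + 1) f x ^ (κ - 2)

lemma sqDens_nonneg {κ : ℝ} {s : ℕ} {f : (Fin d → ℤ) → ℝ} (hf : ∀ x, 0 < f x) (x : Fin d → ℤ) :
    0 ≤ sqDens κ s f x := by
  have := cExp_pos hf (s + 1) x
  unfold sqDens
  positivity

lemma sqDens_meas (κ : ℝ) (s : ℕ) (f : (Fin d → ℤ) → ℝ) : DyMeas s (sqDens κ s f) := by
  intro x y hy
  rw [sqDens, sqDens, dDiff_meas s f x y hy, (cExp_meas (s + 1) f).mono (Nat.le_succ s) x y hy]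

lemma sum_sqDens_le {κ : ℝ} (h1 : 1 < κ) (h2 : κ < 2) {f : (Fin d → ℤ) → ℝ} (hf : ∀ x, 0 < f x)
    (s : ℕ) (x : Fin d → ℤ) :
    ∑ y ∈ dyCube (s + 1) x, (cExp (s + 1) f y ^ κ + κ * (κ - 1) / (2 * 2 ^ d) * sqDens κ s f y)
      ≤ ∑ y ∈ dyCube (s + 1) x, cExp s f y ^ κ := by
  have h3 : ∑ y ∈ dyCube (s + 1) x, κ * cExp (s + 1) f y ^ (κ - 1) * dDiff s f y = 0 := by
    have : ∀ y ∈ dyCube (s + 1) x, κ * cExp (s + 1) f y ^ (κ - 1) * dDiff s f y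
        = κ * cExp (s + 1) f x ^ (κ - 1) * dDiff s f y := fun y hy => by
      rw [cExp_meas (s + 1) f x y hy]
    rw [Finset.sum_congr rfl this, ← Finset.mul_sum]
    simp only [dDiff]
    rw [Finset.sum_sub_distrib, sum_dyCube_cExp (Nat.le_succ s), sum_dyCube_cExp le_rfl, sub_self,
      mul_zero]
  rw [← add_zero (∑ y ∈ dyCube (s + 1) x, (_ + _)), ← h3, ← Finset.sum_add_distrib]
  refine Finset.sum_le_sum fun y _ => ?_
  have := rpow_convexity h1 h2 (one_le_pow₀ (by norm_num : (1 : ℝ) ≤ 2) (n := d))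
    (cExp_pos hf (s + 1) y) (cExp_pos hf s y).le (cExp_le_succ (fun x => (hf x).le) s y)
  simp only [sqDens, dDiff]
  linarith

/-- The tail maximal function `sup_{k ≥ s} E_k w`. -/
def tailMax (w : (Fin d → ℤ) → ℝ≥0∞) (s : ℕ) (x : Fin d → ℤ) : ℝ≥0∞ := ⨆ k, eExp (s + k) w x

lemma tailMax_meas (w : (Fin d → ℤ) → ℝ≥0∞) (s : ℕ) : DyMeas s (tailMax w s) := by
  intro x y hy
  unfold tailMax
  congr 1; ext k
  exact (eExp_meas (s + k) w).mono (Nat.le_add_right s k) x y hy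

lemma eExp_le_tailMax (w : (Fin d → ℤ) → ℝ≥0∞) (s : ℕ) (x : Fin d → ℤ) :
    eExp s w x ≤ tailMax w s x := le_iSup (fun k => eExp (s + k) w x) 0

lemma tailMax_anti (w : (Fin d → ℤ) → ℝ≥0∞) (x : Fin d → ℤ) : Antitone fun s => tailMax w s x := by
  intro s t hst
  refine iSup_le fun k => ?_
  obtain ⟨j, rfl⟩ := Nat.exists_eq_add_of_le hst
  rw [add_assoc]
  exact le_iSup (fun k => eExp (s + k) w x) (j + k)

lemma tailMax_le_maxFn (w : (Fin d → ℤ) → ℝ≥0∞) (s : ℕ) (x : Fin d → ℤ) :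
    tailMax w s x ≤ maxFn w x := iSup_le fun k => eExp_le_maxFn (s + k) w x

lemma tsum_meas_mul_le {s : ℕ} {φ : (Fin d → ℤ) → ℝ≥0∞} (hφ : DyMeas s φ)
    (w : (Fin d → ℤ) → ℝ≥0∞) :
    ∑' x, φ x * w x ≤ 2 ^ d * ∑' x, φ x * tailMax w (s + 1) x := by
  simp_rw [mul_comm (φ _)]
  rw [tsum_mul_meas s hφ, ← ENNReal.tsum_mul_left]
  refine ENNReal.tsum_le_tsum fun x => ?_
  rw [← mul_assoc]
  gcongr
  exact (eExp_le_succ w s x).trans (by gcongr; exact eExp_le_tailMax w (s + 1) x)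

/-- Weighted square function estimate with tail weights. -/
theorem sum_tsum_sqDens_tailMax_le {κ : ℝ} (h1 : 1 < κ) (h2 : κ < 2) {f : (Fin d → ℤ) → ℝ}
    (hf : ∀ x, 0 < f x) (w : (Fin d → ℤ) → ℝ≥0∞) (S : ℕ) :
    ∑ s ∈ Finset.range S, ∑' x, ENNReal.ofReal (sqDens κ s f x) * tailMax w (s + 1) x
      ≤ ENNReal.ofReal (2 * 2 ^ d / (κ * (κ - 1))) *
        ∑' x, ENNReal.ofReal (f x ^ κ) * maxFn w x := by
  have hκ : 0 < κ - 1 := by linarith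
  have hκ0 : 0 < κ := by linarith
  set c := κ * (κ - 1) / (2 * 2 ^ d) with hc
  have hc0 : 0 < c := by positivity
  have key : ∀ S, ENNReal.ofReal c * (∑ s ∈ Finset.range S,
      ∑' x, ENNReal.ofReal (sqDens κ s f x) * tailMax w (s + 1) x)
      + ∑' x, ENNReal.ofReal (cExp S f x ^ κ) * tailMax w S x
      ≤ ∑' x, ENNReal.ofReal (f x ^ κ) * tailMax w 0 x := by
    intro S
    induction S with
    | zero => simp [cExp_zero]
    | succ S ih =>
      refine le_trans ?_ ih
      rw [Finset.sum_range_succ, mul_add, add_assoc]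
      gcongr
      have h3 := tsum_ofReal_mul_le (tailMax_meas w (S + 1)) (fun x => by
          have := cExp_pos hf (S + 1) x
          have := sqDens_nonneg (κ := κ) (s := S) hf x
          positivity) (fun x => by
          have := cExp_pos hf S x
          positivity) (sum_sqDens_le h1 h2 hf S)
      calc _ = ∑' x, ENNReal.ofReal (cExp (S + 1) f x ^ κ + c * sqDens κ S f x)
              * tailMax w (S + 1) x := by
            rw [← ENNReal.tsum_mul_left, ← ENNReal.tsum_add]
            congr 1; ext x
            have := cExp_pos hf (S + 1) x
            have := sqDens_nonneg (κ := κ) (s := S) hf x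
            rw [ENNReal.ofReal_add (by positivity) (by positivity), ENNReal.ofReal_mul hc0.le]
            ring
        _ ≤ _ := h3
        _ ≤ _ := by gcongr with x; exact tailMax_anti w x (Nat.le_succ S)
  have h4 := le_trans le_self_add (key S)
  have h5 : ENNReal.ofReal (2 * 2 ^ d / (κ * (κ - 1))) * ENNReal.ofReal c = 1 := by
    rw [← ENNReal.ofReal_mul (by positivity), ← ENNReal.ofReal_one]
    congr 1; rw [hc]; field_simp
  calc _ = ENNReal.ofReal (2 * 2 ^ d / (κ * (κ - 1))) * (ENNReal.ofReal c * ∑ s ∈ Finset.range S,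
      ∑' x, ENNReal.ofReal (sqDens κ s f x) * tailMax w (s + 1) x) := by
        rw [← mul_assoc, h5, one_mul]
    _ ≤ _ := by
        gcongr
        refine h4.trans ?_
        gcongr with x
        exact tailMax_le_maxFn w 0 x

/-- Weighted square function estimate. -/
theorem tsum_tsum_sqDens_le {κ : ℝ} (h1 : 1 < κ) (h2 : κ < 2) {f : (Fin d → ℤ) → ℝ}
    (hf : ∀ x, 0 < f x) (w : (Fin d → ℤ) → ℝ≥0∞) :
    ∑' s, ∑' x, ENNReal.ofReal (sqDens κ s f x) * w x
      ≤ 2 ^ d * ENNReal.ofReal (2 * 2 ^ d / (κ * (κ - 1))) *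
        ∑' x, ENNReal.ofReal (f x ^ κ) * maxFn w x := by
  refine ENNReal.tsum_le_of_sum_range_le fun S => ?_
  rw [mul_assoc]
  refine le_trans ?_ (mul_le_mul_right (sum_tsum_sqDens_tailMax_le h1 h2 hf w S) _)
  rw [Finset.mul_sum]
  refine Finset.sum_le_sum fun s _ => tsum_meas_mul_le (fun x y hy => ?_) w
  rw [sqDens_meas κ s f x y hy]

/-- The sequence following `g` by jumps of relative size at least `ε` (relative to the running
maximum). -/
def stopSeq (ε : ℝ) (g : ℕ → ℝ) : ℕ → ℝ
  | 0 => g 0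
  | i + 1 => if ε * partialSups g (i + 1) ≤ |g (i + 1) - stopSeq ε g i| then g (i + 1)
      else stopSeq ε g i

/-- The squared jumps of `stopSeq`. -/
def jumpSq (ε : ℝ) (g : ℕ → ℝ) (i : ℕ) : ℝ :=
  if ε * partialSups g (i + 1) ≤ |g (i + 1) - stopSeq ε g i| then (g (i + 1) - stopSeq ε g i) ^ 2
    else 0

lemma jumpSq_nonneg (ε : ℝ) (g : ℕ → ℝ) (i : ℕ) : 0 ≤ jumpSq ε g i := by
  unfold jumpSq; split_ifs <;> positivity

lemma jumpSq_add (ε : ℝ) (g : ℕ → ℝ) (i : ℕ) :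
    jumpSq ε g i + (g (i + 1) - stopSeq ε g (i + 1)) ^ 2 = (g (i + 1) - stopSeq ε g i) ^ 2 := by
  simp only [jumpSq, stopSeq]
  split_ifs <;> simp

lemma abs_sub_stopSeq_le {ε : ℝ} (hε : 0 ≤ ε) {g : ℕ → ℝ} (hg : ∀ i, 0 < g i) (i : ℕ) :
    |g i - stopSeq ε g i| ≤ ε * partialSups g i := by
  have h1 : ∀ i, 0 ≤ partialSups g i := fun i => (hg i).le.trans (le_partialSups g i)
  have h2 := mul_nonneg hε (h1 i)
  cases i with
  | zero => simpa [stopSeq] using h2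
  | succ i =>
    simp only [stopSeq]
    split_ifs with h
    · simpa using h2
    · exact (not_le.1 h).le

lemma exists_jump {ε : ℝ} (hε : 0 < ε) (hε2 : ε ≤ 1 / 2) {g : ℕ → ℝ} (hg : ∀ i, 0 < g i) {i k : ℕ}
    (h : 2 * (ε * partialSups g (i + k)) < |g (i + k) - g i|) :
    ∃ j, i ≤ j ∧ j < i + k ∧ (ε * partialSups g (i + k)) ^ 2 ≤ 4 * jumpSq ε g j := by
  have hM0 : ∀ i, 0 < partialSups g i := fun i => (hg i).trans_le (le_partialSups g i)
  have key : ∀ k, stopSeq ε g (i + k) = stopSeq ε g i ∨ ∃ j, i ≤ j ∧ j < i + k ∧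
      ε * partialSups g (j + 1) ≤ |g (j + 1) - stopSeq ε g j| ∧
      stopSeq ε g (i + k) = g (j + 1) ∧ partialSups g (i + k) ≤ 2 * partialSups g (j + 1) := by
    intro k
    induction k with
    | zero => left; rfl
    | succ k ih =>
      rw [← add_assoc]
      by_cases hj : ε * partialSups g (i + k + 1) ≤ |g (i + k + 1) - stopSeq ε g (i + k)|
      · right
        refine ⟨i + k, by omega, by omega, hj, by rw [stopSeq, if_pos hj], ?_⟩
        linarith [hM0 (i + k + 1)]
      · have e : stopSeq ε g (i + k + 1) = stopSeq ε g (i + k) := by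
          rw [stopSeq, if_neg hj]
        rw [e]
        rcases ih with ih | ⟨j, h1, h2, h3, h4, h5⟩
        · left; exact ih
        · right
          refine ⟨j, h1, by omega, h3, h4, ?_⟩
          rw [h4, not_le, abs_lt] at hj
          have h6 : partialSups g (i + k + 1) = max (partialSups g (i + k)) (g (i + k + 1)) :=
            partialSups_add_one g (i + k)
          rcases max_cases (partialSups g (i + k)) (g (i + k + 1)) with ⟨h7, -⟩ | ⟨h7, -⟩
          · rw [h6, h7]; exact h5
          · have h8 := le_partialSups g (j + 1)
            have h9 := mul_le_mul_of_nonneg_right hε2 (hM0 (i + k + 1)).le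
            have h10 := hj.2
            have h11 : partialSups g (i + k + 1) = g (i + k + 1) := by rw [h6, h7]
            linarith
  have ha := abs_sub_stopSeq_le hε.le hg (i + k)
  rcases key k with h1 | ⟨j, h1, h2, h3, h4, h5⟩
  · exfalso
    have hb := abs_sub_stopSeq_le hε.le hg i
    have hc : ε * partialSups g i ≤ ε * partialSups g (i + k) :=
      mul_le_mul_of_nonneg_left ((partialSups g).mono (by omega)) hε.le
    rw [h1] at ha
    have := abs_sub_le (g (i + k)) (stopSeq ε g i) (g i)
    rw [abs_sub_comm (stopSeq ε g i)] at this
    linarith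
  · refine ⟨j, h1, h2, ?_⟩
    have h6 : jumpSq ε g j = |g (j + 1) - stopSeq ε g j| ^ 2 := by
      rw [jumpSq, if_pos h3, sq_abs]
    rw [h6, show (4 : ℝ) = 2 ^ 2 by norm_num, ← mul_pow]
    have := mul_pos hε (hM0 (i + k))
    refine pow_le_pow_left₀ this.le ?_ 2
    have := mul_le_mul_of_nonneg_left h5 hε.le
    linarith

lemma exists_dyadic_scale {h M : ℝ} (hh : 0 < h) (hM : h ≤ M) :
    ∃ m : ℕ, 2 * ((1 / 2) ^ (m + 1) * M) < h ∧ h ≤ 4 * ((1 / 2) ^ (m + 1) * M) := by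
  have hM0 : 0 < M := hh.trans_le hM
  have hex : ∃ m : ℕ, (1 / 2 : ℝ) ^ m * M < h := by
    obtain ⟨m, hm⟩ := exists_pow_lt_of_lt_one (div_pos hh hM0) (by norm_num : (1 / 2 : ℝ) < 1)
    exact ⟨m, by rwa [lt_div_iff₀ hM0] at hm⟩
  classical
  have h1 := Nat.find_spec hex
  have h2 : Nat.find hex ≠ 0 := fun h0 => by
    rw [h0, pow_zero, one_mul] at h1; linarith
  obtain ⟨m, hm⟩ := Nat.exists_eq_succ_of_ne_zero h2
  have h3 := Nat.find_min hex (m := m) (by omega)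
  rw [not_lt] at h3
  rw [hm, Nat.succ_eq_add_one] at h1
  refine ⟨m + 1, ?_, ?_⟩
  · rw [pow_succ]; linarith
  · rw [pow_succ, pow_succ]; linarith

/-- A pathwise bound for increments in terms of the jumps at all scales. -/
lemma increment_le {r : ℝ} (hr : 2 < r) {g : ℕ → ℝ} (hg : ∀ i, 0 < g i) {i j S : ℕ} (hij : i ≤ j)
    (hjS : j ≤ S) :
    ENNReal.ofReal |g j - g i| ^ r ≤ ENNReal.ofReal (4 ^ (r + 1) * partialSups g S ^ (r - 2)) *
      ∑' m : ℕ, ENNReal.ofReal (((1 / 2) ^ (m + 1)) ^ (r - 2)) *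
        ∑ k ∈ Finset.Ico i j, ENNReal.ofReal (jumpSq ((1 / 2) ^ (m + 1)) g k) := by
  have hr0 : 0 < r := by linarith
  have hM0 : ∀ i, 0 < partialSups g i := fun i => (hg i).trans_le (le_partialSups g i)
  rcases (abs_nonneg (g j - g i)).eq_or_lt with h0 | h0
  · rw [← h0, ENNReal.ofReal_zero, ENNReal.zero_rpow_of_pos hr0]; exact bot_le
  have hle : |g j - g i| ≤ partialSups g j := by
    have h1 := le_partialSups g j
    have h2 := le_partialSups_of_le g hij
    rw [abs_le]
    constructor <;> linarith [hg i, hg j]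
  obtain ⟨m, hm1, hm2⟩ := exists_dyadic_scale h0 hle
  set ε : ℝ := (1 / 2) ^ (m + 1) with hε
  have hε0 : 0 < ε := by positivity
  have hε2 : ε ≤ 1 / 2 := by
    rw [hε, pow_succ]
    have : (1 / 2 : ℝ) ^ m ≤ 1 := pow_le_one₀ (by norm_num) (by norm_num)
    linarith
  obtain ⟨l, rfl⟩ := Nat.exists_eq_add_of_le hij
  obtain ⟨k, hk1, hk2, hk3⟩ := exists_jump hε0 hε2 hg hm1
  have hk0 := jumpSq_nonneg ε g k
  set a := ε * partialSups g (i + l) with ha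
  have ha0 : 0 < a := mul_pos hε0 (hM0 _)
  have h1 : |g (i + l) - g i| ^ r
      ≤ 4 ^ (r + 1) * partialSups g S ^ (r - 2) * (ε ^ (r - 2) * jumpSq ε g k) := by
    calc |g (i + l) - g i| ^ r ≤ (4 * a) ^ r := by gcongr
      _ = 4 ^ r * (a ^ (r - 2) * a ^ 2) := by
        rw [Real.mul_rpow (by norm_num) ha0.le, ← Real.rpow_add_natCast ha0.ne']
        norm_num
      _ ≤ 4 ^ r * ((ε ^ (r - 2) * partialSups g S ^ (r - 2)) * (4 * jumpSq ε g k)) := by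
        rw [← Real.mul_rpow hε0.le (hM0 S).le]
        have : a ≤ ε * partialSups g S :=
          mul_le_mul_of_nonneg_left ((partialSups g).mono hjS) hε0.le
        have h2 : 0 ≤ r - 2 := by linarith
        have := Real.rpow_le_rpow ha0.le this h2
        gcongr
        exact (Real.rpow_nonneg ha0.le _).trans this
      _ = _ := by rw [Real.rpow_add_one (by norm_num)]; ring
  rw [ENNReal.ofReal_rpow_of_nonneg h0.le hr0.le]
  refine (ENNReal.ofReal_le_ofReal h1).trans ?_
  have hS := hM0 S
  rw [ENNReal.ofReal_mul (by positivity)]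
  gcongr
  refine le_trans ?_ (ENNReal.le_tsum m)
  rw [ENNReal.ofReal_mul (by positivity)]
  gcongr
  exact Finset.single_le_sum (f := fun k => ENNReal.ofReal (jumpSq ε g k)) (by simp)
    (Finset.mem_Ico.2 ⟨hk1, hk2⟩)

lemma sum_Ico_antitone_le (J : ℕ → ℝ≥0∞) {t : ℕ → ℕ} (ht : Antitone t) {S : ℕ} (hS : t 0 ≤ S)
    (K : ℕ) :
    ∑ k ∈ Finset.range K, ∑ j ∈ Finset.Ico (t (k + 1)) (t k), J j ≤ ∑ j ∈ Finset.range S, J j := by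
  have : ∀ K, ∑ k ∈ Finset.range K, ∑ j ∈ Finset.Ico (t (k + 1)) (t k), J j
      = ∑ j ∈ Finset.Ico (t K) (t 0), J j := by
    intro K
    induction K with
    | zero => simp
    | succ K ih =>
      rw [Finset.sum_range_succ, ih, add_comm,
        Finset.sum_Ico_consecutive _ (ht (Nat.le_succ K)) (ht (Nat.zero_le K))]
  rw [this K]
  refine Finset.sum_le_sum_of_subset fun j hj => ?_
  rw [Finset.mem_Ico] at hj
  rw [Finset.mem_range]; omega

/-- The `r`-th power of the `r`-variation of `(E_n f)` up to scale `S`. -/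
def varPow (r : ℝ) (f : (Fin d → ℤ) → ℝ) (S : ℕ) (x : Fin d → ℤ) : ℝ≥0∞ :=
  ⨆ (n : ℕ → ℕ) (_ : Monotone n) (_ : ∀ k, n k ≤ S),
    ∑' k, ENNReal.ofReal |cExp (n (k + 1)) f x - cExp (n k) f x| ^ r

/-- The dyadic martingale in reversed order, stopped at scale `S`. -/
def revPath (S : ℕ) (f : (Fin d → ℤ) → ℝ) (x : Fin d → ℤ) (i : ℕ) : ℝ := cExp (S - i) f x

lemma varPow_le {r : ℝ} (hr : 2 < r) {f : (Fin d → ℤ) → ℝ} (hf : ∀ x, 0 < f x) (S : ℕ)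
    (x : Fin d → ℤ) :
    varPow r f S x ≤ ENNReal.ofReal (4 ^ (r + 1) * partialSups (revPath S f x) S ^ (r - 2)) *
      ∑' m : ℕ, ENNReal.ofReal (((1 / 2) ^ (m + 1)) ^ (r - 2)) *
        ∑ k ∈ Finset.range S, ENNReal.ofReal (jumpSq ((1 / 2) ^ (m + 1)) (revPath S f x) k) := by
  refine iSup_le fun n => iSup_le fun hn => iSup_le fun hnS => ?_
  refine ENNReal.tsum_le_of_sum_range_le fun K => ?_
  set g := revPath S f x with hg
  have hg0 : ∀ i, 0 < g i := fun i => cExp_pos hf _ x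
  have h1 : ∀ k, ENNReal.ofReal |cExp (n (k + 1)) f x - cExp (n k) f x| ^ r ≤
      ENNReal.ofReal (4 ^ (r + 1) * partialSups g S ^ (r - 2)) *
      ∑' m : ℕ, ENNReal.ofReal (((1 / 2) ^ (m + 1)) ^ (r - 2)) *
        ∑ j ∈ Finset.Ico (S - n (k + 1)) (S - n k),
          ENNReal.ofReal (jumpSq ((1 / 2) ^ (m + 1)) g j) := fun k => by
    have := increment_le hr hg0 (i := S - n (k + 1)) (j := S - n k) (S := S)
      (Nat.sub_le_sub_left (hn (Nat.le_succ k)) S) (Nat.sub_le _ _)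
    have e : ∀ k, g (S - n k) = cExp (n k) f x := fun k => by
      rw [hg, revPath, Nat.sub_sub_self (hnS k)]
    rwa [abs_sub_comm, e, e] at this
  refine (Finset.sum_le_sum fun k _ => h1 k).trans ?_
  rw [← Finset.mul_sum, ← Summable.tsum_finsetSum fun _ _ => ENNReal.summable]
  simp_rw [← Finset.mul_sum]
  refine mul_le_mul_right (ENNReal.tsum_le_tsum fun m => mul_le_mul_right ?_ _) _
  exact sum_Ico_antitone_le _ (t := fun k => S - n k)
    (fun a b hab => Nat.sub_le_sub_left (hn hab) S) (Nat.sub_le _ _) K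

lemma revPath_pos {f : (Fin d → ℤ) → ℝ} (hf : ∀ x, 0 < f x) (S : ℕ) (x : Fin d → ℤ) (i : ℕ) :
    0 < revPath S f x i := cExp_pos hf _ x

lemma revPath_congr {S i : ℕ} (f : (Fin d → ℤ) → ℝ) {x y : Fin d → ℤ} (h : y ∈ dyCube (S - i) x)
    {j : ℕ} (hj : j ≤ i) : revPath S f y j = revPath S f x j :=
  (cExp_meas (S - j) f).mono (Nat.sub_le_sub_left hj S) x y h

lemma partialSups_revPath_congr {S i : ℕ} (f : (Fin d → ℤ) → ℝ) {x y : Fin d → ℤ}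
    (h : y ∈ dyCube (S - i) x) {j : ℕ} (hj : j ≤ i) :
    partialSups (revPath S f y) j = partialSups (revPath S f x) j := by
  induction j with
  | zero => simpa using revPath_congr f h hj
  | succ j ih => rw [partialSups_add_one, partialSups_add_one, ih (by omega), revPath_congr f h hj]

lemma stopSeq_revPath_congr {S i : ℕ} (ε : ℝ) (f : (Fin d → ℤ) → ℝ) {x y : Fin d → ℤ}
    (h : y ∈ dyCube (S - i) x) {j : ℕ} (hj : j ≤ i) :
    stopSeq ε (revPath S f y) j = stopSeq ε (revPath S f x) j := by
  induction j with
  | zero => exact revPath_congr f h hj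
  | succ j ih =>
    rw [stopSeq, stopSeq, ih (by omega), revPath_congr f h hj, partialSups_revPath_congr f h hj]

lemma jumpSq_revPath_congr {S i : ℕ} (ε : ℝ) (f : (Fin d → ℤ) → ℝ) {x y : Fin d → ℤ}
    (h : y ∈ dyCube (S - (i + 1)) x) :
    jumpSq ε (revPath S f y) i = jumpSq ε (revPath S f x) i := by
  rw [jumpSq, jumpSq, stopSeq_revPath_congr ε f h (Nat.le_succ i), revPath_congr f h le_rfl,
    partialSups_revPath_congr f h le_rfl]

lemma partialSups_revPath_pos {f : (Fin d → ℤ) → ℝ} (hf : ∀ x, 0 < f x) (S : ℕ) (x : Fin d → ℤ)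
    (i : ℕ) : 0 < partialSups (revPath S f x) i :=
  (revPath_pos hf S x i).trans_le (le_partialSups _ i)

lemma ofReal_partialSups_le {f : (Fin d → ℤ) → ℝ} (hf : ∀ x, 0 < f x) (S : ℕ) (x : Fin d → ℤ)
    (i : ℕ) : ENNReal.ofReal (partialSups (revPath S f x) i)
      ≤ maxFn (fun y => ENNReal.ofReal (f y)) x := by
  have h : ∀ j, ENNReal.ofReal (revPath S f x j) ≤ maxFn (fun y => ENNReal.ofReal (f y)) x := by
    intro j
    rw [revPath, ofReal_cExp fun y => (hf y).le]
    exact eExp_le_maxFn _ _ x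
  induction i with
  | zero => simpa using h 0
  | succ i ih =>
    rw [partialSups_add_one, ENNReal.ofReal_max]
    exact max_le ih (h _)

lemma ofReal_partialSups_rpow_le {f : (Fin d → ℤ) → ℝ} (hf : ∀ x, 0 < f x) (S : ℕ)
    (x : Fin d → ℤ) {κ : ℝ} (hκ : 0 ≤ κ) : ENNReal.ofReal (partialSups (revPath S f x) S ^ κ)
      ≤ maxFn (fun y => ENNReal.ofReal (f y)) x ^ κ := by
  rw [← ENNReal.ofReal_rpow_of_nonneg (partialSups_revPath_pos hf S x S).le hκ]
  exact ENNReal.rpow_le_rpow (ofReal_partialSups_le hf S x S) hκ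

/-- The weight attached to time `j` in the reversed martingale. -/
def pathWeight (κ : ℝ) (S : ℕ) (f : (Fin d → ℤ) → ℝ) (w : (Fin d → ℤ) → ℝ≥0∞) (j : ℕ)
    (x : Fin d → ℤ) : ℝ≥0∞ :=
  ENNReal.ofReal (partialSups (revPath S f x) j ^ (κ - 2)) * tailMax w (S - j) x

lemma pathWeight_meas (κ : ℝ) (S : ℕ) (f : (Fin d → ℤ) → ℝ) (w : (Fin d → ℤ) → ℝ≥0∞) (j : ℕ) :
    DyMeas (S - j) (pathWeight κ S f w j) := by
  intro x y hy
  rw [pathWeight, pathWeight, tailMax_meas w (S - j) x y hy, partialSups_revPath_congr f hy le_rfl]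

lemma sum_jump_step {ε : ℝ} {f : (Fin d → ℤ) → ℝ} {S j s : ℕ} (hs : S = s + 1 + j)
    (x : Fin d → ℤ) :
    ∑ y ∈ dyCube (s + 1) x, (jumpSq ε (revPath S f y) j
        + (revPath S f y (j + 1) - stopSeq ε (revPath S f y) (j + 1)) ^ 2)
      ≤ ∑ y ∈ dyCube (s + 1) x, ((revPath S f y j - stopSeq ε (revPath S f y) j) ^ 2
        + dDiff s f y ^ 2) := by
  have e1 : ∀ y, revPath S f y (j + 1) = cExp s f y := fun y => by
    rw [revPath]; congr 1; omega
  have e2 : ∀ y, revPath S f y j = cExp (s + 1) f y := fun y => by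
    rw [revPath]; congr 1; omega
  have e3 : ∀ y ∈ dyCube (s + 1) x, stopSeq ε (revPath S f y) j = stopSeq ε (revPath S f x) j := by
    intro y hy
    refine stopSeq_revPath_congr ε f (i := j) ?_ le_rfl
    rwa [show S - j = s + 1 by omega]
  simp_rw [jumpSq_add, e1, e2]
  set a := stopSeq ε (revPath S f x) j
  set b := cExp (s + 1) f x
  have h3 : ∑ y ∈ dyCube (s + 1) x, 2 * (b - a) * dDiff s f y = 0 := by
    simp only [dDiff]
    rw [← Finset.mul_sum, Finset.sum_sub_distrib, sum_dyCube_cExp (Nat.le_succ s),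
      sum_dyCube_cExp le_rfl, sub_self, mul_zero]
  rw [← add_zero (∑ y ∈ dyCube (s + 1) x, (_ + _)), ← h3, ← Finset.sum_add_distrib]
  refine Finset.sum_le_sum fun y hy => ?_
  rw [e3 y hy, cExp_meas (s + 1) f x y hy, dDiff, cExp_meas (s + 1) f x y hy]
  nlinarith

/-- Weighted estimate for the jumps of the reversed martingale. -/
lemma sum_tsum_jump_le {κ : ℝ} (h1 : 1 < κ) (h2 : κ < 2) {ε : ℝ} (hε : 0 ≤ ε) (hε1 : ε ≤ 1)
    {f : (Fin d → ℤ) → ℝ} (hf : ∀ x, 0 < f x) (w : (Fin d → ℤ) → ℝ≥0∞) (S : ℕ) :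
    ∑ j ∈ Finset.range S, ∑' x, ENNReal.ofReal (jumpSq ε (revPath S f x) j) * pathWeight κ S f w j x
      ≤ (ENNReal.ofReal (2 * 2 ^ d / (κ * (κ - 1))) + 1) *
        ∑' x, maxFn (fun y => ENNReal.ofReal (f y)) x ^ κ * maxFn w x := by
  set Mf := maxFn (fun y => ENNReal.ofReal (f y)) with hMf
  set Φ : ℕ → (Fin d → ℤ) → ℝ := fun j x => (revPath S f x j - stopSeq ε (revPath S f x) j) ^ 2
    with hΦ
  set P := pathWeight κ S f w with hP
  have hpos := fun x i => partialSups_revPath_pos hf S x i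
  have key : ∀ n ≤ S,
      ∑ j ∈ Finset.range n, ∑' x, ENNReal.ofReal (jumpSq ε (revPath S f x) j) * P j x
        + ∑' x, ENNReal.ofReal (Φ n x) * P n x
      ≤ ∑ j ∈ Finset.range n, ∑' x, ENNReal.ofReal (dDiff (S - 1 - j) f x ^ 2) * P j x
        + ∑' x, ENNReal.ofReal (partialSups (revPath S f x) S ^ κ) * tailMax w (S - n) x := by
    intro n
    induction n with
    | zero => intro _; simp [hΦ, stopSeq]
    | succ n ih =>
      intro hn
      have ih := ih (by omega)
      set J := fun x => jumpSq ε (revPath S f x) n with hJ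
      have hJ0 : ∀ x, 0 ≤ J x := fun x => jumpSq_nonneg _ _ _
      have hΦ0 : ∀ j x, 0 ≤ Φ j x := fun j x => sq_nonneg _
      obtain ⟨s, hs⟩ : ∃ s, S = s + 1 + n := ⟨S - 1 - n, by omega⟩
      have hPm : DyMeas (s + 1) (P n) := by
        have := pathWeight_meas κ S f w n
        rwa [show S - n = s + 1 by omega] at this
      have a1 : ∑' x, ENNReal.ofReal (J x) * P n x + ∑' x, ENNReal.ofReal (Φ (n + 1) x) * P n x
          ≤ ∑' x, ENNReal.ofReal (Φ n x) * P n x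
            + ∑' x, ENNReal.ofReal (dDiff (S - 1 - n) f x ^ 2) * P n x := by
        have := tsum_ofReal_mul_le hPm (fun x => add_nonneg (hJ0 x) (hΦ0 (n + 1) x))
          (fun x => add_nonneg (hΦ0 n x) (sq_nonneg (dDiff s f x))) (sum_jump_step hs)
        rw [← ENNReal.tsum_add, ← ENNReal.tsum_add, show S - 1 - n = s by omega]
        simp_rw [← add_mul]
        simp_rw [ENNReal.ofReal_add (hJ0 _) (hΦ0 _ _),
          ENNReal.ofReal_add (hΦ0 _ _) (sq_nonneg _)] at this
        exact this
      have a2 : ∀ x, ENNReal.ofReal (Φ (n + 1) x) * P (n + 1) x ≤ ENNReal.ofReal (Φ (n + 1) x) * P n x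
          + ENNReal.ofReal (partialSups (revPath S f x) S ^ κ) *
            (tailMax w (S - (n + 1)) x - tailMax w (S - n) x) := by
        intro x
        have ht : tailMax w (S - n) x ≤ tailMax w (S - (n + 1)) x := tailMax_anti w x (by omega)
        have b1 : Φ (n + 1) x ≤ partialSups (revPath S f x) (n + 1) ^ 2 := by
          have := abs_sub_stopSeq_le hε (fun i => revPath_pos hf S x i) (n + 1)
          change (revPath S f x (n + 1) - stopSeq ε (revPath S f x) (n + 1)) ^ 2 ≤ _
          rw [← sq_abs (revPath S f x (n + 1) - stopSeq ε (revPath S f x) (n + 1))]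
          refine pow_le_pow_left₀ (abs_nonneg _) (this.trans ?_) 2
          nlinarith [hpos x (n + 1)]
        have b2 : Φ (n + 1) x * partialSups (revPath S f x) (n + 1) ^ (κ - 2)
            ≤ partialSups (revPath S f x) S ^ κ := by
          have e : partialSups (revPath S f x) (n + 1) ^ κ =
              partialSups (revPath S f x) (n + 1) ^ 2
                * partialSups (revPath S f x) (n + 1) ^ (κ - 2) := by
            rw [← Real.rpow_natCast, ← Real.rpow_add (hpos x _)]
            congr 1; push_cast; ring
          have h3 := Real.rpow_le_rpow (hpos x (n + 1)).le
            ((partialSups (revPath S f x)).mono hn) (by linarith : 0 ≤ κ)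
          refine le_trans ?_ h3
          rw [e]
          have := hpos x (n + 1)
          gcongr
        have b3 : partialSups (revPath S f x) (n + 1) ^ (κ - 2)
            ≤ partialSups (revPath S f x) n ^ (κ - 2) :=
          Real.rpow_le_rpow_of_nonpos (hpos x n) ((partialSups (revPath S f x)).mono (Nat.le_succ n))
            (by linarith)
        calc ENNReal.ofReal (Φ (n + 1) x) * P (n + 1) x
            = ENNReal.ofReal (Φ (n + 1) x) *
              (ENNReal.ofReal (partialSups (revPath S f x) (n + 1) ^ (κ - 2)) * tailMax w (S - n) x)
              + ENNReal.ofReal (Φ (n + 1) x * partialSups (revPath S f x) (n + 1) ^ (κ - 2)) *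
                (tailMax w (S - (n + 1)) x - tailMax w (S - n) x) := by
              rw [ENNReal.ofReal_mul (hΦ0 _ _), mul_assoc, ← mul_add, ← mul_add,
                add_tsub_cancel_of_le ht]
              rfl
          _ ≤ _ := by
              rw [hP, pathWeight]
              gcongr
      have reassoc : ∀ (A : ℝ≥0∞) {X Y D F : ℝ≥0∞}, X + F ≤ Y + D →
          ∀ T, A + X + (F + T) ≤ A + Y + D + T := by
        intro A X Y D F h T
        calc A + X + (F + T) = A + (X + F) + T := by ring
          _ ≤ A + (Y + D) + T := by gcongr
          _ = A + Y + D + T := by ring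
      calc _ ≤ ∑ j ∈ Finset.range n, ∑' x, ENNReal.ofReal (jumpSq ε (revPath S f x) j) * P j x
            + ∑' x, ENNReal.ofReal (J x) * P n x
            + ∑' x, (ENNReal.ofReal (Φ (n + 1) x) * P n x
              + ENNReal.ofReal (partialSups (revPath S f x) S ^ κ) *
            (tailMax w (S - (n + 1)) x - tailMax w (S - n) x)) := by
            rw [Finset.sum_range_succ]
            exact add_le_add_right (ENNReal.tsum_le_tsum a2) _
        _ ≤ ∑ j ∈ Finset.range n, ∑' x, ENNReal.ofReal (jumpSq ε (revPath S f x) j) * P j x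
            + ∑' x, ENNReal.ofReal (Φ n x) * P n x
            + ∑' x, ENNReal.ofReal (dDiff (S - 1 - n) f x ^ 2) * P n x
            + ∑' x, ENNReal.ofReal (partialSups (revPath S f x) S ^ κ) *
            (tailMax w (S - (n + 1)) x - tailMax w (S - n) x) := by
            rw [ENNReal.tsum_add]
            exact reassoc _ a1 _
        _ ≤ ∑ j ∈ Finset.range n, ∑' x, ENNReal.ofReal (dDiff (S - 1 - j) f x ^ 2) * P j x
            + ∑' x, ENNReal.ofReal (partialSups (revPath S f x) S ^ κ) * tailMax w (S - n) x
            + ∑' x, ENNReal.ofReal (dDiff (S - 1 - n) f x ^ 2) * P n x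
            + ∑' x, ENNReal.ofReal (partialSups (revPath S f x) S ^ κ) *
            (tailMax w (S - (n + 1)) x - tailMax w (S - n) x) := by gcongr
        _ = _ := by
            rw [add_right_comm (∑ j ∈ Finset.range n, _), add_assoc, ← ENNReal.tsum_add,
              Finset.sum_range_succ]
            congr 1
            congr 1; ext x
            rw [← mul_add, add_tsub_cancel_of_le]
            exact tailMax_anti w x (by omega)
  have h3 := le_trans le_self_add (key S le_rfl)
  refine h3.trans ?_
  rw [add_mul, one_mul]
  gcongr ?_ + ?_
  · have h4 : ∑ j ∈ Finset.range S, ∑' x, ENNReal.ofReal (dDiff (S - 1 - j) f x ^ 2) * P j x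
        ≤ ∑ j ∈ Finset.range S, ∑' x, ENNReal.ofReal (sqDens κ (S - 1 - j) f x)
          * tailMax w (S - 1 - j + 1) x := by
      refine Finset.sum_le_sum fun j hj => ENNReal.tsum_le_tsum fun x => ?_
      have hj' := Finset.mem_range.1 hj
      rw [hP, pathWeight, ← mul_assoc, ← ENNReal.ofReal_mul (sq_nonneg _),
        show S - 1 - j + 1 = S - j by omega]
      gcongr
      rw [sqDens, show S - 1 - j + 1 = S - j by omega]
      refine mul_le_mul_of_nonneg_left ?_ (sq_nonneg _)
      exact Real.rpow_le_rpow_of_nonpos (cExp_pos hf _ x) (le_partialSups (revPath S f x) j)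
        (by linarith)
    refine h4.trans ?_
    rw [Finset.sum_range_reflect (fun s => ∑' x, ENNReal.ofReal (sqDens κ s f x)
          * tailMax w (s + 1) x) S]
    refine (sum_tsum_sqDens_tailMax_le h1 h2 hf w S).trans ?_
    gcongr with x
    rw [← ENNReal.ofReal_rpow_of_nonneg (hf x).le (by linarith)]
    exact ENNReal.rpow_le_rpow (le_maxFn (fun y => ENNReal.ofReal (f y)) x) (by linarith)
  · gcongr with x
    · exact ofReal_partialSups_rpow_le hf S x (by linarith)
    · exact tailMax_le_maxFn w _ x

lemma tsum_sum_jump_mul_le {κ : ℝ} (h1 : 1 < κ) (h2 : κ < 2) {ε : ℝ} (hε : 0 ≤ ε) (hε1 : ε ≤ 1)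
    {f : (Fin d → ℤ) → ℝ} (hf : ∀ x, 0 < f x) (w : (Fin d → ℤ) → ℝ≥0∞) (S : ℕ) :
    ∑' x, (∑ j ∈ Finset.range S, ENNReal.ofReal (jumpSq ε (revPath S f x) j)) *
        (ENNReal.ofReal (partialSups (revPath S f x) S ^ (κ - 2)) * w x)
      ≤ 2 ^ d * ((ENNReal.ofReal (2 * 2 ^ d / (κ * (κ - 1))) + 1) *
        ∑' x, maxFn (fun y => ENNReal.ofReal (f y)) x ^ κ * maxFn w x) := by
  refine le_trans ?_ (mul_le_mul_right (sum_tsum_jump_le h1 h2 hε hε1 hf w S) _)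
  simp_rw [Finset.sum_mul]
  rw [Summable.tsum_finsetSum fun _ _ => ENNReal.summable, Finset.mul_sum]
  refine Finset.sum_le_sum fun j hj => ?_
  have hj' := Finset.mem_range.1 hj
  set φ : (Fin d → ℤ) → ℝ≥0∞ := fun x => ENNReal.ofReal (jumpSq ε (revPath S f x) j) *
    ENNReal.ofReal (partialSups (revPath S f x) j ^ (κ - 2)) with hφ
  have hm : DyMeas (S - (j + 1)) φ := by
    intro x y hy
    simp only [hφ]
    rw [jumpSq_revPath_congr ε f hy, partialSups_revPath_congr f hy (Nat.le_succ j)]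
  have h3 := tsum_meas_mul_le hm w
  rw [show S - (j + 1) + 1 = S - j by omega] at h3
  calc _ ≤ ∑' x, φ x * w x := by
        refine ENNReal.tsum_le_tsum fun x => ?_
        simp only [hφ]
        rw [mul_assoc]
        gcongr ENNReal.ofReal _ * (ENNReal.ofReal ?_ * _)
        exact Real.rpow_le_rpow_of_nonpos (partialSups_revPath_pos hf S x j)
          ((partialSups (revPath S f x)).mono hj'.le) (by linarith)
    _ ≤ _ := h3
    _ = _ := by simp only [hφ, pathWeight, mul_assoc]

lemma rpow_div_le_add {r κ M : ℝ} (hκ : 0 < κ) (hr : κ < r) (hM : 0 < M) (V : ℝ≥0∞) :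
    V ^ (κ / r) ≤ V * ENNReal.ofReal (M ^ (κ - r)) + ENNReal.ofReal (M ^ κ) := by
  have hr0 : 0 < r := hκ.trans hr
  rcases le_total V (ENNReal.ofReal (M ^ r)) with h | h
  · refine le_trans ?_ le_add_self
    refine (ENNReal.rpow_le_rpow h (by positivity)).trans ?_
    rw [ENNReal.ofReal_rpow_of_pos (by positivity), ← Real.rpow_mul hM.le,
      mul_div_cancel₀ _ hr0.ne']
  · refine le_trans ?_ le_self_add
    rcases eq_or_ne V ∞ with rfl | hV
    · rw [ENNReal.top_mul]
      · exact le_top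
      · simp [Real.rpow_pos_of_pos hM]
    have hV0 : V ≠ 0 := fun h0 => by
      rw [h0, nonpos_iff_eq_zero, ENNReal.ofReal_eq_zero] at h
      exact absurd (Real.rpow_pos_of_pos hM r) h.not_gt
    have e : V ^ (κ / r) = V * V ^ (κ / r - 1) := by
      conv_rhs => rw [← ENNReal.rpow_one V, ← ENNReal.rpow_mul, one_mul]
      rw [← ENNReal.rpow_add _ _ hV0 hV]
      congr 1; ring
    rw [e]
    gcongr
    have h1 : κ / r - 1 ≤ 0 := by
      rw [sub_nonpos, div_le_one hr0]; exact hr.le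
    calc V ^ (κ / r - 1) ≤ ENNReal.ofReal (M ^ r) ^ (κ / r - 1) := by
          rw [← neg_neg (κ / r - 1), ENNReal.rpow_neg V, ENNReal.rpow_neg (ENNReal.ofReal _)]
          exact ENNReal.inv_le_inv.2 (ENNReal.rpow_le_rpow h (by linarith))
      _ = ENNReal.ofReal (M ^ (κ - r)) := by
          rw [ENNReal.ofReal_rpow_of_pos (by positivity), ← Real.rpow_mul hM.le]
          congr 2; field_simp

lemma tsum_geometric_rpow_ne_top {s : ℝ} (hs : 0 < s) :
    ∑' m : ℕ, ENNReal.ofReal (((1 / 2) ^ (m + 1)) ^ s) ≠ ∞ := by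
  have h1 : ∀ m : ℕ, (((1 / 2 : ℝ)) ^ (m + 1)) ^ s = (1 / 2 : ℝ) ^ s * ((1 / 2 : ℝ) ^ s) ^ m := by
    intro m
    rw [← pow_succ', ← Real.rpow_natCast, ← Real.rpow_natCast, ← Real.rpow_mul (by norm_num),
      ← Real.rpow_mul (by norm_num), mul_comm]
  have h2 : Summable fun m : ℕ => (1 / 2 : ℝ) ^ s * ((1 / 2 : ℝ) ^ s) ^ m := by
    refine (summable_geometric_of_lt_one (by positivity) ?_).mul_left _
    exact Real.rpow_lt_one (by norm_num) (by norm_num) hs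
  simp_rw [h1]
  rw [← ENNReal.ofReal_tsum_of_nonneg (fun m => by positivity) h2]
  exact ENNReal.ofReal_ne_top

lemma exists_tsum_varPow_mul_le (d : ℕ) {r κ : ℝ} (hr : 2 < r) (h1 : 1 < κ) (h2 : κ < 2) :
    ∃ C : ℝ≥0∞, C ≠ ∞ ∧ ∀ f : (Fin d → ℤ) → ℝ, (∀ x, 0 < f x) → ∀ (S : ℕ)
      (w : (Fin d → ℤ) → ℝ≥0∞),
      ∑' x, varPow r f S x ^ (κ / r) * w x
        ≤ C * ∑' x, maxFn (fun y => ENNReal.ofReal (f y)) x ^ κ * maxFn w x := by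
  set γ : ℕ → ℝ≥0∞ := fun m => ENNReal.ofReal (((1 / 2) ^ (m + 1)) ^ (r - 2)) with hγ
  set C₁ : ℝ≥0∞ := 2 ^ d * (ENNReal.ofReal (2 * 2 ^ d / (κ * (κ - 1))) + 1) with hC₁
  set a : ℝ := 4 ^ (r + 1) with ha
  have ha0 : 0 ≤ a := by positivity
  refine ⟨ENNReal.ofReal a * (∑' m, γ m) * C₁ + 1, ?_, fun f hf S w => ?_⟩
  · have := tsum_geometric_rpow_ne_top (sub_pos.2 hr)
    refine ENNReal.add_ne_top.2 ⟨ENNReal.mul_ne_top (ENNReal.mul_ne_top ENNReal.ofReal_ne_top this)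
      (ENNReal.mul_ne_top (by simp) (by simp)), by simp⟩
  set B := ∑' x, maxFn (fun y => ENNReal.ofReal (f y)) x ^ κ * maxFn w x with hB
  set M : (Fin d → ℤ) → ℝ := fun x => partialSups (revPath S f x) S with hM
  have hM0 : ∀ x, 0 < M x := fun x => partialSups_revPath_pos hf S x S
  have step : ∀ x, varPow r f S x ^ (κ / r) * w x
      ≤ ENNReal.ofReal a * (∑' m, γ m *
          ((∑ k ∈ Finset.range S, ENNReal.ofReal (jumpSq ((1 / 2) ^ (m + 1)) (revPath S f x) k)) *
            (ENNReal.ofReal (M x ^ (κ - 2)) * w x))) + ENNReal.ofReal (M x ^ κ) * w x := by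
    intro x
    refine (mul_le_mul_left (rpow_div_le_add (by linarith) (by linarith) (hM0 x) _) (w x)).trans ?_
    rw [add_mul]
    gcongr ?_ + _
    refine (mul_le_mul_left (mul_le_mul_left (varPow_le hr hf S x) _) _).trans (le_of_eq ?_)
    rw [ENNReal.ofReal_mul ha0]
    have e : ENNReal.ofReal (M x ^ (κ - 2))
        = ENNReal.ofReal (M x ^ (r - 2)) * ENNReal.ofReal (M x ^ (κ - r)) := by
      rw [← ENNReal.ofReal_mul (Real.rpow_nonneg (hM0 x).le _), ← Real.rpow_add (hM0 x)]
      congr 2; ring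
    simp_rw [← mul_assoc, ENNReal.tsum_mul_right, e]
    ring
  have h3 : ∑' x, ENNReal.ofReal (M x ^ κ) * w x ≤ B :=
    ENNReal.tsum_le_tsum fun x => mul_le_mul'
      (ofReal_partialSups_rpow_le hf S x (by linarith)) (le_maxFn w x)
  calc _ ≤ _ := ENNReal.tsum_le_tsum step
    _ = ENNReal.ofReal a * (∑' m, γ m * ∑' x,
          ((∑ k ∈ Finset.range S, ENNReal.ofReal (jumpSq ((1 / 2) ^ (m + 1)) (revPath S f x) k)) *
            (ENNReal.ofReal (M x ^ (κ - 2)) * w x))) + ∑' x, ENNReal.ofReal (M x ^ κ) * w x := by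
        rw [ENNReal.tsum_add, ENNReal.tsum_mul_left, ENNReal.tsum_comm]
        simp_rw [ENNReal.tsum_mul_left]
    _ ≤ ENNReal.ofReal a * (∑' m, γ m * (C₁ * B)) + B := by
        gcongr with m
        rw [hC₁, mul_assoc]
        exact tsum_sum_jump_mul_le h1 h2 (by positivity) (pow_le_one₀ (by norm_num) (by norm_num))
          hf w S
    _ = _ := by rw [ENNReal.tsum_mul_right]; ring

lemma varPow_mono (r : ℝ) (f : (Fin d → ℤ) → ℝ) : Monotone (varPow r f) := by
  intro S T hST x
  exact iSup_le fun n => iSup_le fun hn => iSup_le fun hS =>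
    le_iSup_of_le n (le_iSup_of_le hn (le_iSup_of_le (fun k => (hS k).trans hST) le_rfl))

/-- The `r`-th power of the `r`-variation of the dyadic martingale of `f`. -/
def martVarPow (r : ℝ) (f : (Fin d → ℤ) → ℝ) (x : Fin d → ℤ) : ℝ≥0∞ := ⨆ S, varPow r f S x

lemma sum_range_le_martVarPow (r : ℝ) (f : (Fin d → ℤ) → ℝ) (x : Fin d → ℤ) {n : ℕ → ℕ}
    (hn : Monotone n) (K : ℕ) :
    ∑ k ∈ Finset.range K, ENNReal.ofReal |cExp (n (k + 1)) f x - cExp (n k) f x| ^ r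
      ≤ martVarPow r f x := by
  refine le_trans ?_ (le_iSup _ (n K))
  refine le_trans ?_ (le_iSup_of_le (fun k => n (min k K)) (le_iSup_of_le
    (fun a b h => hn (min_le_min_right K h)) (le_iSup_of_le (fun k => hn (min_le_right k K)) le_rfl)))
  refine le_trans (le_of_eq ?_) (ENNReal.sum_le_tsum (Finset.range K))
  refine Finset.sum_congr rfl fun k hk => ?_
  have := Finset.mem_range.1 hk
  beta_reduce
  rw [min_eq_left (by omega), min_eq_left (by omega)]

/-- Lépingle's inequality for the dyadic martingale of a positive function. -/
theorem exists_tsum_martVarPow_le (d : ℕ) {r p : ℝ} (hr : 2 < r) (hp : 1 < p) :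
    ∃ C : ℝ≥0∞, C ≠ ∞ ∧ ∀ f : (Fin d → ℤ) → ℝ, (∀ x, 0 < f x) →
      ∑' x, martVarPow r f x ^ (p / r) ≤ C * ∑' x, ENNReal.ofReal (f x) ^ p := by
  obtain ⟨κ, hκ1, hκ⟩ := exists_between (lt_min one_lt_two hp)
  obtain ⟨hκ2, hκp⟩ := lt_min_iff.1 hκ
  have hκ0 : 0 < κ := by linarith
  have hq : 1 < p / κ := (one_lt_div hκ0).2 hκp
  have hpq := Real.HolderConjugate.conjExponent hq
  obtain ⟨C₁, hC₁, H₁⟩ := exists_tsum_varPow_mul_le d hr hκ1 hκ2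
  obtain ⟨C₂, hC₂, H₂⟩ := exists_tsum_maxFn_rpow_le d hpq.symm.lt
  obtain ⟨C₃, hC₃, H₃⟩ := exists_tsum_maxFn_rpow_le d hp
  refine ⟨(C₁ * C₂ ^ (1 / (p / κ).conjExponent)) ^ (p / κ) * C₃, ?_, fun f hf => ?_⟩
  · refine ENNReal.mul_ne_top (ENNReal.rpow_ne_top_of_nonneg (by positivity)
      (ENNReal.mul_ne_top hC₁ (ENNReal.rpow_ne_top_of_nonneg ?_ hC₂))) hC₃
    exact hpq.symm.one_div_nonneg
  refine tsum_iSup_rpow_le (varPow_mono r f) (by positivity) fun S => ?_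
  have h := tsum_rpow_le_of_weighted hpq (H₁ f hf S) H₂
  have e1 : κ / r * (p / κ) = p / r := by field_simp
  have e2 : κ * (p / κ) = p := by field_simp
  simp_rw [← ENNReal.rpow_mul, e1, e2] at h
  rw [mul_assoc]
  exact h.trans (mul_le_mul_right (H₃ _) _)

lemma rpow_half_le_add {κ : ℝ} (h1 : 0 < κ) (h2 : κ < 2) {W : ℝ≥0∞} (hW : W ≠ 0) (Q : ℝ≥0∞) :
    Q ^ (κ / 2) ≤ Q * W ^ (κ - 2) + W ^ κ := by
  rcases eq_or_ne W ∞ with rfl | hW'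
  · rw [ENNReal.top_rpow_of_pos h1, add_top]
    exact le_top
  · have h3 : 0 < W.toReal := ENNReal.toReal_pos hW hW'
    have := rpow_div_le_add h1 h2 h3 Q
    rwa [← ENNReal.ofReal_rpow_of_pos h3, ← ENNReal.ofReal_rpow_of_pos h3,
      ENNReal.ofReal_toReal hW'] at this

lemma tsum_rpow_half_le {α : Type*} {κ p : ℝ} (h1 : 0 < κ) (h2 : κ < 2) (hp : κ < p)
    {Q W : α → ℝ≥0∞} {V : (α → ℝ≥0∞) → α → ℝ≥0∞} {C C' : ℝ≥0∞} (hW : ∀ x, W x ≠ 0)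
    (hQ : ∀ w : α → ℝ≥0∞, ∑' x, Q x * W x ^ (κ - 2) * w x ≤ C * ∑' x, W x ^ κ * V w x)
    (hV : ∀ (w : α → ℝ≥0∞) x, w x ≤ V w x)
    (hV' : ∀ w : α → ℝ≥0∞, ∑' x, V w x ^ (p / κ).conjExponent
      ≤ C' * ∑' x, w x ^ (p / κ).conjExponent) :
    ∑' x, Q x ^ (p / 2) ≤
      ((C + 1) * C' ^ (1 / (p / κ).conjExponent)) ^ (p / κ) * ∑' x, W x ^ p := by
  have hpq := Real.HolderConjugate.conjExponent ((one_lt_div h1).2 hp)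
  have h3 : ∀ w : α → ℝ≥0∞, ∑' x, Q x ^ (κ / 2) * w x ≤ (C + 1) * ∑' x, W x ^ κ * V w x := by
    intro w
    calc ∑' x, Q x ^ (κ / 2) * w x
        ≤ ∑' x, (Q x * W x ^ (κ - 2) * w x + W x ^ κ * V w x) := by
          refine ENNReal.tsum_le_tsum fun x => ?_
          refine (mul_le_mul_left (rpow_half_le_add h1 h2 (hW x) (Q x)) _).trans ?_
          rw [add_mul]
          gcongr
          exact hV w x
      _ ≤ _ := by
          rw [ENNReal.tsum_add, add_mul, one_mul]
          gcongr
          exact hQ w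
  have h := tsum_rpow_le_of_weighted hpq h3 hV'
  have e1 : κ / 2 * (p / κ) = p / 2 := by field_simp
  have e2 : κ * (p / κ) = p := by field_simp
  simpa only [← ENNReal.rpow_mul, e1, e2] using h

/-- The absolute value of a martingale difference. -/
def absDiff (s : ℕ) (f : (Fin d → ℤ) → ℝ) (x : Fin d → ℤ) : ℝ≥0∞ := ENNReal.ofReal |dDiff s f x|

lemma absDiff_sq (κ : ℝ) (s : ℕ) {f : (Fin d → ℤ) → ℝ} (hf : ∀ x, 0 < f x) (x : Fin d → ℤ) :
    absDiff s f x ^ (2 : ℝ)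
      = ENNReal.ofReal (sqDens κ s f x) * ENNReal.ofReal (cExp (s + 1) f x) ^ (2 - κ) := by
  have h := cExp_pos hf (s + 1) x
  rw [absDiff, ENNReal.ofReal_rpow_of_nonneg (abs_nonneg _) (by norm_num),
    ENNReal.ofReal_rpow_of_pos h, ← ENNReal.ofReal_mul (sqDens_nonneg hf x), sqDens, mul_assoc,
    ← Real.rpow_add h, show κ - 2 + (2 - κ) = 0 by ring, Real.rpow_zero, mul_one]
  norm_num

lemma mul_rpow_neg_le_one (a : ℝ≥0∞) (t : ℝ) : a ^ t * a ^ (-t) ≤ 1 := by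
  rw [ENNReal.rpow_neg]
  exact ENNReal.mul_inv_le_one _

/-- Hölder's inequality for averages of `|D_s f|^ρ`. -/
lemma ctrAvg_absDiff_le {κ ρ : ℝ} (h1 : 1 < κ) (h2 : κ < 2) (hρ : ρ * (3 - κ) = 2) (n s : ℕ)
    {f : (Fin d → ℤ) → ℝ} (hf : ∀ x, 0 < f x) (x : Fin d → ℤ) :
    ctrAvg n (fun y => absDiff s f y ^ ρ) x ^ (2 / ρ)
      ≤ ctrAvg n (fun y => ENNReal.ofReal (sqDens κ s f y)) x *
        ctrAvg n (fun y => ENNReal.ofReal (cExp (s + 1) f y)) x ^ (2 - κ) := by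
  have hρe : ρ = 2 / (3 - κ) := by rw [eq_div_iff (by linarith)]; exact hρ
  have hρ0 : 0 < ρ := by rw [hρe]; apply div_pos <;> linarith
  have hρ2 : ρ < 2 := by rw [hρe, div_lt_iff₀] <;> linarith
  have hconj : (2 / ρ).HolderConjugate (2 / (2 - ρ)) := by
    have : 0 < 2 - ρ := by linarith
    rw [Real.holderConjugate_iff]
    refine ⟨(one_lt_div hρ0).2 hρ2, ?_⟩
    field_simp; ring
  set q : (Fin d → ℤ) → ℝ≥0∞ := fun y => ENNReal.ofReal (sqDens κ s f y) with hq
  set m : (Fin d → ℤ) → ℝ≥0∞ := fun y => ENNReal.ofReal (cExp (s + 1) f y) with hm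
  have e0 : ∀ y, absDiff s f y ^ ρ = q y ^ (ρ / 2) * m y ^ ((2 - ρ) / 2) := by
    intro y
    have h := congrArg (fun z : ℝ≥0∞ => z ^ (ρ / 2)) (absDiff_sq κ s hf y)
    simp only [← ENNReal.rpow_mul, ENNReal.mul_rpow_of_nonneg _ _ (by positivity : 0 ≤ ρ / 2)] at h
    rw [mul_div_cancel₀ _ two_ne_zero] at h
    rw [h]
    congr 2
    linarith
  have hH := ENNReal.inner_le_Lp_mul_Lq (ctrCube n x) (fun y => q y ^ (ρ / 2))
    (fun y => m y ^ ((2 - ρ) / 2)) hconj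
  have h2ρ : 2 - ρ ≠ 0 := by linarith
  have e1 : ρ / 2 * (2 / ρ) = 1 := by field_simp
  have e2 : (2 - ρ) / 2 * (2 / (2 - ρ)) = 1 := by field_simp
  simp_rw [← ENNReal.rpow_mul, e1, e2, ENNReal.rpow_one] at hH
  simp_rw [ctrAvg, e0]
  set c : ℝ≥0∞ := (2 ^ (n * d))⁻¹ with hc
  have hc0 : c ≠ 0 := by simp [hc]
  have hct : c ≠ ∞ := by simp [hc]
  have e3 : (1 / (2 / (2 - ρ))) * (2 / ρ) = 2 - κ := by
    have : 2 / ρ = 3 - κ := by rw [div_eq_iff hρ0.ne']; linarith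
    have h4 : 2 - ρ = ρ * (2 - κ) := by linarith
    rw [h4]; field_simp
  have e4 : (1 / (2 / ρ)) * (2 / ρ) = 1 := by field_simp
  have e5 : 2 / ρ = 1 + (2 - κ) := by rw [div_eq_iff hρ0.ne']; linarith
  have hρ' : 0 ≤ 2 / ρ := by positivity
  calc _ ≤ (c * ((∑ y ∈ ctrCube n x, q y) ^ (1 / (2 / ρ)) *
        (∑ y ∈ ctrCube n x, m y) ^ (1 / (2 / (2 - ρ))))) ^ (2 / ρ) := by gcongr
    _ = _ := by
      rw [ENNReal.mul_rpow_of_nonneg _ _ hρ', ENNReal.mul_rpow_of_nonneg _ _ hρ',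
        ← ENNReal.rpow_mul, ← ENNReal.rpow_mul, e3, e4, ENNReal.rpow_one, e5,
        ENNReal.rpow_add _ _ hc0 hct, ENNReal.rpow_one,
        ENNReal.mul_rpow_of_nonneg _ _ (by linarith : 0 ≤ 2 - κ)]
      ring

/-- The first square function. -/
def sqFnA (ρ : ℝ) (b : ℝ≥0∞) (f : (Fin d → ℤ) → ℝ) (x : Fin d → ℤ) : ℝ≥0∞ :=
  ∑' s, ∑' j : ℕ, b ^ j * ctrAvg (s + 1 + j) (fun y => absDiff s f y ^ ρ) x ^ (2 / ρ)

lemma maxFn_maxFn_ne_zero {f : (Fin d → ℤ) → ℝ} (hf : ∀ x, 0 < f x) (x : Fin d → ℤ) :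
    maxFn (maxFn fun y => ENNReal.ofReal (f y)) x ≠ 0 := by
  refine ((ENNReal.ofReal_pos.2 (hf x)).trans_le ((le_maxFn _ x).trans (le_maxFn _ x))).ne'

lemma tsum_sqFnA_mul_le {κ ρ : ℝ} (h1 : 1 < κ) (h2 : κ < 2) (hρ : ρ * (3 - κ) = 2) (b : ℝ≥0∞)
    {f : (Fin d → ℤ) → ℝ} (hf : ∀ x, 0 < f x) (w : (Fin d → ℤ) → ℝ≥0∞) :
    ∑' x, sqFnA ρ b f x * maxFn (maxFn fun y => ENNReal.ofReal (f y)) x ^ (κ - 2) * w x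
      ≤ (1 - b)⁻¹ * (2 ^ d * ENNReal.ofReal (2 * 2 ^ d / (κ * (κ - 1)))) *
        ∑' x, maxFn (maxFn fun y => ENNReal.ofReal (f y)) x ^ κ * maxFn (maxFn w) x := by
  set W := maxFn (maxFn fun y => ENNReal.ofReal (f y)) with hW
  have h3 : ∀ n s x, ctrAvg n (fun y => absDiff s f y ^ ρ) x ^ (2 / ρ) * W x ^ (κ - 2)
      ≤ ctrAvg n (fun y => ENNReal.ofReal (sqDens κ s f y)) x := by
    intro n s x
    have h4 : ctrAvg n (fun y => ENNReal.ofReal (cExp (s + 1) f y)) x ≤ W x := by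
      refine (ctrAvg_le_maxFn _ _ x).trans (maxFn_mono (fun y => ?_) x)
      rw [ofReal_cExp fun y => (hf y).le]
      exact eExp_le_maxFn _ _ y
    calc _ ≤ ctrAvg n (fun y => ENNReal.ofReal (sqDens κ s f y)) x * W x ^ (2 - κ)
          * W x ^ (κ - 2) := by
          gcongr
          refine (ctrAvg_absDiff_le h1 h2 hρ n s hf x).trans ?_
          gcongr _ * ?_
          exact ENNReal.rpow_le_rpow h4 (by linarith)
      _ ≤ _ := by
          rw [mul_assoc]
          refine mul_le_of_le_one_right bot_le ?_
          rw [show κ - 2 = -(2 - κ) by ring]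
          exact mul_rpow_neg_le_one _ _
  have h5 : ∀ n s, ∑' x, ctrAvg n (fun y => ENNReal.ofReal (sqDens κ s f y)) x * w x
      ≤ ∑' x, ENNReal.ofReal (sqDens κ s f x) * maxFn w x := by
    intro n s
    rw [tsum_ctrAvg_mul]
    exact ENNReal.tsum_le_tsum fun x => mul_le_mul_right (ctrAvg_le_maxFn n w x) _
  calc ∑' x, sqFnA ρ b f x * W x ^ (κ - 2) * w x
      = ∑' s, ∑' j : ℕ, b ^ j * ∑' x, ctrAvg (s + 1 + j) (fun y => absDiff s f y ^ ρ) x ^ (2 / ρ)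
          * W x ^ (κ - 2) * w x := by
        simp_rw [sqFnA, ← ENNReal.tsum_mul_right]
        rw [ENNReal.tsum_comm]
        refine tsum_congr fun s => ?_
        rw [ENNReal.tsum_comm]
        refine tsum_congr fun j => ?_
        rw [← ENNReal.tsum_mul_left]
        exact tsum_congr fun x => by ring
    _ ≤ ∑' s, ∑' j : ℕ, b ^ j * ∑' x, ENNReal.ofReal (sqDens κ s f x) * maxFn w x := by
        refine ENNReal.tsum_le_tsum fun s => ENNReal.tsum_le_tsum fun j => mul_le_mul_right ?_ _
        exact (ENNReal.tsum_le_tsum fun x => mul_le_mul_left (h3 _ _ x) _).trans (h5 _ _)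
    _ = (1 - b)⁻¹ * ∑' s, ∑' x, ENNReal.ofReal (sqDens κ s f x) * maxFn w x := by
        simp_rw [ENNReal.tsum_mul_right]
        rw [ENNReal.tsum_mul_left, ENNReal.tsum_geometric]
    _ ≤ _ := by
        rw [mul_assoc]
        gcongr _ * ?_
        refine (tsum_tsum_sqDens_le h1 h2 hf _).trans ?_
        gcongr with x
        rw [← ENNReal.ofReal_rpow_of_pos (hf x)]
        exact ENNReal.rpow_le_rpow ((le_maxFn (fun y => ENNReal.ofReal (f y)) x).trans (le_maxFn _ x)) (by linarith)

lemma exists_tsum_maxFn_maxFn_rpow_le (d : ℕ) {p : ℝ} (hp : 1 < p) :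
    ∃ C : ℝ≥0∞, C ≠ ∞ ∧ ∀ h : (Fin d → ℤ) → ℝ≥0∞,
      ∑' x, maxFn (maxFn h) x ^ p ≤ C * ∑' x, h x ^ p := by
  obtain ⟨C, hC, H⟩ := exists_tsum_maxFn_rpow_le d hp
  refine ⟨C * C, ENNReal.mul_ne_top hC hC, fun h => ?_⟩
  rw [mul_assoc]
  exact (H _).trans (mul_le_mul_right (H _) _)

/-- Passage from weighted `L²` estimates to `ℓ^p` estimates of square functions. -/
lemma exists_tsum_rpow_half_le (d : ℕ) {κ p : ℝ} (h1 : 1 < κ) (h2 : κ < 2) (hp : κ < p)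
    {F : Set ((Fin d → ℤ) → ℝ)} (hF : ∀ f ∈ F, ∀ x, 0 < f x)
    {Q : ((Fin d → ℤ) → ℝ) → (Fin d → ℤ) → ℝ≥0∞}
    {V : ((Fin d → ℤ) → ℝ≥0∞) → (Fin d → ℤ) → ℝ≥0∞} {C₁ C₂ : ℝ≥0∞} (hC₁ : C₁ ≠ ∞) (hC₂ : C₂ ≠ ∞)
    (H₁ : ∀ f ∈ F, ∀ w : (Fin d → ℤ) → ℝ≥0∞,
      ∑' x, Q f x * maxFn (maxFn fun y => ENNReal.ofReal (f y)) x ^ (κ - 2) * w x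
        ≤ C₁ * ∑' x, maxFn (maxFn fun y => ENNReal.ofReal (f y)) x ^ κ * V w x)
    (hV : ∀ w x, w x ≤ V w x)
    (H₂ : ∀ w : (Fin d → ℤ) → ℝ≥0∞, ∑' x, V w x ^ (p / κ).conjExponent
      ≤ C₂ * ∑' x, w x ^ (p / κ).conjExponent) :
    ∃ C : ℝ≥0∞, C ≠ ∞ ∧ ∀ f ∈ F, ∑' x, Q f x ^ (p / 2) ≤ C * ∑' x, ENNReal.ofReal (f x) ^ p := by
  have hκ : 0 < κ := by linarith
  have hpq := Real.HolderConjugate.conjExponent ((one_lt_div hκ).2 hp)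
  obtain ⟨C₃, hC₃, H₃⟩ := exists_tsum_maxFn_maxFn_rpow_le d (h1.trans hp)
  refine ⟨((C₁ + 1) * C₂ ^ (1 / (p / κ).conjExponent)) ^ (p / κ) * C₃, ?_, fun f hf => ?_⟩
  · exact ENNReal.mul_ne_top (ENNReal.rpow_ne_top_of_nonneg (div_nonneg (by linarith) hκ.le)
      (ENNReal.mul_ne_top (by simp [hC₁])
        (ENNReal.rpow_ne_top_of_nonneg hpq.symm.one_div_nonneg hC₂))) hC₃
  · refine (tsum_rpow_half_le hκ h2 hp (maxFn_maxFn_ne_zero (hF f hf)) (H₁ f hf) hV H₂).trans ?_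
    rw [mul_assoc]
    exact mul_le_mul_right (H₃ _) _

theorem exists_tsum_sqFnA_le (d : ℕ) {κ ρ p : ℝ} (h1 : 1 < κ) (h2 : κ < 2) (hp : κ < p)
    (hρ : ρ * (3 - κ) = 2) {b : ℝ≥0∞} (hb : b < 1) :
    ∃ C : ℝ≥0∞, C ≠ ∞ ∧ ∀ f ∈ {f : (Fin d → ℤ) → ℝ | ∀ x, 0 < f x},
      ∑' x, sqFnA ρ b f x ^ (p / 2) ≤ C * ∑' x, ENNReal.ofReal (f x) ^ p := by
  have hκ : 0 < κ := by linarith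
  have hpq := Real.HolderConjugate.conjExponent ((one_lt_div hκ).2 hp)
  obtain ⟨C₂, hC₂, H₂⟩ := exists_tsum_maxFn_maxFn_rpow_le d hpq.symm.lt
  refine exists_tsum_rpow_half_le d h1 h2 hp (fun f hf => hf) ?_ hC₂
    (fun f hf => tsum_sqFnA_mul_le h1 h2 hρ b hf)
    (fun w x => (le_maxFn w x).trans (le_maxFn _ x)) H₂
  have hb' : (1 - b)⁻¹ ≠ ∞ := by simpa [tsub_eq_zero_iff_le] using hb
  exact ENNReal.mul_ne_top hb' (ENNReal.mul_ne_top (by simp) (by simp))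

lemma self_mem_ctrCube (n : ℕ) (x : Fin d → ℤ) : x ∈ ctrCube n x :=
  dyCube_subset_ctrCube n x (self_mem_dyCube n x)

/-- The oscillation of `E_n f` on the cube of scale `n` around `x`. -/
def oscFn (n : ℕ) (f : (Fin d → ℤ) → ℝ) (x : Fin d → ℤ) : ℝ≥0∞ :=
  (ctrCube n x).sup fun y => ENNReal.ofReal |cExp n f y - cExp n f x|

/-- The second square function. -/
def sqFnB (f : (Fin d → ℤ) → ℝ) (x : Fin d → ℤ) : ℝ≥0∞ := ∑' n, oscFn n f x ^ (2 : ℝ)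

/-- The points whose neighbourhood of scale `n` is not inside a single dyadic cube of scale `s`. -/
def edgeSet (s n : ℕ) : Set (Fin d → ℤ) := {x | ¬ ctrCube n x ⊆ dyCube s x}

open Classical in
/-- The local maximum of `|D_s f|` near points of the edge set. -/
def edgeMax (s n : ℕ) (f : (Fin d → ℤ) → ℝ) (x : Fin d → ℤ) : ℝ≥0∞ :=
  if x ∈ edgeSet s n then (ctrCube n x).sup (absDiff s f) else 0

lemma tendsto_eExp_zero (hd : 1 ≤ d) {p : ℝ} (hp : 1 < p) {h : (Fin d → ℤ) → ℝ≥0∞}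
    (hh : ∑' x, h x ^ p ≠ ∞) (x : Fin d → ℤ) : Tendsto (fun n => eExp n h x) atTop (𝓝 0) := by
  have h1 : ∀ n, eExp n h x ≤ ((2⁻¹ : ℝ≥0∞) ^ n * ∑' x, h x ^ p) ^ (1 / p) := by
    intro n
    rw [one_div, ENNReal.le_rpow_inv_iff (by linarith)]
    refine (eExp_rpow_le n hp.le h x).trans ?_
    unfold eExp
    refine mul_le_mul' ?_ (ENNReal.sum_le_tsum _)
    rw [← ENNReal.inv_pow]
    refine ENNReal.inv_le_inv.2 (pow_le_pow_right₀ (by norm_num) ?_)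
    exact Nat.le_mul_of_pos_right n hd
  have h2 : Tendsto (fun n : ℕ => ((2⁻¹ : ℝ≥0∞) ^ n * ∑' x, h x ^ p) ^ (1 / p)) atTop (𝓝 0) := by
    have h3 : Tendsto (fun n : ℕ => (2⁻¹ : ℝ≥0∞) ^ n * ∑' x, h x ^ p) atTop (𝓝 0) := by
      have := ENNReal.Tendsto.mul_const
        (ENNReal.tendsto_pow_atTop_nhds_zero_of_lt_one (r := 2⁻¹) (by norm_num)) (Or.inr hh)
      simpa using this
    have := h3.ennrpow_const (1 / p)
    rwa [ENNReal.zero_rpow_of_pos (by positivity)] at this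
  exact tendsto_of_tendsto_of_tendsto_of_le_of_le tendsto_const_nhds h2 (fun _ => bot_le) h1

lemma abs_sub_le_sum_dDiff (f : (Fin d → ℤ) → ℝ) (n J : ℕ) (x y : Fin d → ℤ) :
    |cExp n f y - cExp n f x| ≤ ∑ j ∈ Finset.range J, |dDiff (n + j) f y - dDiff (n + j) f x|
      + |cExp (n + J) f y| + |cExp (n + J) f x| := by
  have h : |cExp n f y - cExp n f x| ≤ ∑ j ∈ Finset.range J, |dDiff (n + j) f y - dDiff (n + j) f x|
      + |cExp (n + J) f y - cExp (n + J) f x| := by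
    induction J with
    | zero => simp
    | succ J ih =>
      rw [Finset.sum_range_succ]
      have h2 := abs_add_le (dDiff (n + J) f y - dDiff (n + J) f x)
        (cExp (n + (J + 1)) f y - cExp (n + (J + 1)) f x)
      rw [show dDiff (n + J) f y - dDiff (n + J) f x
        + (cExp (n + (J + 1)) f y - cExp (n + (J + 1)) f x) = cExp (n + J) f y - cExp (n + J) f x by
        simp only [dDiff, add_assoc]; ring] at h2
      linarith
  linarith [abs_sub (cExp (n + J) f y) (cExp (n + J) f x)]

lemma oscFn_le (hd : 1 ≤ d) {p : ℝ} (hp : 1 < p) {f : (Fin d → ℤ) → ℝ} (hf : ∀ x, 0 < f x)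
    (hfp : ∑' x, ENNReal.ofReal (f x) ^ p ≠ ∞) (n : ℕ) (x : Fin d → ℤ) :
    oscFn n f x ≤ 2 * ∑' j, edgeMax (n + j) n f x := by
  refine Finset.sup_le fun y hy => ?_
  have hd0 : ∀ j, ENNReal.ofReal |dDiff (n + j) f y - dDiff (n + j) f x|
      ≤ 2 * edgeMax (n + j) n f x := by
    intro j
    by_cases h : y ∈ dyCube (n + j) x
    · rw [dDiff_meas (n + j) f x y h]; simp
    · have hx : x ∈ edgeSet (n + j) n := fun hsub => h (hsub hy)
      rw [edgeMax, if_pos hx, two_mul]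
      refine (ENNReal.ofReal_le_ofReal (abs_sub _ _)).trans ?_
      rw [ENNReal.ofReal_add (abs_nonneg _) (abs_nonneg _)]
      exact add_le_add (Finset.le_sup (f := absDiff (n + j) f) hy)
        (Finset.le_sup (f := absDiff (n + j) f) (self_mem_ctrCube n x))
  have h1 : ∀ J, ENNReal.ofReal |cExp n f y - cExp n f x| ≤ 2 * ∑' j, edgeMax (n + j) n f x
      + (eExp (J + n) (fun z => ENNReal.ofReal (f z)) y
        + eExp (J + n) (fun z => ENNReal.ofReal (f z)) x) := by
    intro J
    refine (ENNReal.ofReal_le_ofReal (abs_sub_le_sum_dDiff f n J x y)).trans ?_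
    rw [abs_of_pos (cExp_pos hf _ y), abs_of_pos (cExp_pos hf _ x), add_assoc,
      ENNReal.ofReal_add (Finset.sum_nonneg fun _ _ => abs_nonneg _)
        (add_nonneg (cExp_pos hf _ y).le (cExp_pos hf _ x).le),
      ENNReal.ofReal_add (cExp_pos hf _ y).le (cExp_pos hf _ x).le,
      ofReal_cExp fun z => (hf z).le, ofReal_cExp fun z => (hf z).le,
      ENNReal.ofReal_sum_of_nonneg fun _ _ => abs_nonneg _, add_comm n J, ← ENNReal.tsum_mul_left]
    gcongr ?_ + _
    exact (Finset.sum_le_sum fun j _ => hd0 j).trans (ENNReal.sum_le_tsum _)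
  have h2 := fun z => (tendsto_eExp_zero hd hp hfp z).comp (tendsto_add_atTop_nat n)
  have h3 := ((h2 y).add (h2 x)).const_add (2 * ∑' j, edgeMax (n + j) n f x)
  simp only [add_zero] at h3
  exact ge_of_tendsto' h3 h1

lemma tsum_sq_le {β : ℝ≥0∞} (hβ0 : β ≠ 0) (hβ : β < 1) (a : ℕ → ℝ≥0∞) :
    (∑' j, a j) ^ (2 : ℝ) ≤ (1 - β ^ 2)⁻¹ * ∑' j, (β ^ (2 * j))⁻¹ * a j ^ (2 : ℝ) := by
  have hβt : β ≠ ∞ := (hβ.trans ENNReal.one_lt_top).ne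
  have h := tsum_mul_le_Lp_mul_Lq Real.HolderConjugate.two_two (fun j => β ^ j)
    (fun j => (β ^ j)⁻¹ * a j)
  have e : ∀ j, β ^ j * ((β ^ j)⁻¹ * a j) = a j := fun j => by
    rw [← mul_assoc, ENNReal.mul_inv_cancel (pow_ne_zero j hβ0) (ENNReal.pow_ne_top hβt), one_mul]
  simp_rw [e] at h
  refine (ENNReal.rpow_le_rpow h (by norm_num : (0 : ℝ) ≤ 2)).trans (le_of_eq ?_)
  rw [ENNReal.mul_rpow_of_nonneg _ _ (by norm_num), ← ENNReal.rpow_mul, ← ENNReal.rpow_mul,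
    show (1 / 2 : ℝ) * 2 = 1 by norm_num, ENNReal.rpow_one, ENNReal.rpow_one]
  congr 1
  · rw [← ENNReal.tsum_geometric]
    refine tsum_congr fun j => ?_
    rw [ENNReal.rpow_two, ← pow_mul, ← pow_mul, mul_comm]
  · refine tsum_congr fun j => ?_
    rw [ENNReal.mul_rpow_of_nonneg _ _ (by norm_num), ENNReal.rpow_two, ← ENNReal.inv_pow,
      ← pow_mul, mul_comm j 2]

lemma ctrCube_subset {m n k : ℕ} {x y : Fin d → ℤ} (hy : ∀ i, |y i - x i| ≤ 2 ^ k)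
    (hk : (2 : ℤ) ^ k + 2 ^ (m + 2) ≤ 2 ^ (n + 2)) : ctrCube m y ⊆ ctrCube n x := by
  intro z hz
  rw [mem_ctrCube] at hz ⊢
  intro i
  have h1 := hz i
  have h2 := hy i
  have h3 : |z i - x i| ≤ |z i - y i| + |y i - x i| := abs_sub_le _ _ _
  linarith

lemma eExp_le_ctrAvg_succ (n : ℕ) (h : (Fin d → ℤ) → ℝ≥0∞) {x y : Fin d → ℤ}
    (hy : y ∈ ctrCube n x) : eExp n h y ≤ 2 ^ d * ctrAvg (n + 1) h x := by
  unfold eExp ctrAvg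
  have h1 : ∑ z ∈ dyCube n y, h z ≤ ∑ z ∈ ctrCube (n + 1) x, h z := by
    refine Finset.sum_le_sum_of_subset ((dyCube_subset_ctrCube n y).trans ?_)
    refine ctrCube_subset (k := n + 2) (mem_ctrCube.1 hy) ?_
    have e : (2 : ℤ) ^ (n + 1 + 2) = 2 ^ (n + 2) + 2 ^ (n + 2) := by ring
    exact e.ge
  have e : (2 : ℝ≥0∞) ^ d * (2 ^ ((n + 1) * d))⁻¹ = (2 ^ (n * d))⁻¹ := by
    rw [add_mul, one_mul, pow_add, ENNReal.mul_inv (by simp) (by simp), mul_left_comm,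
      ENNReal.mul_inv_cancel (by simp) (by simp), mul_one]
  rw [← mul_assoc, e]
  gcongr

lemma card_ctrCube_le (n : ℕ) (x : Fin d → ℤ) : (ctrCube n x).card ≤ 2 ^ ((n + 4) * d) := by
  rw [ctrCube, Fintype.card_piFinset, pow_mul]
  refine (Finset.prod_le_pow_card _ _ (2 ^ (n + 4)) fun i _ => ?_).trans (by simp)
  rw [Int.card_Icc]
  have : (1 : ℤ) ≤ 2 ^ n := one_le_pow₀ (by norm_num)
  zify
  rw [Int.toNat_of_nonneg (by rw [pow_add]; linarith), pow_add, pow_add]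
  linarith

lemma eExp_ctrAvg_le {n s : ℕ} (hns : n ≤ s) (g : (Fin d → ℤ) → ℝ≥0∞) (z : Fin d → ℤ) :
    eExp s (ctrAvg (n + 1) g) z ≤ 64 ^ d * ctrAvg (s + 2) g z := by
  unfold eExp ctrAvg
  have h1 : ∑ y ∈ dyCube s z, ∑ x ∈ ctrCube (n + 1) y, g x
      ≤ 2 ^ ((n + 5) * d) * ∑ x ∈ ctrCube (s + 2) z, g x := by
    have h2 : ∀ y ∈ dyCube s z, ctrCube (n + 1) y ⊆ ctrCube (s + 2) z := by
      intro y hy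
      refine ctrCube_subset (k := s) (fun i => ?_) ?_
      · rw [abs_sub_comm]; exact (abs_sub_lt_of_mem_dyCube hy i).le
      · have : (2 : ℤ) ^ n ≤ 2 ^ s := pow_le_pow_right₀ (by norm_num) hns
        have e1 : (2 : ℤ) ^ (n + 1 + 2) = 8 * 2 ^ n := by ring
        have e2 : (2 : ℤ) ^ (s + 2 + 2) = 16 * 2 ^ s := by ring
        have e3 : (0 : ℤ) < 2 ^ s := by positivity
        rw [e1, e2]
        linarith
    calc ∑ y ∈ dyCube s z, ∑ x ∈ ctrCube (n + 1) y, g x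
        = ∑ y ∈ dyCube s z, ∑ x ∈ ctrCube (s + 2) z, if y ∈ ctrCube (n + 1) x then g x else 0 := by
          refine Finset.sum_congr rfl fun y hy => ?_
          rw [← Finset.sum_filter]
          refine Finset.sum_congr ?_ fun _ _ => rfl
          ext x
          rw [Finset.mem_filter, mem_ctrCube_comm (x := x)]
          exact ⟨fun h => ⟨h2 y hy h, h⟩, fun h => h.2⟩
      _ = ∑ x ∈ ctrCube (s + 2) z, ∑ y ∈ dyCube s z, if y ∈ ctrCube (n + 1) x then g x else 0 :=
          Finset.sum_comm
      _ ≤ ∑ x ∈ ctrCube (s + 2) z, 2 ^ ((n + 5) * d) * g x := by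
          refine Finset.sum_le_sum fun x _ => ?_
          rw [← Finset.sum_filter, Finset.sum_const, nsmul_eq_mul]
          gcongr
          have h3 : (Finset.filter (· ∈ ctrCube (n + 1) x) (dyCube s z)).card
              ≤ (ctrCube (n + 1) x).card :=
            Finset.card_le_card fun y hy => (Finset.mem_filter.1 hy).2
          exact_mod_cast h3.trans (card_ctrCube_le (n + 1) x)
      _ = _ := by rw [Finset.mul_sum]
  rw [← Finset.mul_sum]
  refine (mul_le_mul_right (mul_le_mul_right h1 _) _).trans (le_of_eq ?_)
  have e1 : (2 : ℝ≥0∞) ^ ((n + 5) * d) = 16 ^ d * 2 ^ ((n + 1) * d) := by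
    rw [show (16 : ℝ≥0∞) = 2 ^ 4 by norm_num, ← pow_mul, ← pow_add]; congr 1; ring
  have e2 : (2 : ℝ≥0∞) ^ ((s + 2) * d) = 2 ^ (s * d) * 4 ^ d := by
    rw [show (4 : ℝ≥0∞) = 2 ^ 2 by norm_num, ← pow_mul, ← pow_add]; congr 1; ring
  rw [e1, e2, ENNReal.mul_inv (by simp) (by simp)]
  have e3 : (64 : ℝ≥0∞) ^ d = 16 ^ d * 4 ^ d := by rw [← mul_pow]; norm_num
  have e4 : (4 : ℝ≥0∞) ^ d * (4 ^ d)⁻¹ = 1 := ENNReal.mul_inv_cancel (by simp) (by simp)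
  have e5 := two_pow_inv_mul_self ((n + 1) * d)
  set S := ∑ x ∈ ctrCube (s + 2) z, g x
  calc _ = (2 ^ (s * d))⁻¹ * 16 ^ d * S * ((2 ^ ((n + 1) * d))⁻¹ * 2 ^ ((n + 1) * d)) := by ring
    _ = (2 ^ (s * d))⁻¹ * 16 ^ d * S * (4 ^ d * (4 ^ d)⁻¹) := by rw [e4, e5]
    _ = _ := by rw [e3]; ring

lemma ctrAvg_mul_le {θ θ' : ℝ} (h : θ.HolderConjugate θ') (n : ℕ) (u v : (Fin d → ℤ) → ℝ≥0∞)
    (x : Fin d → ℤ) : ctrAvg n (fun y => u y * v y) x ≤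
      ctrAvg n (fun y => u y ^ θ) x ^ (1 / θ) * ctrAvg n (fun y => v y ^ θ') x ^ (1 / θ') := by
  unfold ctrAvg
  set c : ℝ≥0∞ := (2 ^ (n * d))⁻¹ with hc
  have e : c = c ^ (1 / θ) * c ^ (1 / θ') := by
    rw [← ENNReal.rpow_add _ _ (by simp [hc]) (by simp [hc]), one_div, one_div, h.inv_add_inv_eq_one,
      ENNReal.rpow_one]
  rw [ENNReal.mul_rpow_of_nonneg _ _ h.one_div_nonneg,
    ENNReal.mul_rpow_of_nonneg _ _ h.symm.one_div_nonneg]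
  calc _ ≤ c * ((∑ y ∈ ctrCube n x, u y ^ θ) ^ (1 / θ) * (∑ y ∈ ctrCube n x, v y ^ θ') ^ (1 / θ')) := by
        gcongr
        exact ENNReal.inner_le_Lp_mul_Lq _ u v h
    _ = c ^ (1 / θ) * c ^ (1 / θ') * ((∑ y ∈ ctrCube n x, u y ^ θ) ^ (1 / θ) * (∑ y ∈ ctrCube n x, v y ^ θ') ^ (1 / θ')) := by rw [← e]
    _ = _ := by ring

lemma exists_of_mem_edgeSet {s n : ℕ} {x : Fin d → ℤ} (hx : x ∈ edgeSet s n) :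
    ∃ i, x i - x i / 2 ^ s * 2 ^ s < 2 ^ (n + 2) ∨
      x i / 2 ^ s * 2 ^ s + 2 ^ s ≤ x i + 2 ^ (n + 2) := by
  obtain ⟨y, hy, hyx⟩ := Finset.not_subset.1 hx
  rw [mem_dyCube] at hyx
  push Not at hyx
  obtain ⟨i, hi⟩ := hyx
  refine ⟨i, ?_⟩
  by_contra! h
  obtain ⟨h1, h2⟩ := h
  have h3 := abs_le.1 (mem_ctrCube.1 hy i)
  refine hi (le_antisymm ?_ ?_)
  · refine Int.le_of_lt_add_one (Int.ediv_lt_of_lt_mul (by positivity) ?_)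
    linarith
  · exact (Int.le_ediv_iff_mul_le (by positivity)).2 (by linarith)

/-- Integers near the boundary of their dyadic interval. -/
lemma card_edge_le (s n : ℕ) (a : ℤ) :
    ((Finset.Icc (a - 2 ^ (s + 4)) (a + 2 ^ (s + 4))).filter fun b =>
      b - b / 2 ^ s * 2 ^ s < 2 ^ (n + 2) ∨ b / 2 ^ s * 2 ^ s + 2 ^ s ≤ b + 2 ^ (n + 2)).card
      ≤ 264 * 2 ^ n := by
  have hsub : ((Finset.Icc (a - 2 ^ (s + 4)) (a + 2 ^ (s + 4))).filter fun b =>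
      b - b / 2 ^ s * 2 ^ s < 2 ^ (n + 2) ∨ b / 2 ^ s * 2 ^ s + 2 ^ s ≤ b + 2 ^ (n + 2))
      ⊆ (Finset.Icc (a / 2 ^ s - 16) (a / 2 ^ s + 16)).biUnion fun q =>
        Finset.Ico (q * 2 ^ s) (q * 2 ^ s + 2 ^ (n + 2)) ∪
          Finset.Ico (q * 2 ^ s + 2 ^ s - 2 ^ (n + 2)) (q * 2 ^ s + 2 ^ s) := by
    intro b hb
    rw [Finset.mem_filter, Finset.mem_Icc] at hb
    obtain ⟨⟨h1, h2⟩, h3⟩ := hb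
    have hs : (2 : ℤ) ^ s ≠ 0 := by positivity
    have e : (2 : ℤ) ^ (s + 4) = 16 * 2 ^ s := by ring
    rw [e] at h1 h2
    rw [Finset.mem_biUnion]
    refine ⟨b / 2 ^ s, Finset.mem_Icc.2 ⟨?_, ?_⟩, ?_⟩
    · have := Int.ediv_le_ediv (c := 2 ^ s) (by positivity) h1
      rwa [show a - 16 * 2 ^ s = a + (-16) * 2 ^ s by ring, Int.add_mul_ediv_right _ _ hs] at this
    · have := Int.ediv_le_ediv (c := 2 ^ s) (by positivity) h2
      rwa [Int.add_mul_ediv_right _ _ hs] at this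
    · have h4 := Int.ediv_mul_le b hs
      have h5 := Int.lt_ediv_add_one_mul_self b (by positivity : (0 : ℤ) < 2 ^ s)
      rw [Finset.mem_union, Finset.mem_Ico, Finset.mem_Ico]
      rcases h3 with h3 | h3
      · left; constructor <;> linarith
      · right; constructor <;> linarith
  refine (Finset.card_le_card hsub).trans ?_
  refine (Finset.card_biUnion_le_card_mul _ _ (8 * 2 ^ n) fun q _ => ?_).trans ?_
  · refine (Finset.card_union_le _ _).trans ?_
    rw [Int.card_Ico, Int.card_Ico]
    have e1 : (q * 2 ^ s + 2 ^ (n + 2) - q * 2 ^ s : ℤ) = ((4 * 2 ^ n : ℕ) : ℤ) := by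
      push_cast; ring
    have e2 : (q * 2 ^ s + 2 ^ s - (q * 2 ^ s + 2 ^ s - 2 ^ (n + 2)) : ℤ) = ((4 * 2 ^ n : ℕ) : ℤ) := by
      push_cast; ring
    rw [e1, e2, Int.toNat_natCast]
    linarith
  · rw [Int.card_Icc, show a / 2 ^ s + 16 + 1 - (a / 2 ^ s - 16) = 33 by ring,
      show Int.toNat 33 = 33 from rfl]
    exact (by ring : 33 * (8 * 2 ^ n) = 264 * 2 ^ n).le

open Classical in
lemma card_edgeSet_le (n j : ℕ) (z : Fin d → ℤ) :
    ((ctrCube (n + j + 2) z).filter (· ∈ edgeSet (n + j) n)).card * 2 ^ j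
      ≤ d * (264 * 64 ^ d) * 2 ^ ((n + j) * d) := by
  set s := n + j with hs
  set I : Fin d → Finset ℤ := fun i => (Finset.Icc (z i - 2 ^ (s + 4)) (z i + 2 ^ (s + 4))).filter
    fun b => b - b / 2 ^ s * 2 ^ s < 2 ^ (n + 2) ∨ b / 2 ^ s * 2 ^ s + 2 ^ s ≤ b + 2 ^ (n + 2) with hI
  set P : Fin d → Finset (Fin d → ℤ) := fun i => Fintype.piFinset fun k =>
    if k = i then I i else Finset.Icc (z k - 2 ^ (s + 4)) (z k + 2 ^ (s + 4)) with hP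
  have hsub : (ctrCube (s + 2) z).filter (· ∈ edgeSet s n) ⊆ Finset.univ.biUnion P := by
    intro x hx
    rw [Finset.mem_filter] at hx
    obtain ⟨i, hi⟩ := exists_of_mem_edgeSet hx.2
    rw [Finset.mem_biUnion]
    refine ⟨i, Finset.mem_univ _, ?_⟩
    have hx1 := hx.1
    rw [ctrCube, Fintype.mem_piFinset] at hx1
    rw [Fintype.mem_piFinset]
    intro k
    split_ifs with hk
    · subst hk
      exact Finset.mem_filter.2 ⟨hx1 k, hi⟩
    · exact hx1 k
  have hcard : ∀ i, (P i).card * 2 ^ j ≤ 264 * 64 ^ d * 2 ^ (s * d) := by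
    intro i
    rw [hP, Fintype.card_piFinset, ← Finset.mul_prod_erase _ _ (Finset.mem_univ i), if_pos rfl]
    have h1 : ∏ k ∈ Finset.univ.erase i,
        (if k = i then I i else Finset.Icc (z k - 2 ^ (s + 4)) (z k + 2 ^ (s + 4))).card
        ≤ ∏ k ∈ Finset.univ.erase i, 2 ^ (s + 6) := by
      refine Finset.prod_le_prod' fun k hk => ?_
      rw [if_neg (Finset.ne_of_mem_erase hk), Int.card_Icc]
      have : (1 : ℤ) ≤ 2 ^ s := one_le_pow₀ (by norm_num)
      zify
      have e1 : (2 : ℤ) ^ (s + 4) = 16 * 2 ^ s := by ring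
      have e2 : (2 : ℤ) ^ (s + 6) = 64 * 2 ^ s := by ring
      rw [e1, e2, Int.toNat_of_nonneg (by linarith)]
      linarith
    have h2 : (I i).card * 2 ^ j ≤ 264 * 2 ^ (s + 6) := by
      have := card_edge_le s n (z i)
      calc (I i).card * 2 ^ j ≤ 264 * 2 ^ n * 2 ^ j := by gcongr
        _ = 264 * 2 ^ s := by rw [hs, pow_add]; ring
        _ ≤ _ := by gcongr <;> omega
    calc _ ≤ (I i).card * (∏ k ∈ Finset.univ.erase i, 2 ^ (s + 6)) * 2 ^ j := by gcongr
      _ = (I i).card * 2 ^ j * ∏ k ∈ Finset.univ.erase i, 2 ^ (s + 6) := by ring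
      _ ≤ 264 * 2 ^ (s + 6) * ∏ k ∈ Finset.univ.erase i, 2 ^ (s + 6) := by gcongr
      _ = 264 * ∏ k : Fin d, 2 ^ (s + 6) := by
          rw [mul_assoc, Finset.mul_prod_erase (f := fun _ => 2 ^ (s + 6)) _ (Finset.mem_univ i)]
      _ = _ := by
          rw [Finset.prod_const, Finset.card_univ, Fintype.card_fin, pow_add, mul_pow, ← pow_mul]
          ring
  calc _ ≤ (∑ i, (P i).card) * 2 ^ j := by
        gcongr
        exact (Finset.card_le_card hsub).trans Finset.card_biUnion_le
    _ = ∑ i, (P i).card * 2 ^ j := Finset.sum_mul _ _ _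
    _ ≤ ∑ i : Fin d, 264 * 64 ^ d * 2 ^ (s * d) := Finset.sum_le_sum fun i _ => hcard i
    _ = _ := by simp; ring

lemma ctrAvg_indicator_edgeSet_le (n j : ℕ) (z : Fin d → ℤ) :
    ctrAvg (n + j + 2) ((edgeSet (n + j) n).indicator 1) z
      ≤ (d * (264 * 64 ^ d) : ℕ) * 2⁻¹ ^ j := by
  classical
  have h := card_edgeSet_le n j z
  unfold ctrAvg
  simp only [Set.indicator_apply, Pi.one_apply]
  rw [← Finset.sum_filter, Finset.sum_const, nsmul_eq_mul, mul_one]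
  set N := ((ctrCube (n + j + 2) z).filter (· ∈ edgeSet (n + j) n)).card
  have h' : (N : ℝ≥0∞) * 2 ^ j ≤ (d * (264 * 64 ^ d) : ℕ) * 2 ^ ((n + j) * d) := by exact_mod_cast h
  have e : (2 : ℝ≥0∞) ^ j * 2⁻¹ ^ j = 1 := by
    rw [← mul_pow, ENNReal.mul_inv_cancel (by simp) (by simp), one_pow]
  calc (2 ^ ((n + j + 2) * d))⁻¹ * (N : ℝ≥0∞)
      ≤ (2 ^ ((n + j) * d))⁻¹ * (N : ℝ≥0∞) := by
        exact mul_le_mul_left (ENNReal.inv_le_inv.2 (pow_le_pow_right₀ (by norm_num)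
          (Nat.mul_le_mul_right d (by omega)))) _
    _ = (2 ^ ((n + j) * d))⁻¹ * ((N : ℝ≥0∞) * 2 ^ j) * 2⁻¹ ^ j := by
        rw [mul_assoc, mul_assoc, e, mul_one]
    _ ≤ (2 ^ ((n + j) * d))⁻¹ * ((d * (264 * 64 ^ d) : ℕ) * 2 ^ ((n + j) * d)) * 2⁻¹ ^ j := by gcongr
    _ = (d * (264 * 64 ^ d) : ℕ) * ((2 ^ ((n + j) * d))⁻¹ * 2 ^ ((n + j) * d)) * 2⁻¹ ^ j := by ring
    _ = _ := by rw [two_pow_inv_mul_self, mul_one]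

lemma edgeMax_sq_le {κ : ℝ} (h2 : κ < 2) {s n : ℕ} (hns : n ≤ s)
    {f : (Fin d → ℤ) → ℝ} (hf : ∀ x, 0 < f x) (x : Fin d → ℤ) :
    edgeMax s n f x ^ (2 : ℝ) * maxFn (maxFn fun y => ENNReal.ofReal (f y)) x ^ (κ - 2)
      ≤ 2 ^ d * (2 ^ d) ^ (2 - κ) * ((edgeSet s n).indicator 1 x *
        ctrAvg (n + 1) (fun y => ENNReal.ofReal (sqDens κ s f y)) x) := by
  classical
  by_cases hx : x ∈ edgeSet s n
  · obtain ⟨y, hy, hyx⟩ := Finset.exists_mem_eq_sup (ctrCube n x) ⟨x, self_mem_ctrCube n x⟩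
      (absDiff s f)
    have e : edgeMax s n f x = absDiff s f y := by
      rw [← hyx, edgeMax, if_pos hx]
    rw [e, absDiff_sq κ s hf y, Set.indicator_of_mem hx, Pi.one_apply, one_mul]
    set q : (Fin d → ℤ) → ℝ≥0∞ := fun y => ENNReal.ofReal (sqDens κ s f y)
    set W := maxFn (maxFn fun y => ENNReal.ofReal (f y))
    have hq : q y ≤ 2 ^ d * ctrAvg (n + 1) q x := by
      have hm : DyMeas n q := fun a b hab => by
        simp only [q, ((sqDens_meas κ s f).mono hns) a b hab]
      calc q y = eExp n q y := by rw [eExp_of_meas hm]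
        _ ≤ _ := eExp_le_ctrAvg_succ n q hy
    have hm : ENNReal.ofReal (cExp (s + 1) f y) ≤ 2 ^ d * W x := by
      set m : (Fin d → ℤ) → ℝ≥0∞ := fun y => ENNReal.ofReal (cExp (s + 1) f y)
      have hm : DyMeas n m := fun a b hab => by
        simp only [m, ((cExp_meas (s + 1) f).mono (hns.trans s.le_succ)) a b hab]
      calc m y = eExp n m y := by rw [eExp_of_meas hm]
        _ ≤ 2 ^ d * ctrAvg (n + 1) m x := eExp_le_ctrAvg_succ n m hy
        _ ≤ 2 ^ d * W x := by
          refine mul_le_mul_right ((ctrAvg_le_maxFn _ _ x).trans (maxFn_mono (fun z => ?_) x)) _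
          simp only [m]
          rw [ofReal_cExp fun y => (hf y).le]
          exact eExp_le_maxFn _ _ z
    calc q y * ENNReal.ofReal (cExp (s + 1) f y) ^ (2 - κ) * W x ^ (κ - 2)
        ≤ (2 ^ d * ctrAvg (n + 1) q x) * (2 ^ d * W x) ^ (2 - κ) * W x ^ (κ - 2) := by
          refine mul_le_mul_left (mul_le_mul' hq ?_) _
          exact ENNReal.rpow_le_rpow hm (by linarith)
      _ = 2 ^ d * (2 ^ d) ^ (2 - κ) * ctrAvg (n + 1) q x *
          (W x ^ (2 - κ) * W x ^ (-(2 - κ))) := by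
          rw [ENNReal.mul_rpow_of_nonneg _ _ (by linarith : 0 ≤ 2 - κ), neg_sub]
          ring
      _ ≤ _ := mul_le_of_le_one_right bot_le (mul_rpow_neg_le_one _ _)
  · rw [edgeMax, if_neg hx]
    simp

lemma tsum_indicator_mul_ctrAvg_le {n s : ℕ} (hns : n ≤ s) {q : (Fin d → ℤ) → ℝ≥0∞}
    (hq : DyMeas s q) (v : (Fin d → ℤ) → ℝ≥0∞) :
    ∑' x, ctrAvg (n + 1) q x * v x ≤ 64 ^ d * ∑' x, q x * ctrAvg (s + 2) v x := by
  rw [tsum_ctrAvg_mul, ← ENNReal.tsum_mul_left]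
  calc ∑' x, q x * ctrAvg (n + 1) v x = ∑' x, ctrAvg (n + 1) v x * q x :=
        tsum_congr fun x => mul_comm _ _
    _ = ∑' x, eExp s (ctrAvg (n + 1) v) x * q x := tsum_mul_meas s hq
    _ ≤ ∑' x, (64 ^ d * ctrAvg (s + 2) v x) * q x :=
        ENNReal.tsum_le_tsum fun x => mul_le_mul_left (eExp_ctrAvg_le hns v x) _
    _ = _ := tsum_congr fun x => by ring

lemma ctrAvg_indicator_mul_le {θ θ' : ℝ} (h : θ.HolderConjugate θ') (n j : ℕ)
    (w : (Fin d → ℤ) → ℝ≥0∞) (x : Fin d → ℤ) :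
    ctrAvg (n + j + 2) (fun y => w y * (edgeSet (n + j) n).indicator 1 y) x
      ≤ maxFn (fun y => w y ^ θ) x ^ (1 / θ) *
        ((d * (264 * 64 ^ d) : ℕ) * 2⁻¹ ^ j) ^ (1 / θ') := by
  refine (ctrAvg_mul_le h _ _ _ x).trans (mul_le_mul' ?_ ?_)
  · exact ENNReal.rpow_le_rpow (ctrAvg_le_maxFn _ _ x) h.one_div_nonneg
  · refine ENNReal.rpow_le_rpow ?_ h.symm.one_div_nonneg
    refine le_trans (le_of_eq ?_) (ctrAvg_indicator_edgeSet_le n j x)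
    congr 1
    ext y
    by_cases hy : y ∈ edgeSet (n + j) n
    · simp [hy]
    · simp [hy, h.symm.pos]

lemma tsum_edgeMax_le {κ : ℝ} (h2 : κ < 2) {θ θ' : ℝ}
    (h : θ.HolderConjugate θ') {f : (Fin d → ℤ) → ℝ} (hf : ∀ x, 0 < f x) (n j : ℕ)
    (w : (Fin d → ℤ) → ℝ≥0∞) :
    ∑' x, edgeMax (n + j) n f x ^ (2 : ℝ) *
        maxFn (maxFn fun y => ENNReal.ofReal (f y)) x ^ (κ - 2) * w x
      ≤ (2 ^ d * (2 ^ d) ^ (2 - κ)) * (64 ^ d *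
        (((d * (264 * 64 ^ d) : ℕ) * 2⁻¹ ^ j) ^ (1 / θ') *
        ∑' x, ENNReal.ofReal (sqDens κ (n + j) f x) * maxFn (fun y => w y ^ θ) x ^ (1 / θ))) := by
  set c : ℝ≥0∞ := 2 ^ d * (2 ^ d) ^ (2 - κ)
  set q : (Fin d → ℤ) → ℝ≥0∞ := fun y => ENNReal.ofReal (sqDens κ (n + j) f y)
  have hq : DyMeas (n + j) q := fun a b hab => by
    simp only [q, sqDens_meas κ (n + j) f a b hab]
  calc _ ≤ ∑' x, c * (ctrAvg (n + 1) q x * (w x * (edgeSet (n + j) n).indicator 1 x)) := by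
        refine ENNReal.tsum_le_tsum fun x => ?_
        refine (mul_le_mul_left (edgeMax_sq_le h2 (Nat.le_add_right n j) hf x) _).trans
          (le_of_eq ?_)
        ring
    _ = c * ∑' x, ctrAvg (n + 1) q x * (w x * (edgeSet (n + j) n).indicator 1 x) :=
        ENNReal.tsum_mul_left
    _ ≤ c * (64 ^ d * ∑' x, q x * ctrAvg (n + j + 2)
          (fun y => w y * (edgeSet (n + j) n).indicator 1 y) x) :=
        mul_le_mul_right (tsum_indicator_mul_ctrAvg_le (Nat.le_add_right n j) hq _) _
    _ ≤ _ := by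
        refine mul_le_mul_right (mul_le_mul_right ?_ _) _
        rw [← ENNReal.tsum_mul_left]
        refine ENNReal.tsum_le_tsum fun x =>
          (mul_le_mul_right (ctrAvg_indicator_mul_le h n j w x) _).trans (le_of_eq ?_)
        ring

lemma tsum_sqFnB_mul_le (hd : 1 ≤ d) {κ p : ℝ} (h1 : 1 < κ) (h2 : κ < 2) (hp : 1 < p) {θ θ' : ℝ}
    (h : θ.HolderConjugate θ') {β : ℝ≥0∞} (hβ0 : β ≠ 0) (hβ : β < 1)
    (hβθ : (2⁻¹ : ℝ≥0∞) ^ (1 / θ') = β ^ 4) {f : (Fin d → ℤ) → ℝ} (hf : ∀ x, 0 < f x)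
    (hfp : ∑' x, ENNReal.ofReal (f x) ^ p ≠ ∞) (w : (Fin d → ℤ) → ℝ≥0∞) :
    ∑' x, sqFnB f x * maxFn (maxFn fun y => ENNReal.ofReal (f y)) x ^ (κ - 2) * w x
      ≤ (4 * (1 - β ^ 2)⁻¹ * (2 ^ d * (2 ^ d) ^ (2 - κ) * (64 ^ d *
          ((d * (264 * 64 ^ d) : ℕ) : ℝ≥0∞) ^ (1 / θ'))) * (1 - β ^ 2)⁻¹ *
          (2 ^ d * ENNReal.ofReal (2 * 2 ^ d / (κ * (κ - 1))))) *
        ∑' x, maxFn (maxFn fun y => ENNReal.ofReal (f y)) x ^ κ *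
          maxFn (fun y => maxFn (fun z => w z ^ θ) y ^ (1 / θ)) x := by
  set W := maxFn (maxFn fun y => ENNReal.ofReal (f y)) with hW
  set u : (Fin d → ℤ) → ℝ≥0∞ := fun y => maxFn (fun z => w z ^ θ) y ^ (1 / θ) with hu
  set A : ℝ≥0∞ := 4 * (1 - β ^ 2)⁻¹
  set B : ℝ≥0∞ := 2 ^ d * (2 ^ d) ^ (2 - κ) * (64 ^ d *
          ((d * (264 * 64 ^ d) : ℕ) : ℝ≥0∞) ^ (1 / θ'))
  have hβt : β ≠ ∞ := (hβ.trans ENNReal.one_lt_top).ne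
  have h3 : ∀ n x, oscFn n f x ^ (2 : ℝ) ≤
      A * ∑' j, (β ^ (2 * j))⁻¹ * edgeMax (n + j) n f x ^ (2 : ℝ) := by
    intro n x
    refine (ENNReal.rpow_le_rpow (oscFn_le hd hp hf hfp n x) (by norm_num)).trans ?_
    rw [ENNReal.mul_rpow_of_nonneg _ _ (by norm_num)]
    calc (2 : ℝ≥0∞) ^ (2 : ℝ) * (∑' j, edgeMax (n + j) n f x) ^ (2 : ℝ)
        ≤ 4 * ((1 - β ^ 2)⁻¹ * ∑' j, (β ^ (2 * j))⁻¹ * edgeMax (n + j) n f x ^ (2 : ℝ)) := by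
          refine mul_le_mul' ?_ (tsum_sq_le hβ0 hβ _)
          rw [ENNReal.rpow_two]; norm_num
      _ = _ := by rw [mul_assoc]
  have h4 : ∀ n j, ∑' x, edgeMax (n + j) n f x ^ (2 : ℝ) * W x ^ (κ - 2) * w x
      ≤ B * (β ^ (4 * j) * ∑' x, ENNReal.ofReal (sqDens κ (n + j) f x) * u x) := by
    intro n j
    refine (tsum_edgeMax_le h2 h hf n j w).trans (le_of_eq ?_)
    have e : ((2 : ℝ≥0∞)⁻¹ ^ j) ^ (1 / θ') = β ^ (4 * j) := by
      rw [← ENNReal.rpow_natCast, ← ENNReal.rpow_mul, mul_comm, ENNReal.rpow_mul, hβθ,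
        ENNReal.rpow_natCast, ← pow_mul]
    rw [ENNReal.mul_rpow_of_nonneg _ _ h.symm.one_div_nonneg, e]
    simp only [B]
    ring
  have h5 : ∀ j, ∑' n, ∑' x, ENNReal.ofReal (sqDens κ (n + j) f x) * u x
      ≤ 2 ^ d * ENNReal.ofReal (2 * 2 ^ d / (κ * (κ - 1))) * ∑' x, W x ^ κ * maxFn u x := by
    intro j
    refine le_trans ?_ ((tsum_tsum_sqDens_le h1 h2 hf u).trans ?_)
    · exact ENNReal.tsum_comp_le_tsum_of_injective (add_left_injective j)
        (fun s => ∑' x, ENNReal.ofReal (sqDens κ s f x) * u x)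
    · gcongr with x
      rw [← ENNReal.ofReal_rpow_of_pos (hf x)]
      exact ENNReal.rpow_le_rpow ((le_maxFn (fun y => ENNReal.ofReal (f y)) x).trans
        (le_maxFn _ x)) (by linarith)
  have h6 : ∀ j, (β ^ (2 * j))⁻¹ * β ^ (4 * j) = (β ^ 2) ^ j := by
    intro j
    rw [show 4 * j = 2 * j + 2 * j by ring, pow_add, ← mul_assoc,
      ENNReal.inv_mul_cancel (pow_ne_zero _ hβ0) (ENNReal.pow_ne_top hβt), one_mul, pow_mul]
  calc ∑' x, sqFnB f x * W x ^ (κ - 2) * w x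
      ≤ ∑' x, (∑' n, A * ∑' j, (β ^ (2 * j))⁻¹ * edgeMax (n + j) n f x ^ (2 : ℝ)) *
          W x ^ (κ - 2) * w x := by
        refine ENNReal.tsum_le_tsum fun x => mul_le_mul_left (mul_le_mul_left ?_ _) _
        exact ENNReal.tsum_le_tsum fun n => h3 n x
    _ = A * ∑' j, (β ^ (2 * j))⁻¹ * ∑' n, ∑' x, edgeMax (n + j) n f x ^ (2 : ℝ) *
          W x ^ (κ - 2) * w x := by
        simp_rw [← ENNReal.tsum_mul_left, ← ENNReal.tsum_mul_right]
        rw [ENNReal.tsum_comm]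
        calc _ = ∑' n, ∑' j, ∑' x, A * ((β ^ (2 * j))⁻¹ * edgeMax (n + j) n f x ^ (2 : ℝ)) *
              W x ^ (κ - 2) * w x := tsum_congr fun n => ENNReal.tsum_comm
          _ = ∑' j, ∑' n, ∑' x, A * ((β ^ (2 * j))⁻¹ * edgeMax (n + j) n f x ^ (2 : ℝ)) *
              W x ^ (κ - 2) * w x := ENNReal.tsum_comm
          _ = _ := tsum_congr fun j => tsum_congr fun n => tsum_congr fun x => by ring
    _ ≤ A * ∑' j, (β ^ (2 * j))⁻¹ * ∑' n, B * (β ^ (4 * j) *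
          ∑' x, ENNReal.ofReal (sqDens κ (n + j) f x) * u x) := by
        refine mul_le_mul_right (ENNReal.tsum_le_tsum fun j => mul_le_mul_right
          (ENNReal.tsum_le_tsum fun n => h4 n j) _) _
    _ = A * ∑' j, B * (β ^ 2) ^ j * ∑' n,
          ∑' x, ENNReal.ofReal (sqDens κ (n + j) f x) * u x := by
        congr 1
        refine tsum_congr fun j => ?_
        rw [ENNReal.tsum_mul_left, ENNReal.tsum_mul_left, ← h6]
        ring
    _ ≤ A * ∑' j, B * (β ^ 2) ^ j * (2 ^ d * ENNReal.ofReal (2 * 2 ^ d / (κ * (κ - 1))) *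
          ∑' x, W x ^ κ * maxFn u x) :=
        mul_le_mul_right (ENNReal.tsum_le_tsum fun j => mul_le_mul_right (h5 j) _) _
    _ = _ := by
        rw [ENNReal.tsum_mul_right, ENNReal.tsum_mul_left, ENNReal.tsum_geometric]
        ring

theorem exists_tsum_sqFnB_le (hd : 1 ≤ d) {κ p : ℝ} (h1 : 1 < κ) (h2 : κ < 2) (hp : κ < p) :
    ∃ C : ℝ≥0∞, C ≠ ∞ ∧
      ∀ f ∈ {f : (Fin d → ℤ) → ℝ | (∀ x, 0 < f x) ∧ ∑' x, ENNReal.ofReal (f x) ^ p ≠ ∞},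
      ∑' x, sqFnB f x ^ (p / 2) ≤ C * ∑' x, ENNReal.ofReal (f x) ^ p := by
  have hκ : 0 < κ := by linarith
  have hpq := Real.HolderConjugate.conjExponent ((one_lt_div hκ).2 hp)
  set c := (p / κ).conjExponent
  have hc : 1 < c := hpq.symm.lt
  set θ := (1 + c) / 2 with hθ
  have hθ1 : 1 < θ := by rw [hθ]; linarith
  have hθc : 1 < c / θ := by rw [one_lt_div (by linarith), hθ]; linarith
  have h := Real.HolderConjugate.conjExponent hθ1
  set θ' := θ.conjExponent
  set β : ℝ≥0∞ := (2⁻¹ : ℝ≥0∞) ^ (1 / (4 * θ')) with hβ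
  have hθ' : 0 < θ' := h.symm.pos
  have hβ0 : β ≠ 0 := by simp [hβ]
  have hβ1 : β < 1 := ENNReal.rpow_lt_one (by simp) (by positivity)
  have hβθ : (2⁻¹ : ℝ≥0∞) ^ (1 / θ') = β ^ 4 := by
    rw [hβ, ← ENNReal.rpow_natCast, ← ENNReal.rpow_mul]
    congr 1
    push_cast
    field_simp
  have hβ2 : β ^ 2 < 1 := pow_lt_one₀ bot_le hβ1 (by norm_num)
  have hβi : (1 - β ^ 2)⁻¹ ≠ ∞ := by simpa [tsub_eq_zero_iff_le] using hβ2
  obtain ⟨C₂, hC₂, H₂⟩ := exists_tsum_maxFn_rpow_le d hc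
  obtain ⟨C₃, hC₃, H₃⟩ := exists_tsum_maxFn_rpow_le d hθc
  refine exists_tsum_rpow_half_le d h1 h2 hp (fun f hf => hf.1)
    (V := fun w => maxFn (fun y => maxFn (fun z => w z ^ θ) y ^ (1 / θ))) ?_
    (ENNReal.mul_ne_top hC₂ hC₃)
    (fun f hf => tsum_sqFnB_mul_le hd h1 h2 (h1.trans hp) h hβ0 hβ1 hβθ hf.1 hf.2)
    (fun w x => ?_) (fun w => ?_)
  · refine ENNReal.mul_ne_top (ENNReal.mul_ne_top (ENNReal.mul_ne_top (ENNReal.mul_ne_top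
      (by simp) hβi) (ENNReal.mul_ne_top (ENNReal.mul_ne_top (by simp) ?_)
      (ENNReal.mul_ne_top (by simp) ?_))) hβi)
      (ENNReal.mul_ne_top (by simp) (by simp))
    · exact ENNReal.rpow_ne_top_of_nonneg (by linarith) (by simp)
    · exact ENNReal.rpow_ne_top_of_nonneg (by positivity) (ENNReal.natCast_ne_top _)
  · refine le_trans ?_ (le_maxFn _ x)
    calc w x = (w x ^ θ) ^ (1 / θ) := by
          rw [← ENNReal.rpow_mul, mul_one_div_cancel (by linarith), ENNReal.rpow_one]
      _ ≤ _ := ENNReal.rpow_le_rpow (le_maxFn (fun z => w z ^ θ) x) (by positivity)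
  · refine (H₂ _).trans ?_
    rw [mul_assoc]
    refine mul_le_mul_right ?_ _
    have e : ∀ a : ℝ≥0∞, (a ^ (1 / θ)) ^ c = a ^ (c / θ) := fun a => by
      rw [← ENNReal.rpow_mul]; congr 1; ring
    have e' : ∀ a : ℝ≥0∞, (a ^ θ) ^ (c / θ) = a ^ c := fun a => by
      rw [← ENNReal.rpow_mul, mul_div_cancel₀ _ (by linarith)]
    have := H₃ (fun z => w z ^ θ)
    simp_rw [e'] at this
    simp_rw [e]
    exact this

/-- A nested family of finite sets of pairs of lattice points with the geometry of the dilates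
of a convex body of dimension `2 * d`. -/
structure IsAdmissible (Λ : ℝ → Finset ((Fin d → ℤ) × (Fin d → ℤ))) (n : ℝ → ℕ) (c L : ℝ) :
    Prop where
  c_pos : 0 < c
  le_L : (2 : ℝ) ^ (4 * (2 * d)) ≤ L
  scale_mono : ∀ t t', t ≤ t' → n t ≤ n t'
  mono : ∀ t t', 0 < t → t ≤ t' → Λ t ⊆ Λ t'
  abs_le : ∀ t, 0 < t → ∀ z ∈ Λ t, ∀ i, |z.1 i| ≤ 2 ^ (n t + 2) ∧ |z.2 i| ≤ 2 ^ (n t + 2)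
  le_card : ∀ t, 0 < t → c * 2 ^ (n t * (2 * d)) ≤ (Λ t).card
  card_le : ∀ t, 0 < t → ∀ s < n t, ∀ B : Finset ((Fin d → ℤ) × (Fin d → ℤ)),
    (∀ z ∈ B, z ∈ Λ t ∧ ∃ z' ∉ Λ t, ∀ i, |z'.1 i - z.1 i| < 2 ^ (s + 1) ∧
      |z'.2 i - z.2 i| < 2 ^ (s + 1)) →
    (B.card : ℝ) * 2 ^ (n t - s) ≤ L * 2 ^ (n t * (2 * d))

/-- The embedding of pairs of lattice points into `ℝ^d × ℝ^d`. -/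
def latEmb (z : (Fin d → ℤ) × (Fin d → ℤ)) : (Fin d → ℝ) × (Fin d → ℝ) :=
  (fun i => (z.1 i : ℝ), fun i => (z.2 i : ℝ))

/-- The unit cube with corner at a lattice point. -/
def unitCube (z : (Fin d → ℤ) × (Fin d → ℤ)) : Set ((Fin d → ℝ) × (Fin d → ℝ)) :=
  (Set.univ.pi fun i => Set.Ico (z.1 i : ℝ) (z.1 i + 1)) ×ˢ
    (Set.univ.pi fun i => Set.Ico (z.2 i : ℝ) (z.2 i + 1))

lemma volume_unitCube (z : (Fin d → ℤ) × (Fin d → ℤ)) : volume (unitCube z) = 1 := by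
  rw [unitCube, Measure.volume_eq_prod, Measure.prod_prod, Real.volume_pi_Ico, Real.volume_pi_Ico]
  simp

lemma measurableSet_unitCube (z : (Fin d → ℤ) × (Fin d → ℤ)) : MeasurableSet (unitCube z) :=
  (MeasurableSet.univ_pi fun _ => measurableSet_Ico).prod
    (MeasurableSet.univ_pi fun _ => measurableSet_Ico)

lemma norm_sub_latEmb_lt {z : (Fin d → ℤ) × (Fin d → ℤ)} {v : (Fin d → ℝ) × (Fin d → ℝ)}
    (hv : v ∈ unitCube z) : ‖v - latEmb z‖ < 1 := by
  rw [Prod.norm_def, max_lt_iff, pi_norm_lt_iff one_pos, pi_norm_lt_iff one_pos]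
  obtain ⟨h1, h2⟩ := hv
  refine ⟨fun i => ?_, fun i => ?_⟩
  · have := h1 i (Set.mem_univ i)
    rw [Real.norm_eq_abs, abs_lt]
    simp only [latEmb, Prod.fst_sub, Pi.sub_apply, Set.mem_Ico] at *
    constructor <;> linarith
  · have := h2 i (Set.mem_univ i)
    rw [Real.norm_eq_abs, abs_lt]
    simp only [latEmb, Prod.snd_sub, Pi.sub_apply, Set.mem_Ico] at *
    constructor <;> linarith

lemma disjoint_unitCube {z z' : (Fin d → ℤ) × (Fin d → ℤ)} (h : z ≠ z') :
    Disjoint (unitCube z) (unitCube z') := by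
  rw [Set.disjoint_left]
  intro v hv hv'
  refine h (Prod.ext (funext fun i => ?_) (funext fun i => ?_))
  · rw [← Int.floor_eq_iff.2 (hv.1 i (Set.mem_univ i)),
      ← Int.floor_eq_iff.2 (hv'.1 i (Set.mem_univ i))]
  · rw [← Int.floor_eq_iff.2 (hv.2 i (Set.mem_univ i)),
      ← Int.floor_eq_iff.2 (hv'.2 i (Set.mem_univ i))]

section Dilate

variable {E : Type*} [NormedAddCommGroup E] [NormedSpace ℝ E] {G : Set E}

lemma mem_dilate_mono (hG : Convex ℝ G) (h0 : (0 : E) ∈ G) {t t' : ℝ} (ht : 0 < t) (htt : t ≤ t')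
    {z : E} (hz : z ∈ dilate G t) : z ∈ dilate G t' := by
  have ht' := ht.trans_le htt
  have := hG.smul_mem_of_zero_mem h0 hz (t := t / t') ⟨by positivity, (div_le_one ht').2 htt⟩
  rw [smul_smul] at this
  rwa [show t / t' * t⁻¹ = t'⁻¹ by field_simp] at this

lemma add_mem_dilate (hG : Convex ℝ G) {r : ℝ} (hr : Metric.ball 0 r ⊆ G) {t σ : ℝ}
    (ht : 0 < t) (hσ : 0 < σ) {z w : E} (hz : z ∈ dilate G t) (hw : ‖w‖ < r * σ) :
    z + w ∈ dilate G (t + σ) := by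
  have hw' : σ⁻¹ • w ∈ G := by
    refine hr ?_
    rw [mem_ball_zero_iff, norm_smul, norm_inv, Real.norm_of_nonneg hσ.le, inv_mul_lt_iff₀ hσ]
    linarith
  have := hG hz hw' (a := t / (t + σ)) (b := σ / (t + σ)) (by positivity) (by positivity)
    (by field_simp)
  rw [smul_smul, smul_smul, show t / (t + σ) * t⁻¹ = (t + σ)⁻¹ by field_simp,
    show σ / (t + σ) * σ⁻¹ = (t + σ)⁻¹ by field_simp, ← smul_add] at this
  exact this

end Dilate

open scoped Pointwise in
lemma volume_dilate (G : Set ((Fin d → ℝ) × (Fin d → ℝ))) {t : ℝ} (ht : 0 < t) :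
    volume (dilate G t) = ENNReal.ofReal (t ^ (2 * d)) * volume G := by
  have e : dilate G t = t • G := by
    ext z
    rw [Set.mem_smul_set_iff_inv_smul_mem₀ ht.ne']
    rfl
  have h : (volume : Measure (Fin d → ℝ)).IsAddHaarMeasure := inferInstance
  have h' := Measure.prod.instIsAddHaarMeasure (volume : Measure (Fin d → ℝ))
    (volume : Measure (Fin d → ℝ))
  rw [e, Measure.volume_eq_prod, Measure.addHaar_smul_of_nonneg _ ht.le]
  congr 3
  simp [two_mul]

lemma card_add_volume_le {G : Set ((Fin d → ℝ) × (Fin d → ℝ))} (hd : 1 ≤ d) (hG : Convex ℝ G)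
    {r : ℝ} (hr0 : 0 < r) (hr : Metric.ball 0 r ⊆ G) (hGv : volume G ≠ ∞) {t τ : ℝ} (ht : 0 < t)
    (hτt : τ ≤ t) {B : Finset ((Fin d → ℤ) × (Fin d → ℤ))} (hB : ∀ z ∈ B, latEmb z ∈ dilate G t)
    (hB' : ∀ z ∈ B, 0 < τ → latEmb z ∉ dilate G (τ + r⁻¹)) :
    (B.card : ℝ) + max 0 τ ^ (2 * d) * (volume G).toReal
      ≤ (t + r⁻¹) ^ (2 * d) * (volume G).toReal := by
  have hr1 : r * r⁻¹ = 1 := mul_inv_cancel₀ hr0.ne'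
  set U := ⋃ z ∈ B, unitCube z with hU
  have hUv : volume U = B.card := by
    rw [hU, measure_biUnion_finset (fun z _ z' _ h => disjoint_unitCube h)
      fun z _ => measurableSet_unitCube z]
    simp [volume_unitCube]
  have hUG : U ⊆ dilate G (t + r⁻¹) := by
    refine Set.iUnion₂_subset fun z hz v hv => ?_
    have := add_mem_dilate hG hr ht (inv_pos.2 hr0) (hB z hz) (w := v - latEmb z)
      (by rw [hr1]; exact norm_sub_latEmb_lt hv)
    rwa [add_sub_cancel] at this
  have hUm : MeasurableSet U := B.measurableSet_biUnion fun z _ => measurableSet_unitCube z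
  have htr : 0 < t + r⁻¹ := by positivity
  have h1 : (B.card : ℝ≥0∞) + ENNReal.ofReal (max 0 τ ^ (2 * d)) * volume G
      ≤ ENNReal.ofReal ((t + r⁻¹) ^ (2 * d)) * volume G := by
    rcases le_or_gt τ 0 with hτ | hτ
    · rw [max_eq_left hτ, zero_pow (by omega), ENNReal.ofReal_zero, zero_mul, add_zero, ← hUv,
        ← volume_dilate G htr]
      exact measure_mono hUG
    · rw [max_eq_right hτ.le, ← hUv, ← volume_dilate G htr, ← volume_dilate G hτ,
        ← measure_union' (Set.disjoint_left.2 fun v hv hv' => ?_) hUm]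
      · exact measure_mono (Set.union_subset hUG fun v hv => mem_dilate_mono hG (hr (Metric.mem_ball_self hr0)) hτ
          (hτt.trans (le_add_of_nonneg_right (inv_nonneg.2 hr0.le))) hv)
      · obtain ⟨z, hz, hvz⟩ := Set.mem_iUnion₂.1 hv
        refine hB' z hz hτ ?_
        have := add_mem_dilate hG hr hτ (inv_pos.2 hr0) hv' (w := latEmb z - v)
          (by rw [hr1, norm_sub_rev]; exact norm_sub_latEmb_lt hvz)
        rwa [add_sub_cancel] at this
  have h2 := ENNReal.toReal_mono (ENNReal.mul_ne_top ENNReal.ofReal_ne_top hGv) h1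
  rw [ENNReal.toReal_add (by simp) (ENNReal.mul_ne_top ENNReal.ofReal_ne_top hGv),
    ENNReal.toReal_mul, ENNReal.toReal_mul, ENNReal.toReal_ofReal (by positivity),
    ENNReal.toReal_ofReal (by positivity), ENNReal.toReal_natCast] at h2
  exact h2

lemma pow_sub_pow_le_mul {a b : ℝ} (hb : 0 ≤ b) (hab : b ≤ a) (D : ℕ) :
    a ^ (D + 1) - b ^ (D + 1) ≤ (D + 1) * a ^ D * (a - b) := by
  induction D with
  | zero => simp
  | succ D ih =>
    have h1 : a * (a ^ (D + 1) - b ^ (D + 1)) ≤ a * ((D + 1) * a ^ D * (a - b)) :=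
      mul_le_mul_of_nonneg_left ih (hb.trans hab)
    have h2 : b ^ (D + 1) * (a - b) ≤ a ^ (D + 1) * (a - b) :=
      mul_le_mul_of_nonneg_right (pow_le_pow_left₀ hb hab _) (sub_nonneg.2 hab)
    push_cast
    calc a ^ (D + 1 + 1) - b ^ (D + 1 + 1)
        = a * (a ^ (D + 1) - b ^ (D + 1)) + b ^ (D + 1) * (a - b) := by ring
      _ ≤ a * ((D + 1) * a ^ D * (a - b)) + a ^ (D + 1) * (a - b) := add_le_add h1 h2
      _ = _ := by ring

lemma pow_le_card_of_box {m : ℕ} {B : Finset ((Fin d → ℤ) × (Fin d → ℤ))}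
    (hB : ∀ z : (Fin d → ℤ) × (Fin d → ℤ), (∀ i, |z.1 i| ≤ m ∧ |z.2 i| ≤ m) → z ∈ B) :
    (2 * m + 1) ^ (2 * d) ≤ B.card := by
  set I : Finset (Fin d → ℤ) := Fintype.piFinset fun _ => Finset.Icc (-(m : ℤ)) m with hI
  have hc : I.card = (2 * m + 1) ^ d := by
    rw [hI, Fintype.card_piFinset, Finset.prod_const, Finset.card_univ, Fintype.card_fin,
      Int.card_Icc]
    congr 1
    omega
  have hs : I ×ˢ I ⊆ B := by
    intro z hz
    rw [Finset.mem_product, hI, Fintype.mem_piFinset, Fintype.mem_piFinset] at hz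
    exact hB z fun i => ⟨abs_le.2 (Finset.mem_Icc.1 (hz.1 i)), abs_le.2 (Finset.mem_Icc.1 (hz.2 i))⟩
  calc (2 * m + 1) ^ (2 * d) = (I ×ˢ I).card := by
        rw [Finset.card_product, hc]; ring
    _ ≤ B.card := Finset.card_le_card hs

lemma norm_latEmb_lt {z : (Fin d → ℤ) × (Fin d → ℤ)} {b : ℝ} (hb : 0 < b) :
    ‖latEmb z‖ < b ↔ ∀ i, |(z.1 i : ℝ)| < b ∧ |(z.2 i : ℝ)| < b := by
  rw [Prod.norm_def, max_lt_iff, pi_norm_lt_iff hb, pi_norm_lt_iff hb, ← forall_and]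
  rfl

lemma latEmb_sub (z z' : (Fin d → ℤ) × (Fin d → ℤ)) :
    latEmb z - latEmb z' = latEmb (z - z') := by
  ext <;> simp [latEmb]

theorem exists_isAdmissible (hd : 1 ≤ d) {G : Set ((Fin d → ℝ) × (Fin d → ℝ))}
    (hG : IsConvexBody G) (h0 : (0 : (Fin d → ℝ) × (Fin d → ℝ)) ∈ G) :
    ∃ (Λ : ℝ → Finset ((Fin d → ℤ) × (Fin d → ℤ))) (n : ℝ → ℕ) (c L : ℝ),
      IsAdmissible Λ n c L ∧ ∀ t, 0 < t → (Λ t : Set _) = latticePts d G t := by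
  obtain ⟨hconv, hopen, hbdd, -⟩ := hG
  obtain ⟨r, hr0, hr⟩ := Metric.isOpen_iff.1 hopen 0 h0
  obtain ⟨R, hR0, hR⟩ := hbdd.subset_ball_lt 0 0
  have hvol : volume G ≠ ∞ := hbdd.measure_lt_top.ne
  have hmem : ∀ t z, z ∈ latticePts d G t ↔ latEmb z ∈ dilate G t := fun _ _ => Iff.rfl
  have hnorm : ∀ t, 0 < t → ∀ z ∈ latticePts d G t, ∀ i,
      |(z.1 i : ℝ)| < t * R ∧ |(z.2 i : ℝ)| < t * R := by
    intro t ht z hz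
    rw [← norm_latEmb_lt (by positivity)]
    have := hR (show t⁻¹ • latEmb z ∈ G from hz)
    rwa [mem_ball_zero_iff, norm_smul, norm_inv, Real.norm_of_nonneg ht.le,
      inv_mul_lt_iff₀ ht] at this
  set n : ℝ → ℕ := fun t => Nat.log 2 ⌊t * R⌋₊ with hn
  have hn1 : ∀ t, 0 < t → t * R < 2 * 2 ^ n t := by
    intro t ht
    have h1 : ⌊t * R⌋₊ < 2 ^ (n t + 1) := Nat.lt_pow_succ_log_self (by norm_num) _
    have h2 := (Nat.floor_lt (by positivity)).1 h1
    push_cast at h2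
    linarith [pow_succ (2 : ℝ) (n t)]
  have hn2 : ∀ t, 0 < t → n t ≠ 0 → (2 : ℝ) ^ n t ≤ t * R := by
    intro t ht h
    have h1 : 2 ^ n t ≤ ⌊t * R⌋₊ := Nat.pow_log_le_self 2 (by
      intro h2; simp [hn, h2] at h)
    have h2 := (Nat.le_floor_iff (by positivity)).1 h1
    push_cast at h2
    exact h2
  have hfin : ∀ t, 0 < t → (latticePts d G t).Finite := by
    intro t ht
    set I : Finset (Fin d → ℤ) := Fintype.piFinset fun _ =>
      Finset.Icc (-(⌈t * R⌉ : ℤ)) ⌈t * R⌉ with hI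
    refine (I ×ˢ I).finite_toSet.subset fun z hz => ?_
    have h := hnorm t ht z hz
    have h1 : ∀ a : ℤ, |(a : ℝ)| < t * R → a ∈ Finset.Icc (-(⌈t * R⌉ : ℤ)) ⌈t * R⌉ := by
      intro a ha
      have h2 : (|a| : ℤ) ≤ ⌈t * R⌉ := by
        have := ha.trans_le (Int.le_ceil _)
        exact_mod_cast this.le
      exact Finset.mem_Icc.2 (abs_le.1 h2)
    rw [Finset.mem_coe, Finset.mem_product, hI, Fintype.mem_piFinset, Fintype.mem_piFinset]
    exact ⟨fun i => h1 _ (h i).1, fun i => h1 _ (h i).2⟩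
  classical
  set Λ : ℝ → Finset ((Fin d → ℤ) × (Fin d → ℤ)) := fun t =>
    if ht : 0 < t then (hfin t ht).toFinset else ∅ with hΛ
  have hΛmem : ∀ t, 0 < t → ∀ z, z ∈ Λ t ↔ z ∈ latticePts d G t := by
    intro t ht z
    simp only [hΛ, dif_pos ht, Set.Finite.mem_toFinset]
  set V := (volume G).toReal
  have hV : 0 ≤ V := ENNReal.toReal_nonneg
  set K := 2 / R + 1 / r with hK
  have hKpos : 0 < K := by positivity
  set L₁ : ℝ := V * ((2 * d) * K ^ (2 * d - 1) * (4 / r)) with hL₁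
  refine ⟨Λ, n, (min 1 (r / R)) ^ (2 * d), max (2 ^ (4 * (2 * d))) L₁,
    ⟨by positivity, le_max_left _ _, ?_, ?_, ?_, ?_, ?_⟩, ?_⟩
  · intro t t' h
    exact Nat.log_mono_right (Nat.floor_le_floor (by gcongr))
  · intro t t' ht h z hz
    rw [hΛmem t ht, hmem] at hz
    rw [hΛmem t' (ht.trans_le h), hmem]
    exact mem_dilate_mono hconv h0 ht h hz
  · intro t ht z hz i
    rw [hΛmem t ht] at hz
    have h1 := hn1 t ht
    have h2 : (2 : ℝ) * 2 ^ n t ≤ 2 ^ (n t + 2) := by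
      rw [pow_add]; nlinarith [pow_pos (two_pos : (0 : ℝ) < 2) (n t)]
    obtain ⟨h3, h4⟩ := hnorm t ht z hz i
    constructor
    · exact_mod_cast (h3.trans (h1.trans_le h2)).le
    · exact_mod_cast (h4.trans (h1.trans_le h2)).le
  · intro t ht
    set m := ⌈r * t⌉₊ - 1 with hm
    have hrt : 0 < r * t := by positivity
    have hceil : 0 < ⌈r * t⌉₊ := Nat.ceil_pos.2 hrt
    have hm1 : ((m : ℕ) : ℝ) + 1 = ⌈r * t⌉₊ := by
      rw [hm, Nat.cast_sub hceil]; simp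
    have hm2 : (m : ℝ) < r * t := by linarith [Nat.ceil_lt_add_one hrt.le]
    have hm3 : r * t ≤ 2 * m + 1 := by
      have : (0 : ℝ) ≤ m := Nat.cast_nonneg _
      linarith [Nat.le_ceil (r * t)]
    have hcard : (2 * m + 1) ^ (2 * d) ≤ (Λ t).card := by
      refine pow_le_card_of_box fun z hz => ?_
      rw [hΛmem t ht, hmem]
      refine hr ?_
      rw [mem_ball_zero_iff, norm_smul, norm_inv, Real.norm_of_nonneg ht.le, inv_mul_lt_iff₀ ht,
        norm_latEmb_lt (by positivity)]
      intro i
      have h1 : (|(z.1 i : ℝ)|) ≤ m := by exact_mod_cast (hz i).1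
      have h2 : (|(z.2 i : ℝ)|) ≤ m := by exact_mod_cast (hz i).2
      constructor <;> linarith
    have h1 : min 1 (r / R) * 2 ^ n t ≤ 2 * m + 1 := by
      rcases eq_or_ne (n t) 0 with h | h
      · rw [h, pow_zero, mul_one]
        have : (0 : ℝ) ≤ m := Nat.cast_nonneg _
        exact (min_le_left _ _).trans (by linarith)
      · calc min 1 (r / R) * 2 ^ n t ≤ r / R * (t * R) := by
              gcongr
              · exact min_le_right _ _
              · exact hn2 t ht h
          _ = r * t := by field_simp
          _ ≤ _ := hm3
    calc (min 1 (r / R)) ^ (2 * d) * 2 ^ (n t * (2 * d))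
        = (min 1 (r / R) * 2 ^ n t) ^ (2 * d) := by
          rw [mul_pow, pow_mul 2 (n t) (2 * d)]
      _ ≤ (2 * m + 1 : ℝ) ^ (2 * d) := pow_le_pow_left₀ (by positivity) h1 _
      _ ≤ _ := by exact_mod_cast hcard
  · intro t ht s hs B hB
    refine le_trans ?_ (mul_le_mul_of_nonneg_right (le_max_right _ _) (by positivity))
    set σ := 2 * 2 ^ s / r with hσ
    set τ := t - σ - r⁻¹ with hτ
    have hσ0 : 0 < σ := by positivity
    have hri : 0 < r⁻¹ := inv_pos.2 hr0
    have hB' : ∀ z ∈ B, 0 < τ → latEmb z ∉ dilate G (τ + r⁻¹) := by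
      intro z hz hτ0 hzG
      obtain ⟨-, z', hz', hzz⟩ := hB z hz
      refine hz' ?_
      rw [hΛmem t ht, hmem]
      have := add_mem_dilate hconv hr (by positivity) hσ0 hzG (w := latEmb z' - latEmb z) (by
        rw [latEmb_sub, norm_latEmb_lt (by positivity)]
        intro i
        have h1 : (|(z'.1 i - z.1 i : ℝ)|) < 2 ^ (s + 1) := by exact_mod_cast (hzz i).1
        have h2 : (|(z'.2 i - z.2 i : ℝ)|) < 2 ^ (s + 1) := by exact_mod_cast (hzz i).2
        have e : r * σ = 2 ^ (s + 1) := by rw [hσ]; field_simp; ring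
        rw [e]
        simp only [Prod.fst_sub, Prod.snd_sub, Pi.sub_apply, Int.cast_sub]
        exact ⟨h1, h2⟩)
      rwa [add_sub_cancel, show τ + r⁻¹ + σ = t by rw [hτ]; ring] at this
    have hτt : τ ≤ t := by rw [hτ]; linarith
    have h1 := card_add_volume_le hd hconv hr0 hr hvol ht hτt
      (fun z hz => (hΛmem t ht z).1 (hB z hz).1) hB'
    have hb : max 0 τ ≤ t + r⁻¹ := max_le (by positivity) (by linarith)
    have h2 := pow_sub_pow_le_mul (le_max_left 0 τ) hb (2 * d - 1)
    rw [show 2 * d - 1 + 1 = 2 * d by omega] at h2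
    have ed : (((2 * d - 1 : ℕ) : ℝ) + 1) = 2 * d := by
      rw [Nat.cast_sub (by omega)]; push_cast; ring
    rw [ed] at h2
    have hs1 : (1 : ℝ) ≤ 2 ^ s := one_le_pow₀ (by norm_num)
    have hn1' : (1 : ℝ) ≤ 2 ^ n t := one_le_pow₀ (by norm_num)
    have h3 : t + r⁻¹ - max 0 τ ≤ 4 / r * 2 ^ s := by
      have h4 : r⁻¹ ≤ 2 ^ s / r := by rw [inv_eq_one_div]; gcongr
      have h5 : t - σ - r⁻¹ ≤ max 0 τ := le_max_right _ _
      have e : 4 / r * 2 ^ s = σ + 2 * (2 ^ s / r) := by rw [hσ]; ring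
      linarith
    have h4 : t + r⁻¹ ≤ K * 2 ^ n t := by
      have h5 : r⁻¹ ≤ 2 ^ n t / r := by rw [inv_eq_one_div]; gcongr
      have h6 : t ≤ 2 * 2 ^ n t / R := (le_div_iff₀ hR0).2 (hn1 t ht).le
      have e : K * 2 ^ n t = 2 * 2 ^ n t / R + 2 ^ n t / r := by rw [hK]; ring
      linarith
    have h5 : (B.card : ℝ) ≤ V * (2 * d * (K * 2 ^ n t) ^ (2 * d - 1) * (4 / r * 2 ^ s)) := by
      calc (B.card : ℝ) ≤ V * ((t + r⁻¹) ^ (2 * d) - max 0 τ ^ (2 * d)) := by linarith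
        _ ≤ V * (2 * d * (t + r⁻¹) ^ (2 * d - 1) * (t + r⁻¹ - max 0 τ)) := by gcongr
        _ ≤ _ := by
          gcongr
    calc (B.card : ℝ) * 2 ^ (n t - s)
        ≤ V * (2 * d * (K * 2 ^ n t) ^ (2 * d - 1) * (4 / r * 2 ^ s)) * 2 ^ (n t - s) := by gcongr
      _ = L₁ * ((2 ^ n t) ^ (2 * d - 1) * (2 ^ s * 2 ^ (n t - s))) := by
          rw [hL₁, mul_pow]; ring
      _ = L₁ * 2 ^ (n t * (2 * d)) := by
          rw [← pow_add, show s + (n t - s) = n t by omega, ← pow_succ,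
            show 2 * d - 1 + 1 = 2 * d by omega, pow_mul 2 (n t) (2 * d)]
  · intro t ht
    ext z
    rw [Finset.mem_coe, hΛmem t ht]

lemma abs_avg_sub_avg_le {α : Type*} {A B X : Finset α} (hAB : A ⊆ B) (hBX : B ⊆ X) {c : ℝ}
    (hc : 0 < c) (hcA : c ≤ A.card) (F : α → ℝ) :
    |(B.card : ℝ)⁻¹ * ∑ z ∈ B, F z - (A.card : ℝ)⁻¹ * ∑ z ∈ A, F z|
      ≤ (c⁻¹ * ∑ z ∈ B, |F z| + (c⁻¹ - (B.card : ℝ)⁻¹) * ∑ z ∈ X, |F z|) -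
        (c⁻¹ * ∑ z ∈ A, |F z| + (c⁻¹ - (A.card : ℝ)⁻¹) * ∑ z ∈ X, |F z|) := by
  classical
  have hA0 : (0 : ℝ) < A.card := hc.trans_le hcA
  have hcard : (A.card : ℝ) ≤ B.card := by exact_mod_cast Finset.card_le_card hAB
  have hinv : (B.card : ℝ)⁻¹ ≤ (A.card : ℝ)⁻¹ := inv_anti₀ hA0 hcard
  have hinvc : (B.card : ℝ)⁻¹ ≤ c⁻¹ := inv_anti₀ hc (hcA.trans hcard)
  have hB0 : 0 ≤ (B.card : ℝ)⁻¹ := by positivity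
  have e1 := Finset.sum_sdiff (f := F) hAB
  have e2 := Finset.sum_sdiff (f := fun z => |F z|) hAB
  have h1 : |∑ z ∈ B \ A, F z| ≤ ∑ z ∈ B \ A, |F z| := Finset.abs_sum_le_sum_abs _ _
  have h2 : |∑ z ∈ A, F z| ≤ ∑ z ∈ X, |F z| := (Finset.abs_sum_le_sum_abs _ _).trans
    (Finset.sum_le_sum_of_subset_of_nonneg (hAB.trans hBX) fun _ _ _ => abs_nonneg _)
  rw [← e1, ← e2]
  set a := (A.card : ℝ)⁻¹
  set b := (B.card : ℝ)⁻¹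
  set S := ∑ z ∈ A, F z
  set D := ∑ z ∈ B \ A, F z
  set D' := ∑ z ∈ B \ A, |F z|
  calc |b * (D + S) - a * S| = |b * D + -((a - b) * S)| := by congr 1; ring
    _ ≤ |b * D| + |-((a - b) * S)| := abs_add_le _ _
    _ = b * |D| + (a - b) * |S| := by
        rw [abs_neg, abs_mul, abs_mul, abs_of_nonneg hB0, abs_of_nonneg (sub_nonneg.2 hinv)]
    _ ≤ c⁻¹ * D' + (a - b) * ∑ z ∈ X, |F z| := by
        gcongr
    _ = _ := by ring

lemma sq_sum_range_le {γ : ℝ} (hγ : 0 < γ) (hγ1 : γ < 1) (n : ℕ) (x : ℕ → ℝ) :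
    (∑ i ∈ Finset.range (n + 1), x i) ^ 2
      ≤ (1 - γ)⁻¹ * ∑ i ∈ Finset.range (n + 1), (γ ^ (n - i))⁻¹ * x i ^ 2 := by
  refine (Finset.sum_sq_le_sum_mul_sum_of_sq_le_mul (Finset.range (n + 1))
    (f := fun i => γ ^ (n - i)) (g := fun i => (γ ^ (n - i))⁻¹ * x i ^ 2)
    (fun i _ => by positivity) (fun i _ => by positivity) fun i _ => ?_).trans ?_
  · rw [mul_inv_cancel_left₀ (by positivity)]
  · refine mul_le_mul_of_nonneg_right ?_ (Finset.sum_nonneg fun i _ => by positivity)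
    rw [Finset.sum_flip (fun i => γ ^ i)]
    rw [← tsum_geometric_of_lt_one hγ.le hγ1]
    exact (summable_geometric_of_lt_one hγ.le hγ1).sum_le_tsum _ fun i _ => by positivity

/-- Control of increments and size of averages over nested sets at a single scale. -/
lemma exists_blockFn {α : Type*} (X : Finset α) {c γ : ℝ} (hc : 0 < c) (hγ : 0 < γ) (hγ1 : γ < 1)
    (n : ℕ) (F : ℕ → α → ℝ) (Y : ℕ → ℝ) (hY : ∀ i ≤ n, c⁻¹ * ∑ z ∈ X, |F i z| ≤ Y i)
    (𝒜 : Set (Finset α)) (hX : ∀ A ∈ 𝒜, A ⊆ X) (hcA : ∀ A ∈ 𝒜, c ≤ A.card)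
    (hF : ∀ A ∈ 𝒜, ∀ i ≤ n, |(A.card : ℝ)⁻¹ * ∑ z ∈ A, F i z| ≤ γ ^ (2 * (n - i)) * Y i) :
    ∃ Ψ : Finset α → ℝ,
      (∀ A ∈ 𝒜, 0 ≤ Ψ A ∧
        Ψ A ≤ 4 * (1 - γ)⁻¹ * ∑ i ∈ Finset.range (n + 1), γ ^ (n - i) * Y i ^ 2 ∧
        ((A.card : ℝ)⁻¹ * ∑ z ∈ A, ∑ i ∈ Finset.range (n + 1), F i z) ^ 2
          ≤ 4 * (1 - γ)⁻¹ * ∑ i ∈ Finset.range (n + 1), γ ^ (n - i) * Y i ^ 2) ∧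
      ∀ A ∈ 𝒜, ∀ B ∈ 𝒜, A ⊆ B →
        ((B.card : ℝ)⁻¹ * ∑ z ∈ B, ∑ i ∈ Finset.range (n + 1), F i z -
          (A.card : ℝ)⁻¹ * ∑ z ∈ A, ∑ i ∈ Finset.range (n + 1), F i z) ^ 2 ≤ Ψ B - Ψ A := by
  have hγi : 0 < (1 - γ)⁻¹ := inv_pos.2 (by linarith)
  set φ : ℕ → Finset α → ℝ := fun i A =>
    c⁻¹ * ∑ z ∈ A, |F i z| + (c⁻¹ - (A.card : ℝ)⁻¹) * ∑ z ∈ X, |F i z| with hφ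
  have hT : ∀ i, 0 ≤ ∑ z ∈ X, |F i z| := fun i => Finset.sum_nonneg fun _ _ => abs_nonneg _
  have hY0 : ∀ i ≤ n, 0 ≤ Y i := fun i hi => le_trans (by have := hT i; positivity) (hY i hi)
  have hφ0 : ∀ i, ∀ A ∈ 𝒜, 0 ≤ φ i A := by
    intro i A hA
    have h1 : (A.card : ℝ)⁻¹ ≤ c⁻¹ := inv_anti₀ hc (hcA A hA)
    exact add_nonneg (mul_nonneg (by positivity) (Finset.sum_nonneg fun _ _ => abs_nonneg _))
      (mul_nonneg (sub_nonneg.2 h1) (hT i))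
  have hφY : ∀ i ≤ n, ∀ A ∈ 𝒜, φ i A ≤ 2 * Y i := by
    intro i hi A hA
    have h1 : ∑ z ∈ A, |F i z| ≤ ∑ z ∈ X, |F i z| :=
      Finset.sum_le_sum_of_subset_of_nonneg (hX A hA) fun _ _ _ => abs_nonneg _
    have h2 : 0 ≤ (A.card : ℝ)⁻¹ * ∑ z ∈ X, |F i z| := mul_nonneg (by positivity) (hT i)
    have h3 : c⁻¹ * ∑ z ∈ A, |F i z| ≤ c⁻¹ * ∑ z ∈ X, |F i z| := by gcongr
    have h4 := hY i hi
    simp only [hφ, sub_mul]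
    linarith
  have hsum : ∀ A : Finset α, (A.card : ℝ)⁻¹ * ∑ z ∈ A, ∑ i ∈ Finset.range (n + 1), F i z
      = ∑ i ∈ Finset.range (n + 1), (A.card : ℝ)⁻¹ * ∑ z ∈ A, F i z := by
    intro A
    rw [Finset.sum_comm, Finset.mul_sum]
  have hpow : ∀ m, (γ ^ m)⁻¹ * γ ^ (2 * m) = γ ^ m := by
    intro m
    rw [two_mul, pow_add, inv_mul_cancel_left₀ (by positivity)]
  refine ⟨fun A => 2 * (1 - γ)⁻¹ * ∑ i ∈ Finset.range (n + 1), γ ^ (n - i) * (Y i * φ i A),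
    fun A hA => ⟨?_, ?_, ?_⟩, fun A hA B hB hAB => ?_⟩
  · refine mul_nonneg (by positivity) (Finset.sum_nonneg fun i hi => ?_)
    have := hY0 i (Finset.mem_range_succ_iff.1 hi)
    have := hφ0 i A hA
    positivity
  · have : ∑ i ∈ Finset.range (n + 1), γ ^ (n - i) * (Y i * φ i A)
        ≤ ∑ i ∈ Finset.range (n + 1), 2 * (γ ^ (n - i) * Y i ^ 2) := by
      refine Finset.sum_le_sum fun i hi => ?_
      have hi := Finset.mem_range_succ_iff.1 hi
      calc γ ^ (n - i) * (Y i * φ i A) ≤ γ ^ (n - i) * (Y i * (2 * Y i)) := by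
            gcongr
            · exact hY0 i hi
            · exact hφY i hi A hA
        _ = _ := by ring
    rw [← Finset.mul_sum] at this
    calc _ ≤ 2 * (1 - γ)⁻¹ * (2 * ∑ i ∈ Finset.range (n + 1), γ ^ (n - i) * Y i ^ 2) :=
          mul_le_mul_of_nonneg_left this (by positivity)
      _ = _ := by ring
  · rw [hsum]
    refine (sq_sum_range_le hγ hγ1 n _).trans ?_
    have h4 : (1 - γ)⁻¹ ≤ 4 * (1 - γ)⁻¹ := by linarith
    refine mul_le_mul h4 (Finset.sum_le_sum fun i hi => ?_)
      (Finset.sum_nonneg fun i _ => by positivity) (by positivity)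
    have hi := Finset.mem_range_succ_iff.1 hi
    have h5 := sq_le_sq' (by linarith [neg_abs_le ((A.card : ℝ)⁻¹ * ∑ z ∈ A, F i z), hF A hA i hi])
      ((le_abs_self _).trans (hF A hA i hi))
    have h6 : γ ^ (2 * (n - i)) ≤ 1 := pow_le_one₀ hγ.le hγ1.le
    calc (γ ^ (n - i))⁻¹ * ((A.card : ℝ)⁻¹ * ∑ z ∈ A, F i z) ^ 2
        ≤ (γ ^ (n - i))⁻¹ * (γ ^ (2 * (n - i)) * Y i) ^ 2 := by gcongr
      _ = ((γ ^ (n - i))⁻¹ * γ ^ (2 * (n - i))) * γ ^ (2 * (n - i)) * Y i ^ 2 := by ring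
      _ ≤ γ ^ (n - i) * 1 * Y i ^ 2 := by
          rw [hpow]
          gcongr
      _ = _ := by ring
  · rw [hsum, hsum, ← Finset.sum_sub_distrib, ← mul_sub, ← Finset.sum_sub_distrib]
    refine (sq_sum_range_le hγ hγ1 n _).trans ?_
    rw [mul_comm 2, mul_assoc]
    refine mul_le_mul_of_nonneg_left ?_ hγi.le
    rw [Finset.mul_sum]
    refine Finset.sum_le_sum fun i hi => ?_
    have hi := Finset.mem_range_succ_iff.1 hi
    set a := (A.card : ℝ)⁻¹ * ∑ z ∈ A, F i z with ha
    set b := (B.card : ℝ)⁻¹ * ∑ z ∈ B, F i z with hb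
    have h1 : |b - a| ≤ φ i B - φ i A := abs_avg_sub_avg_le hAB (hX B hB) hc (hcA A hA) (F i)
    have h2 : |b - a| ≤ 2 * (γ ^ (2 * (n - i)) * Y i) := by
      have := abs_sub b a
      have h3 := hF A hA i hi
      have h4 := hF B hB i hi
      linarith
    calc (γ ^ (n - i))⁻¹ * (b - a) ^ 2 = (γ ^ (n - i))⁻¹ * (|b - a| * |b - a|) := by
          rw [← sq, sq_abs]
      _ ≤ (γ ^ (n - i))⁻¹ * (2 * (γ ^ (2 * (n - i)) * Y i) * (φ i B - φ i A)) := by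
          gcongr
          exact (abs_nonneg _).trans h2
      _ = 2 * ((γ ^ (n - i))⁻¹ * γ ^ (2 * (n - i)) * (Y i * φ i B) -
            (γ ^ (n - i))⁻¹ * γ ^ (2 * (n - i)) * (Y i * φ i A)) := by ring
      _ = _ := by rw [hpow]

/-- Quadratic variation over several scales. -/
lemma sum_sq_sub_le {b : ℝ → ℝ} {n : ℝ → ℕ} (hn : ∀ t t', t ≤ t' → n t ≤ n t') {R : ℕ → ℝ}
    {Ψ : ℕ → ℝ → ℝ} (hΨ : ∀ t, 0 < t → 0 ≤ Ψ (n t) t ∧ Ψ (n t) t ≤ R (n t) ∧ b t ^ 2 ≤ R (n t))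
    (hR : ∀ m, 0 ≤ R m)
    (hb : ∀ t t', 0 < t → t ≤ t' → n t = n t' → (b t' - b t) ^ 2 ≤ Ψ (n t) t' - Ψ (n t) t)
    {u : ℕ → ℝ} (hu : Monotone u) (hu0 : 0 < u 0) (K : ℕ) :
    ∑ k ∈ Finset.range K, (b (u (k + 1)) - b (u k)) ^ 2
      ≤ 5 * ∑ m ∈ Finset.range (n (u K) + 1), R m := by
  set Ξ : ℝ → ℝ := fun t => 5 * ∑ m ∈ Finset.range (n t), R m + 2 * R (n t) + Ψ (n t) t with hΞ
  have hpos : ∀ k, 0 < u k := fun k => hu0.trans_le (hu (Nat.zero_le k))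
  have h1 : ∀ t t', 0 < t → t ≤ t' → (b t' - b t) ^ 2 ≤ Ξ t' - Ξ t := by
    intro t t' ht htt
    have h2 := hΨ t ht
    have h3 := hΨ t' (ht.trans_le htt)
    rcases (hn t t' htt).eq_or_lt with h | h
    · have := hb t t' ht htt h
      simp only [hΞ]
      rw [← h]
      linarith
    · have h4 : ∑ m ∈ Finset.range (n t + 1), R m ≤ ∑ m ∈ Finset.range (n t'), R m :=
        Finset.sum_le_sum_of_subset_of_nonneg (Finset.range_mono h) fun i _ _ => hR i
      rw [Finset.sum_range_succ] at h4
      simp only [hΞ]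
      nlinarith [sq_nonneg (b t' + b t)]
  calc ∑ k ∈ Finset.range K, (b (u (k + 1)) - b (u k)) ^ 2
      ≤ ∑ k ∈ Finset.range K, (Ξ (u (k + 1)) - Ξ (u k)) :=
        Finset.sum_le_sum fun k _ => h1 _ _ (hpos k) (hu k.le_succ)
    _ = Ξ (u K) - Ξ (u 0) := Finset.sum_range_sub (fun k => Ξ (u k)) K
    _ ≤ Ξ (u K) := by
        have h2 := (hΨ (u 0) (hpos 0)).1
        have h3 : 0 ≤ ∑ m ∈ Finset.range (n (u 0)), R m := Finset.sum_nonneg fun i _ => hR i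
        have h4 := hR (n (u 0))
        have : 0 ≤ Ξ (u 0) := by simp only [hΞ]; positivity
        linarith
    _ ≤ _ := by
        have h2 := (hΨ (u K) (hpos K)).2.1
        have h4 := hR (n (u K))
        rw [Finset.sum_range_succ]
        simp only [hΞ]
        linarith

/-- Martingale differences of the tensor product of two functions. -/
def pairDiff (s : ℕ) (f g : (Fin d → ℤ) → ℝ) (z : (Fin d → ℤ) × (Fin d → ℤ)) : ℝ :=
  cExp s f z.1 * cExp s g z.2 - cExp (s + 1) f z.1 * cExp (s + 1) g z.2

lemma sum_pairDiff_cube (s : ℕ) (f g : (Fin d → ℤ) → ℝ) (x y : Fin d → ℤ) :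
    ∑ w ∈ dyCube (s + 1) x ×ˢ dyCube (s + 1) y, pairDiff s f g w = 0 := by
  simp only [pairDiff, Finset.sum_sub_distrib, Finset.sum_product]
  rw [← Finset.sum_mul_sum, ← Finset.sum_mul_sum, sum_dyCube_cExp s.le_succ,
    sum_dyCube_cExp s.le_succ, sum_dyCube_cExp le_rfl, sum_dyCube_cExp le_rfl, sub_self]

lemma sum_pairDiff_of_invariant (s : ℕ) (f g : (Fin d → ℤ) → ℝ)
    {I : Finset ((Fin d → ℤ) × (Fin d → ℤ))}
    (hI : ∀ z ∈ I, dyCube (s + 1) z.1 ×ˢ dyCube (s + 1) z.2 ⊆ I) :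
    ∑ z ∈ I, pairDiff s f g z = 0 := by
  have h1 : ∑ z ∈ I, ∑ w ∈ dyCube (s + 1) z.1 ×ˢ dyCube (s + 1) z.2, pairDiff s f g w = 0 :=
    Finset.sum_eq_zero fun z _ => sum_pairDiff_cube s f g z.1 z.2
  rw [Finset.sum_comm' (t' := I) (s' := fun w => dyCube (s + 1) w.1 ×ˢ dyCube (s + 1) w.2)] at h1
  · simp only [Finset.sum_const, Finset.card_product, card_dyCube, ← Finset.smul_sum] at h1
    exact (smul_eq_zero.1 h1).resolve_left (by positivity)
  · intro z w
    simp only [Finset.mem_product]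
    constructor
    · rintro ⟨hz, hw1, hw2⟩
      exact ⟨⟨mem_dyCube_comm.1 hw1, mem_dyCube_comm.1 hw2⟩,
        hI z hz (Finset.mem_product.2 ⟨hw1, hw2⟩)⟩
    · rintro ⟨⟨hz1, hz2⟩, hw⟩
      exact ⟨hI w hw (Finset.mem_product.2 ⟨hz1, hz2⟩), mem_dyCube_comm.1 hz1,
        mem_dyCube_comm.1 hz2⟩

open Classical in
/-- The points of a finite set whose dyadic cube leaves the set. -/
def bdry (s : ℕ) (A : Finset ((Fin d → ℤ) × (Fin d → ℤ))) : Finset ((Fin d → ℤ) × (Fin d → ℤ)) :=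
  A.filter fun z => ¬ dyCube s z.1 ×ˢ dyCube s z.2 ⊆ A

lemma abs_sum_pairDiff_le (s : ℕ) (f g : (Fin d → ℤ) → ℝ)
    (A : Finset ((Fin d → ℤ) × (Fin d → ℤ))) :
    |∑ z ∈ A, pairDiff s f g z| ≤ ∑ z ∈ bdry (s + 1) A, |pairDiff s f g z| := by
  classical
  have h0 : ∑ z ∈ A.filter (fun z => dyCube (s + 1) z.1 ×ˢ dyCube (s + 1) z.2 ⊆ A),
      pairDiff s f g z = 0 := by
    refine sum_pairDiff_of_invariant s f g fun z hz w hw => ?_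
    rw [Finset.mem_filter] at hz ⊢
    have hw' := Finset.mem_product.1 hw
    rw [dyCube_eq hw'.1, dyCube_eq hw'.2]
    exact ⟨hz.2 hw, hz.2⟩
  rw [← Finset.sum_filter_add_sum_filter_not A
    (fun z => dyCube (s + 1) z.1 ×ˢ dyCube (s + 1) z.2 ⊆ A), h0, zero_add]
  refine (Finset.abs_sum_le_sum_abs _ _).trans (le_of_eq ?_)
  unfold bdry
  congr!

lemma sum_abs_le_of_card_le {α : Type*} {B X : Finset α} (hBX : B ⊆ X) {ρ δ N : ℝ} (hρ : 1 < ρ)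
    (hδ : 0 ≤ δ) (hN : 0 < N) (hB : (B.card : ℝ) ≤ δ * N) (F : α → ℝ) :
    ∑ z ∈ B, |F z| ≤ δ ^ (1 - ρ⁻¹) * N * (N⁻¹ * ∑ z ∈ X, |F z| ^ ρ) ^ ρ⁻¹ := by
  have hρ0 : 0 < ρ := by linarith
  have hc := Real.HolderConjugate.conjExponent hρ
  have h1 := Real.inner_le_Lp_mul_Lq B (fun z => |F z|) (fun _ => (1 : ℝ)) hc
  have he : 1 / ρ.conjExponent = 1 - ρ⁻¹ := by
    have := hc.inv_add_inv_eq_one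
    rw [one_div]; linarith
  have he0 : 0 ≤ 1 - ρ⁻¹ := by
    have := inv_le_one_of_one_le₀ hρ.le
    linarith
  simp only [mul_one, abs_abs, abs_one, Real.one_rpow, Finset.sum_const, nsmul_eq_mul] at h1
  rw [he, one_div] at h1
  have hs0 : 0 ≤ ∑ z ∈ B, |F z| ^ ρ := Finset.sum_nonneg fun _ _ => by positivity
  have hs : ∑ z ∈ B, |F z| ^ ρ ≤ ∑ z ∈ X, |F z| ^ ρ :=
    Finset.sum_le_sum_of_subset_of_nonneg hBX fun _ _ _ => by positivity
  calc ∑ z ∈ B, |F z| ≤ (∑ z ∈ X, |F z| ^ ρ) ^ ρ⁻¹ * (δ * N) ^ (1 - ρ⁻¹) := by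
        refine h1.trans ?_
        gcongr
    _ = (N * (N⁻¹ * ∑ z ∈ X, |F z| ^ ρ)) ^ ρ⁻¹ * (δ * N) ^ (1 - ρ⁻¹) := by
        rw [mul_inv_cancel_left₀ hN.ne']
    _ = δ ^ (1 - ρ⁻¹) * (N ^ ρ⁻¹ * N ^ (1 - ρ⁻¹)) * (N⁻¹ * ∑ z ∈ X, |F z| ^ ρ) ^ ρ⁻¹ := by
        rw [Real.mul_rpow hN.le (mul_nonneg (by positivity) (hs0.trans hs)),
          Real.mul_rpow hδ hN.le]
        ring
    _ = _ := by
        rw [← Real.rpow_add hN, add_sub_cancel, Real.rpow_one]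

/-- Reflection of pairs of lattice points through `x`. -/
def pairRefl (x : Fin d → ℤ) : (Fin d → ℤ) × (Fin d → ℤ) ≃ (Fin d → ℤ) × (Fin d → ℤ) :=
  (Equiv.subLeft x).prodCongr (Equiv.subLeft x)

lemma pairRefl_apply (x : Fin d → ℤ) (z : (Fin d → ℤ) × (Fin d → ℤ)) :
    pairRefl x z = (x - z.1, x - z.2) := rfl

lemma pairRefl_pairRefl (x : Fin d → ℤ) (z : (Fin d → ℤ) × (Fin d → ℤ)) :
    pairRefl x (pairRefl x z) = z := by
  simp [pairRefl_apply]

lemma mem_map_pairRefl {x : Fin d → ℤ} {A : Finset ((Fin d → ℤ) × (Fin d → ℤ))}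
    {z : (Fin d → ℤ) × (Fin d → ℤ)} :
    z ∈ A.map (pairRefl x).toEmbedding ↔ pairRefl x z ∈ A := by
  rw [Finset.mem_map_equiv, (Equiv.symm_apply_eq _).2 (pairRefl_pairRefl x z).symm]

lemma map_subset_ctrCube {Λ : ℝ → Finset ((Fin d → ℤ) × (Fin d → ℤ))} {n : ℝ → ℕ} {c L : ℝ}
    (h : IsAdmissible Λ n c L) {t : ℝ} (ht : 0 < t) (x : Fin d → ℤ) :
    (Λ t).map (pairRefl x).toEmbedding ⊆ ctrCube (n t) x ×ˢ ctrCube (n t) x := by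
  intro z hz
  have h1 := h.abs_le t ht _ (mem_map_pairRefl.1 hz)
  simp only [pairRefl_apply, Pi.sub_apply] at h1
  exact Finset.mem_product.2 ⟨mem_ctrCube.2 fun i => abs_sub_comm (x i) _ ▸ (h1 i).1,
    mem_ctrCube.2 fun i => abs_sub_comm (x i) _ ▸ (h1 i).2⟩

lemma card_bdry_le {Λ : ℝ → Finset ((Fin d → ℤ) × (Fin d → ℤ))} {n : ℝ → ℕ} {c L : ℝ}
    (h : IsAdmissible Λ n c L) {t : ℝ} (ht : 0 < t) (x : Fin d → ℤ) {s : ℕ} (hs : s < n t) :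
    ((bdry (s + 1) ((Λ t).map (pairRefl x).toEmbedding)).card : ℝ)
      ≤ L * ((2 : ℝ) ^ (n t - s))⁻¹ * 2 ^ (n t * (2 * d)) := by
  have h1 := h.card_le t ht s hs
    ((bdry (s + 1) ((Λ t).map (pairRefl x).toEmbedding)).map (pairRefl x).toEmbedding) ?_
  · rw [Finset.card_map] at h1
    rw [mul_right_comm, ← div_eq_mul_inv, le_div_iff₀ (by positivity)]
    exact h1
  · intro z hz
    rw [mem_map_pairRefl, bdry, Finset.mem_filter, mem_map_pairRefl, pairRefl_pairRefl] at hz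
    obtain ⟨hz, hz2⟩ := hz
    obtain ⟨w, hw, hw2⟩ := Finset.not_subset.1 hz2
    rw [mem_map_pairRefl] at hw2
    refine ⟨hz, _, hw2, fun i => ?_⟩
    obtain ⟨h3, h4⟩ := Finset.mem_product.1 hw
    have h5 := abs_sub_lt_of_mem_dyCube h3 i
    have h6 := abs_sub_lt_of_mem_dyCube h4 i
    simp only [pairRefl_apply, Pi.sub_apply] at h5 h6 ⊢
    constructor
    · convert h5 using 2; ring
    · convert h6 using 2; ring

/-- The single scale majorant of the martingale differences. -/
def scaleNorm (c L ρ : ℝ) (f g : (Fin d → ℤ) → ℝ) (x : Fin d → ℤ) (m i : ℕ) : ℝ :=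
  if i < m then
    c⁻¹ * L ^ (1 - ρ⁻¹) * (((2 : ℝ) ^ (m * (2 * d)))⁻¹ *
      ∑ z ∈ ctrCube m x ×ˢ ctrCube m x, |pairDiff i f g z| ^ ρ) ^ ρ⁻¹
  else (c * 2 ^ (m * (2 * d)))⁻¹ * ∑ z ∈ ctrCube m x ×ˢ ctrCube m x,
      |cExp m f z.1 * cExp m g z.2 - cExp m f x * cExp m g x|

/-- The weighted sum of squares of single scale majorants. -/
def scaleSq (c L ρ γ : ℝ) (f g : (Fin d → ℤ) → ℝ) (x : Fin d → ℤ) (m : ℕ) : ℝ :=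
  4 * (1 - γ)⁻¹ * ∑ i ∈ Finset.range (m + 1), γ ^ (m - i) * scaleNorm c L ρ f g x m i ^ 2

lemma scaleSq_nonneg (c L ρ : ℝ) {γ : ℝ} (hγ : 0 < γ) (hγ1 : γ < 1) (f g : (Fin d → ℤ) → ℝ)
    (x : Fin d → ℤ) (m : ℕ) : 0 ≤ scaleSq c L ρ γ f g x m := by
  have : 0 < (1 - γ)⁻¹ := inv_pos.2 (by linarith)
  unfold scaleSq
  exact mul_nonneg (by positivity) (Finset.sum_nonneg fun i _ => by positivity)

theorem sum_sq_sub_le_scaleSq {Λ : ℝ → Finset ((Fin d → ℤ) × (Fin d → ℤ))} {n : ℝ → ℕ} {c L : ℝ}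
    (h : IsAdmissible Λ n c L) {ρ γ : ℝ} (hρ : 1 < ρ) (hγ : 0 < γ) (hγ1 : γ < 1)
    (hγρ : (2 : ℝ)⁻¹ ^ (1 - ρ⁻¹) = γ ^ 2) (f g : (Fin d → ℤ) → ℝ) (x : Fin d → ℤ) {b : ℝ → ℝ}
    (hb : ∀ t, 0 < t → b t = ((Λ t).card : ℝ)⁻¹ * ∑ z ∈ Λ t, f (x - z.1) * g (x - z.2)
      - cExp (n t) f x * cExp (n t) g x)
    {u : ℕ → ℝ} (hu : Monotone u) (hu0 : 0 < u 0) (K : ℕ) :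
    ∑ k ∈ Finset.range K, (b (u (k + 1)) - b (u k)) ^ 2
      ≤ 5 * ∑ m ∈ Finset.range (n (u K) + 1), scaleSq c L ρ γ f g x m := by
  have hc0 := h.c_pos
  have hL : 0 < L := lt_of_lt_of_le (by positivity) h.le_L
  set F : ℕ → ℕ → (Fin d → ℤ) × (Fin d → ℤ) → ℝ := fun m i z =>
    if i < m then pairDiff i f g z else
      cExp m f z.1 * cExp m g z.2 - cExp m f x * cExp m g x with hF
  set Γ : ℝ → Finset ((Fin d → ℤ) × (Fin d → ℤ)) := fun t => (Λ t).map (pairRefl x).toEmbedding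
    with hΓ
  have hΓc : ∀ t, (Γ t).card = (Λ t).card := fun t => Finset.card_map _
  have hsumF : ∀ m z, ∑ i ∈ Finset.range (m + 1), F m i z
      = f z.1 * g z.2 - cExp m f x * cExp m g x := by
    intro m z
    rw [Finset.sum_range_succ]
    simp only [hF, lt_irrefl, if_false]
    rw [Finset.sum_congr rfl fun i hi => if_pos (Finset.mem_range.1 hi)]
    simp only [pairDiff]
    rw [Finset.sum_range_sub' (fun i => cExp i f z.1 * cExp i g z.2), cExp_zero, cExp_zero]
    ring
  have hbΓ : ∀ t, 0 < t → b t = ((Γ t).card : ℝ)⁻¹ *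
      ∑ z ∈ Γ t, ∑ i ∈ Finset.range (n t + 1), F (n t) i z := by
    intro t ht
    have hcard : (0 : ℝ) < (Λ t).card := lt_of_lt_of_le (by positivity) (h.le_card t ht)
    simp only [hsumF]
    rw [hb t ht, hΓc, Finset.sum_sub_distrib, Finset.sum_const, hΓc, nsmul_eq_mul, mul_sub,
      inv_mul_cancel_left₀ hcard.ne', Finset.sum_map]
    rfl
  have hbox : ∀ m, (((ctrCube m x ×ˢ ctrCube m x).card : ℕ) : ℝ) ≤ L * 2 ^ (m * (2 * d)) := by
    intro m
    have h1 := card_ctrCube_le m x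
    calc (((ctrCube m x ×ˢ ctrCube m x).card : ℕ) : ℝ)
        = (ctrCube m x).card * (ctrCube m x).card := by rw [Finset.card_product]; push_cast; rfl
      _ ≤ (2 ^ ((m + 4) * d) : ℕ) * (2 ^ ((m + 4) * d) : ℕ) := by gcongr
      _ = 2 ^ (4 * (2 * d)) * 2 ^ (m * (2 * d)) := by push_cast; ring
      _ ≤ _ := by gcongr; exact h.le_L
  have hblock : ∀ m, ∃ Ψ : Finset ((Fin d → ℤ) × (Fin d → ℤ)) → ℝ,
      (∀ A ∈ Γ '' {t | 0 < t ∧ n t = m}, 0 ≤ Ψ A ∧ Ψ A ≤ scaleSq c L ρ γ f g x m ∧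
        ((A.card : ℝ)⁻¹ * ∑ z ∈ A, ∑ i ∈ Finset.range (m + 1), F m i z) ^ 2
          ≤ scaleSq c L ρ γ f g x m) ∧
      ∀ A ∈ Γ '' {t | 0 < t ∧ n t = m}, ∀ B ∈ Γ '' {t | 0 < t ∧ n t = m}, A ⊆ B →
        ((B.card : ℝ)⁻¹ * ∑ z ∈ B, ∑ i ∈ Finset.range (m + 1), F m i z -
          (A.card : ℝ)⁻¹ * ∑ z ∈ A, ∑ i ∈ Finset.range (m + 1), F m i z) ^ 2 ≤ Ψ B - Ψ A := by
    intro m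
    set N : ℝ := 2 ^ (m * (2 * d)) with hN
    have hN0 : 0 < N := by positivity
    refine exists_blockFn (ctrCube m x ×ˢ ctrCube m x) (c := c * N) (by positivity) hγ hγ1 m (F m)
      (scaleNorm c L ρ f g x m) ?_ _ ?_ ?_ ?_
    · intro i hi
      rcases hi.lt_or_eq with hi | rfl
      · simp only [hF, scaleNorm, if_pos hi]
        rw [← hN]
        calc _ ≤ (c * N)⁻¹ * (L ^ (1 - ρ⁻¹) * N * (N⁻¹ *
              ∑ z ∈ ctrCube m x ×ˢ ctrCube m x, |pairDiff i f g z| ^ ρ) ^ ρ⁻¹) := by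
              gcongr
              exact sum_abs_le_of_card_le subset_rfl hρ hL.le hN0 (hbox m) _
          _ = _ := by field_simp
      · simp only [hF, scaleNorm, lt_irrefl, if_false]
        rw [← hN]
    · rintro _ ⟨t, ⟨ht, rfl⟩, rfl⟩
      exact map_subset_ctrCube h ht x
    · rintro _ ⟨t, ⟨ht, rfl⟩, rfl⟩
      rw [hΓc]
      exact h.le_card t ht
    · rintro _ ⟨t, ⟨ht, rfl⟩, rfl⟩ i hi
      have hcard : ((Γ t).card : ℝ)⁻¹ ≤ (c * N)⁻¹ := by
        rw [hΓc]
        exact inv_anti₀ (by positivity) (h.le_card t ht)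
      have hsub := map_subset_ctrCube h ht x
      rw [abs_mul, abs_of_nonneg (by positivity : (0 : ℝ) ≤ ((Γ t).card : ℝ)⁻¹)]
      rcases hi.lt_or_eq with hi | rfl
      · simp only [hF, scaleNorm, if_pos hi]
        rw [← hN]
        calc _ ≤ (c * N)⁻¹ * ((L * ((2 : ℝ) ^ (n t - i))⁻¹) ^ (1 - ρ⁻¹) * N * (N⁻¹ *
              ∑ z ∈ ctrCube (n t) x ×ˢ ctrCube (n t) x, |pairDiff i f g z| ^ ρ) ^ ρ⁻¹) := by
              gcongr
              refine (abs_sum_pairDiff_le i f g (Γ t)).trans ?_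
              exact sum_abs_le_of_card_le ((Finset.filter_subset _ _).trans hsub) hρ
                (by positivity) hN0 (card_bdry_le h ht x hi) _
          _ = (c * N)⁻¹ * (L ^ (1 - ρ⁻¹) * γ ^ (2 * (n t - i)) * N * (N⁻¹ *
              ∑ z ∈ ctrCube (n t) x ×ˢ ctrCube (n t) x, |pairDiff i f g z| ^ ρ) ^ ρ⁻¹) := by
              rw [Real.mul_rpow hL.le (by positivity), ← inv_pow, ← Real.rpow_natCast,
                ← Real.rpow_mul (by norm_num), mul_comm (((n t - i : ℕ) : ℝ)),
                Real.rpow_mul (by norm_num), hγρ, Real.rpow_natCast, ← pow_mul]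
          _ = _ := by field_simp
      · simp only [hF, scaleNorm, lt_irrefl, if_false, Nat.sub_self, mul_zero, pow_zero, one_mul]
        rw [← hN]
        gcongr
        exact (Finset.abs_sum_le_sum_abs _ _).trans
          (Finset.sum_le_sum_of_subset_of_nonneg hsub fun _ _ _ => abs_nonneg _)
  choose Ψ hΨ hΨ' using hblock
  refine sum_sq_sub_le (n := n) (Ψ := fun m t => Ψ m (Γ t)) h.scale_mono
    (R := scaleSq c L ρ γ f g x) (fun t ht => ?_) (scaleSq_nonneg c L ρ hγ hγ1 f g x) (fun t t' ht htt hn => ?_)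
    hu hu0 K
  · rw [hbΓ t ht]
    exact hΨ (n t) _ ⟨t, ⟨ht, rfl⟩, rfl⟩
  · rw [hbΓ t ht, hbΓ t' (ht.trans_le htt), ← hn]
    exact hΨ' (n t) _ ⟨t, ⟨ht, rfl⟩, rfl⟩ _ ⟨t', ⟨ht.trans_le htt, hn.symm⟩, rfl⟩
      (Finset.map_subset_map.2 (h.mono t t' ht htt))

lemma ennreal_add_rpow_le (a b : ℝ≥0∞) {t : ℝ} (ht : 0 ≤ t) :
    (a + b) ^ t ≤ 2 ^ t * (a ^ t + b ^ t) := by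
  rcases le_total a b with h | h
  · calc (a + b) ^ t ≤ (2 * b) ^ t := by
          gcongr
          rw [two_mul]
          gcongr
      _ = 2 ^ t * b ^ t := ENNReal.mul_rpow_of_nonneg _ _ ht
      _ ≤ _ := by
          gcongr
          exact le_add_self
  · calc (a + b) ^ t ≤ (2 * a) ^ t := by
          gcongr
          rw [two_mul]
          gcongr
      _ = 2 ^ t * a ^ t := ENNReal.mul_rpow_of_nonneg _ _ ht
      _ ≤ _ := by
          gcongr
          exact le_self_add

/-- The iterated `ρ`-maximal function. -/
def maxRho (ρ : ℝ) (f : (Fin d → ℤ) → ℝ) (x : Fin d → ℤ) : ℝ≥0∞ :=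
  maxFn (fun y => maxFn (fun w => ENNReal.ofReal (f w)) y ^ ρ) x ^ (1 / ρ)

lemma maxFn_le_maxRho {ρ : ℝ} (hρ : 0 < ρ) (f : (Fin d → ℤ) → ℝ) (x : Fin d → ℤ) :
    maxFn (fun w => ENNReal.ofReal (f w)) x ≤ maxRho ρ f x := by
  rw [maxRho, one_div, ENNReal.le_rpow_inv_iff hρ]
  exact le_maxFn (fun y => maxFn (fun w => ENNReal.ofReal (f w)) y ^ ρ) x

lemma ctrAvg_maxFn_le {ρ : ℝ} (hρ : 0 < ρ) (f : (Fin d → ℤ) → ℝ) (n : ℕ) (x : Fin d → ℤ) :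
    ctrAvg n (fun y => maxFn (fun w => ENNReal.ofReal (f w)) y ^ ρ) x ≤ maxRho ρ f x ^ ρ := by
  rw [maxRho, ← ENNReal.rpow_mul, one_div, inv_mul_cancel₀ hρ.ne', ENNReal.rpow_one]
  exact ctrAvg_le_maxFn n _ x

lemma sum_ctrCube_prod (m : ℕ) (x : Fin d → ℤ) (u v : (Fin d → ℤ) → ℝ≥0∞) :
    (2 ^ (m * (2 * d)))⁻¹ * ∑ z ∈ ctrCube m x ×ˢ ctrCube m x, u z.1 * v z.2
      = ctrAvg m u x * ctrAvg m v x := by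
  rw [Finset.sum_product, ← Finset.sum_mul_sum, ctrAvg, ctrAvg,
    show m * (2 * d) = m * d + m * d by ring, pow_add,
    ENNReal.mul_inv (Or.inl (by positivity)) (Or.inl (by simp))]
  ring

lemma ofReal_cExp_le_maxFn {f : (Fin d → ℤ) → ℝ} (hf : ∀ x, 0 < f x) (n : ℕ) (x : Fin d → ℤ) :
    ENNReal.ofReal (cExp n f x) ≤ maxFn (fun w => ENNReal.ofReal (f w)) x := by
  rw [ofReal_cExp fun y => (hf y).le]
  exact eExp_le_maxFn n _ x

lemma ofReal_abs_pairDiff_le {f g : (Fin d → ℤ) → ℝ} (hf : ∀ x, 0 < f x) (hg : ∀ x, 0 < g x)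
    (i : ℕ) (z : (Fin d → ℤ) × (Fin d → ℤ)) :
    ENNReal.ofReal |pairDiff i f g z|
      ≤ absDiff i f z.1 * maxFn (fun w => ENNReal.ofReal (g w)) z.2 +
        maxFn (fun w => ENNReal.ofReal (f w)) z.1 * absDiff i g z.2 := by
  have e : pairDiff i f g z
      = dDiff i f z.1 * cExp i g z.2 + cExp (i + 1) f z.1 * dDiff i g z.2 := by
    unfold pairDiff dDiff; ring
  have h1 := cExp_pos hg i z.2
  have h2 := cExp_pos hf (i + 1) z.1
  calc _ ≤ ENNReal.ofReal (|dDiff i f z.1| * cExp i g z.2 + cExp (i + 1) f z.1 * |dDiff i g z.2|) := by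
        apply ENNReal.ofReal_le_ofReal
        rw [e]
        refine (abs_add_le _ _).trans ?_
        rw [abs_mul, abs_mul, abs_of_pos h1, abs_of_pos h2]
    _ = absDiff i f z.1 * ENNReal.ofReal (cExp i g z.2) +
          ENNReal.ofReal (cExp (i + 1) f z.1) * absDiff i g z.2 := by
        rw [ENNReal.ofReal_add (by positivity) (by positivity), ENNReal.ofReal_mul (by positivity),
          ENNReal.ofReal_mul h2.le]
        rfl
    _ ≤ _ := by
        gcongr
        · exact ofReal_cExp_le_maxFn hg _ _
        · exact ofReal_cExp_le_maxFn hf _ _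

lemma ofReal_avg_pairDiff_le {ρ : ℝ} (hρ : 0 < ρ) {f g : (Fin d → ℤ) → ℝ} (hf : ∀ x, 0 < f x)
    (hg : ∀ x, 0 < g x) (x : Fin d → ℤ) (m i : ℕ) :
    ENNReal.ofReal (((2 : ℝ) ^ (m * (2 * d)))⁻¹ *
      ∑ z ∈ ctrCube m x ×ˢ ctrCube m x, |pairDiff i f g z| ^ ρ)
    ≤ 2 ^ ρ * (ctrAvg m (fun y => absDiff i f y ^ ρ) x * maxRho ρ g x ^ ρ +
        maxRho ρ f x ^ ρ * ctrAvg m (fun y => absDiff i g y ^ ρ) x) := by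
  set Mf := maxFn (fun w => ENNReal.ofReal (f w)) with hMf
  set Mg := maxFn (fun w => ENNReal.ofReal (g w)) with hMg
  rw [ENNReal.ofReal_mul (by positivity), ENNReal.ofReal_sum_of_nonneg fun _ _ => by positivity,
    ENNReal.ofReal_inv_of_pos (by positivity), ENNReal.ofReal_pow (by norm_num),
    ENNReal.ofReal_ofNat]
  calc _ ≤ (2 ^ (m * (2 * d)))⁻¹ * ∑ z ∈ ctrCube m x ×ˢ ctrCube m x,
        2 ^ ρ * (absDiff i f z.1 ^ ρ * Mg z.2 ^ ρ + Mf z.1 ^ ρ * absDiff i g z.2 ^ ρ) := by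
        gcongr with z
        rw [← ENNReal.ofReal_rpow_of_nonneg (abs_nonneg _) hρ.le]
        calc _ ≤ (absDiff i f z.1 * Mg z.2 + Mf z.1 * absDiff i g z.2) ^ ρ := by
              gcongr
              exact ofReal_abs_pairDiff_le hf hg i z
          _ ≤ _ := by
              refine (ennreal_add_rpow_le _ _ hρ.le).trans_eq ?_
              rw [ENNReal.mul_rpow_of_nonneg _ _ hρ.le, ENNReal.mul_rpow_of_nonneg _ _ hρ.le]
    _ = 2 ^ ρ * (ctrAvg m (fun y => absDiff i f y ^ ρ) x * ctrAvg m (fun y => Mg y ^ ρ) x +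
        ctrAvg m (fun y => Mf y ^ ρ) x * ctrAvg m (fun y => absDiff i g y ^ ρ) x) := by
        rw [← Finset.mul_sum, Finset.sum_add_distrib, mul_left_comm, mul_add,
          sum_ctrCube_prod m x (fun y => absDiff i f y ^ ρ) (fun y => Mg y ^ ρ),
          sum_ctrCube_prod m x (fun y => Mf y ^ ρ) (fun y => absDiff i g y ^ ρ)]
    _ ≤ _ := by
        gcongr _ * (_ * ?_ + ?_ * _)
        · exact ctrAvg_maxFn_le hρ g m x
        · exact ctrAvg_maxFn_le hρ f m x

lemma ofReal_scaleNorm_sq_le {c L ρ : ℝ} (hc : 0 < c) (hL : 0 < L) (hρ : 0 < ρ)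
    {f g : (Fin d → ℤ) → ℝ} (hf : ∀ x, 0 < f x) (hg : ∀ x, 0 < g x) (x : Fin d → ℤ) {m i : ℕ}
    (hi : i < m) :
    ENNReal.ofReal (scaleNorm c L ρ f g x m i ^ 2)
      ≤ ENNReal.ofReal ((c⁻¹ * L ^ (1 - ρ⁻¹)) ^ 2) * (2 ^ (2 : ℝ) * 2 ^ (2 / ρ)) *
        (ctrAvg m (fun y => absDiff i f y ^ ρ) x ^ (2 / ρ) * maxRho ρ g x ^ (2 : ℝ) +
          maxRho ρ f x ^ (2 : ℝ) * ctrAvg m (fun y => absDiff i g y ^ ρ) x ^ (2 / ρ)) := by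
  have h2 : 0 ≤ 2 / ρ := by positivity
  have e : ρ * (2 / ρ) = 2 := by field_simp
  have hn : (0 : ℝ) ≤ ((2 : ℝ) ^ (m * (2 * d)))⁻¹ *
      ∑ z ∈ ctrCube m x ×ˢ ctrCube m x, |pairDiff i f g z| ^ ρ :=
    mul_nonneg (by positivity) (Finset.sum_nonneg fun _ _ => by positivity)
  rw [scaleNorm, if_pos hi, mul_pow, ENNReal.ofReal_mul (by positivity), ← Real.rpow_natCast
    ((_ : ℝ) ^ ρ⁻¹), ← Real.rpow_mul hn, show ρ⁻¹ * ((2 : ℕ) : ℝ) = 2 / ρ by push_cast; ring,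
    ← ENNReal.ofReal_rpow_of_nonneg hn h2, mul_assoc]
  gcongr _ * ?_
  calc _ ≤ (2 ^ ρ * (ctrAvg m (fun y => absDiff i f y ^ ρ) x * maxRho ρ g x ^ ρ +
        maxRho ρ f x ^ ρ * ctrAvg m (fun y => absDiff i g y ^ ρ) x)) ^ (2 / ρ) := by
        gcongr
        exact ofReal_avg_pairDiff_le hρ hf hg x m i
    _ ≤ _ := by
        rw [ENNReal.mul_rpow_of_nonneg _ _ h2, ← ENNReal.rpow_mul, e, mul_assoc]
        gcongr
        refine (ennreal_add_rpow_le _ _ h2).trans_eq ?_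
        rw [ENNReal.mul_rpow_of_nonneg _ _ h2, ENNReal.mul_rpow_of_nonneg _ _ h2,
          ← ENNReal.rpow_mul, ← ENNReal.rpow_mul, e]

lemma ofReal_scaleNorm_self_le {c L ρ : ℝ} (hc : 0 < c) (hρ : 0 < ρ)
    {f g : (Fin d → ℤ) → ℝ} (hf : ∀ x, 0 < f x) (hg : ∀ x, 0 < g x) (x : Fin d → ℤ) (m : ℕ) :
    ENNReal.ofReal (scaleNorm c L ρ f g x m m)
      ≤ ENNReal.ofReal c⁻¹ * 2 ^ (4 * (2 * d)) * 2 ^ d *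
        (oscFn m f x * maxRho ρ g x + maxRho ρ f x * oscFn m g x) := by
  have hN : (0 : ℝ) < 2 ^ (m * (2 * d)) := by positivity
  have hpt : ∀ z ∈ ctrCube m x ×ˢ ctrCube m x,
      ENNReal.ofReal |cExp m f z.1 * cExp m g z.2 - cExp m f x * cExp m g x|
        ≤ 2 ^ d * (oscFn m f x * maxRho ρ g x + maxRho ρ f x * oscFn m g x) := by
    intro z hz
    obtain ⟨hz1, hz2⟩ := Finset.mem_product.1 hz
    have h1 := cExp_pos hg m z.2
    have h2 := cExp_pos hf m x
    have e : cExp m f z.1 * cExp m g z.2 - cExp m f x * cExp m g x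
        = (cExp m f z.1 - cExp m f x) * cExp m g z.2 +
          cExp m f x * (cExp m g z.2 - cExp m g x) := by ring
    have hd1 : (1 : ℝ≥0∞) ≤ 2 ^ d := one_le_pow₀ (by norm_num)
    have o1 : ENNReal.ofReal |cExp m f z.1 - cExp m f x| ≤ oscFn m f x :=
      Finset.le_sup (f := fun y => ENNReal.ofReal |cExp m f y - cExp m f x|) hz1
    have o2 : ENNReal.ofReal |cExp m g z.2 - cExp m g x| ≤ oscFn m g x :=
      Finset.le_sup (f := fun y => ENNReal.ofReal |cExp m g y - cExp m g x|) hz2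
    have m1 : ENNReal.ofReal (cExp m g z.2) ≤ 2 ^ d * maxRho ρ g x := by
      rw [ofReal_cExp fun y => (hg y).le]
      refine (eExp_le_ctrAvg_succ m _ hz2).trans ?_
      gcongr
      exact (ctrAvg_le_maxFn _ _ x).trans (maxFn_le_maxRho hρ g x)
    have m2 : ENNReal.ofReal (cExp m f x) ≤ 2 ^ d * maxRho ρ f x :=
      ((ofReal_cExp_le_maxFn hf m x).trans (maxFn_le_maxRho hρ f x)).trans
        (le_mul_of_one_le_left bot_le hd1)
    calc _ ≤ ENNReal.ofReal (|cExp m f z.1 - cExp m f x| * cExp m g z.2 +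
          cExp m f x * |cExp m g z.2 - cExp m g x|) := by
          apply ENNReal.ofReal_le_ofReal
          rw [e]
          refine (abs_add_le _ _).trans ?_
          rw [abs_mul, abs_mul, abs_of_pos h1, abs_of_pos h2]
      _ ≤ oscFn m f x * (2 ^ d * maxRho ρ g x) + (2 ^ d * maxRho ρ f x) * oscFn m g x := by
          rw [ENNReal.ofReal_add (by positivity) (by positivity),
            ENNReal.ofReal_mul (by positivity), ENNReal.ofReal_mul h2.le]
          gcongr
      _ = _ := by ring
  rw [scaleNorm, if_neg (lt_irrefl m), ENNReal.ofReal_mul (by positivity),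
    ENNReal.ofReal_sum_of_nonneg fun _ _ => abs_nonneg _, mul_inv,
    ENNReal.ofReal_mul (by positivity), ENNReal.ofReal_inv_of_pos hN,
    ENNReal.ofReal_pow (by norm_num), ENNReal.ofReal_ofNat, mul_assoc, mul_assoc, mul_assoc]
  gcongr _ * ?_
  refine (mul_le_mul_right (Finset.sum_le_card_nsmul _ _ _ hpt) _).trans ?_
  have hcard : (((ctrCube m x ×ˢ ctrCube m x).card : ℕ) : ℝ≥0∞)
      ≤ 2 ^ (4 * (2 * d)) * 2 ^ (m * (2 * d)) := by
    have h1 := card_ctrCube_le m x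
    have : (ctrCube m x ×ˢ ctrCube m x).card ≤ 2 ^ (4 * (2 * d)) * 2 ^ (m * (2 * d)) := by
      rw [Finset.card_product]
      calc _ ≤ 2 ^ ((m + 4) * d) * 2 ^ ((m + 4) * d) := Nat.mul_le_mul h1 h1
        _ = _ := by ring
    exact_mod_cast this
  rw [nsmul_eq_mul]
  calc _ ≤ (2 ^ (m * (2 * d)))⁻¹ * ((2 ^ (4 * (2 * d)) * 2 ^ (m * (2 * d))) * (2 ^ d *
        (oscFn m f x * maxRho ρ g x + maxRho ρ f x * oscFn m g x))) := by gcongr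
    _ = ((2 ^ (m * (2 * d)))⁻¹ * 2 ^ (m * (2 * d))) * (2 ^ (4 * (2 * d)) * (2 ^ d *
        (oscFn m f x * maxRho ρ g x + maxRho ρ f x * oscFn m g x))) := by ring
    _ = _ := by rw [two_pow_inv_mul_self, one_mul]

lemma tsum_sum_range_eq (φ : ℕ → ℕ → ℝ≥0∞) :
    ∑' m, ∑ i ∈ Finset.range m, φ m i = ∑' i, ∑' j, φ (i + 1 + j) i := by
  have h1 : ∀ m, ∑ i ∈ Finset.range m, φ m i = ∑' i, if i < m then φ m i else 0 := by
    intro m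
    rw [tsum_eq_sum (s := Finset.range m) fun i hi => if_neg (by simpa using hi)]
    exact Finset.sum_congr rfl fun i hi => (if_pos (Finset.mem_range.1 hi)).symm
  simp only [h1]
  rw [ENNReal.tsum_comm]
  refine tsum_congr fun i => ?_
  rw [← Summable.sum_add_tsum_nat_add' (f := fun m => if i < m then φ m i else 0) (k := i + 1)
    ENNReal.summable, Finset.sum_eq_zero fun m hm => if_neg (by simpa [Nat.lt_succ_iff] using hm), zero_add]
  refine tsum_congr fun j => ?_
  rw [if_pos (by omega), add_comm j]

lemma exists_tsum_scaleSq_le {c L ρ γ : ℝ} (hc : 0 < c) (hL : 0 < L) (hρ : 0 < ρ) (hγ : 0 < γ)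
    (hγ1 : γ < 1) : ∃ C : ℝ≥0∞, C ≠ ∞ ∧ ∀ f g : (Fin d → ℤ) → ℝ, (∀ x, 0 < f x) →
      (∀ x, 0 < g x) → ∀ x, ∑' m, ENNReal.ofReal (scaleSq c L ρ γ f g x m)
        ≤ C * ((sqFnA ρ (ENNReal.ofReal γ) f x + sqFnB f x) * maxRho ρ g x ^ (2 : ℝ) +
          maxRho ρ f x ^ (2 : ℝ) * (sqFnA ρ (ENNReal.ofReal γ) g x + sqFnB g x)) := by
  have hγi : 0 < (1 - γ)⁻¹ := inv_pos.2 (by linarith)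
  set b := ENNReal.ofReal γ with hb
  have hb1 : b ≤ 1 := ENNReal.ofReal_le_one.2 hγ1.le
  set C₁ : ℝ≥0∞ := ENNReal.ofReal ((c⁻¹ * L ^ (1 - ρ⁻¹)) ^ 2) * (2 ^ (2 : ℝ) * 2 ^ (2 / ρ)) with hC₁
  set C₂ : ℝ≥0∞ := (ENNReal.ofReal c⁻¹ * 2 ^ (4 * (2 * d)) * 2 ^ d) ^ (2 : ℝ) * 2 ^ (2 : ℝ) with hC₂
  have hC₁' : C₁ ≠ ∞ := ENNReal.mul_ne_top ENNReal.ofReal_ne_top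
    (ENNReal.mul_ne_top (by finiteness) (ENNReal.rpow_ne_top_of_nonneg (by positivity) (by simp)))
  have hC₂' : C₂ ≠ ∞ := ENNReal.mul_ne_top (ENNReal.rpow_ne_top_of_nonneg (by positivity)
    (by finiteness)) (by finiteness)
  refine ⟨ENNReal.ofReal (4 * (1 - γ)⁻¹) * (C₁ + C₂), ENNReal.mul_ne_top ENNReal.ofReal_ne_top
    (ENNReal.add_ne_top.2 ⟨hC₁', hC₂'⟩), fun f g hf hg x => ?_⟩
  set P := maxRho ρ f x ^ (2 : ℝ) with hP
  set Q := maxRho ρ g x ^ (2 : ℝ) with hQ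
  have hself : ∀ m, ENNReal.ofReal (scaleNorm c L ρ f g x m m ^ 2)
      ≤ C₂ * (oscFn m f x ^ (2 : ℝ) * Q + P * oscFn m g x ^ (2 : ℝ)) := by
    intro m
    have h0 : 0 ≤ scaleNorm c L ρ f g x m m := by
      rw [scaleNorm, if_neg (lt_irrefl m)]
      exact mul_nonneg (by positivity) (Finset.sum_nonneg fun _ _ => abs_nonneg _)
    rw [← Real.rpow_natCast, Nat.cast_ofNat, ← ENNReal.ofReal_rpow_of_nonneg h0 (by norm_num), hC₂,
      mul_assoc]
    calc _ ≤ (ENNReal.ofReal c⁻¹ * 2 ^ (4 * (2 * d)) * 2 ^ d *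
        (oscFn m f x * maxRho ρ g x + maxRho ρ f x * oscFn m g x)) ^ (2 : ℝ) := by
          gcongr
          exact ofReal_scaleNorm_self_le hc hρ hf hg x m
      _ ≤ _ := by
          rw [ENNReal.mul_rpow_of_nonneg _ _ (by norm_num)]
          gcongr _ * ?_
          refine (ennreal_add_rpow_le _ _ (by norm_num)).trans_eq ?_
          rw [ENNReal.mul_rpow_of_nonneg _ _ (by norm_num),
            ENNReal.mul_rpow_of_nonneg _ _ (by norm_num)]
  have hterm : ∀ m, ENNReal.ofReal (scaleSq c L ρ γ f g x m) ≤ ENNReal.ofReal (4 * (1 - γ)⁻¹) *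
      (∑ i ∈ Finset.range m, b ^ (m - i) * (C₁ *
        (ctrAvg m (fun y => absDiff i f y ^ ρ) x ^ (2 / ρ) * Q +
          P * ctrAvg m (fun y => absDiff i g y ^ ρ) x ^ (2 / ρ))) +
        C₂ * (oscFn m f x ^ (2 : ℝ) * Q + P * oscFn m g x ^ (2 : ℝ))) := by
    intro m
    rw [scaleSq, ENNReal.ofReal_mul (by positivity),
      ENNReal.ofReal_sum_of_nonneg fun _ _ => by positivity, Finset.sum_range_succ, Nat.sub_self,
      pow_zero, one_mul]
    gcongr _ * (?_ + ?_)
    · refine Finset.sum_le_sum fun i hi => ?_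
      rw [ENNReal.ofReal_mul (by positivity), ENNReal.ofReal_pow hγ.le]
      gcongr _ * ?_
      exact ofReal_scaleNorm_sq_le hc hL hρ hf hg x (Finset.mem_range.1 hi)
    · exact hself m
  refine (ENNReal.tsum_le_tsum hterm).trans ?_
  rw [ENNReal.tsum_mul_left, ENNReal.tsum_add, tsum_sum_range_eq, ENNReal.tsum_mul_left (a := C₂),
    ENNReal.tsum_add, ENNReal.tsum_mul_right, ENNReal.tsum_mul_left (a := P),
    mul_assoc (ENNReal.ofReal _)]
  gcongr _ * ?_
  have hA : ∑' i, ∑' j, b ^ (i + 1 + j - i) * (C₁ *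
        (ctrAvg (i + 1 + j) (fun y => absDiff i f y ^ ρ) x ^ (2 / ρ) * Q +
          P * ctrAvg (i + 1 + j) (fun y => absDiff i g y ^ ρ) x ^ (2 / ρ)))
      ≤ C₁ * (sqFnA ρ b f x * Q + P * sqFnA ρ b g x) := by
    calc _ ≤ ∑' i, ∑' j, C₁ * (b ^ j * ctrAvg (i + 1 + j) (fun y => absDiff i f y ^ ρ) x ^ (2 / ρ)
          * Q + P * (b ^ j * ctrAvg (i + 1 + j) (fun y => absDiff i g y ^ ρ) x ^ (2 / ρ))) := by
          refine ENNReal.tsum_le_tsum fun i => ENNReal.tsum_le_tsum fun j => ?_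
          rw [show i + 1 + j - i = j + 1 by omega]
          calc _ ≤ b ^ j * (C₁ *
                (ctrAvg (i + 1 + j) (fun y => absDiff i f y ^ ρ) x ^ (2 / ρ) * Q +
                P * ctrAvg (i + 1 + j) (fun y => absDiff i g y ^ ρ) x ^ (2 / ρ))) := by
                gcongr ?_ * _
                exact pow_le_pow_right_of_le_one' hb1 (Nat.le_succ j)
            _ = _ := by ring
      _ = _ := by
          simp only [ENNReal.tsum_mul_left, ENNReal.tsum_mul_right, ENNReal.tsum_add]
          rfl
  refine (add_le_add_left hA _).trans ?_
  change C₁ * (sqFnA ρ b f x * Q + P * sqFnA ρ b g x) + C₂ * (sqFnB f x * Q + P * sqFnB g x) ≤ _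
  calc _ ≤ (C₁ + C₂) * (sqFnA ρ b f x * Q + P * sqFnA ρ b g x) +
        (C₁ + C₂) * (sqFnB f x * Q + P * sqFnB g x) := by
        gcongr ?_ * _ + ?_ * _
        · exact le_self_add
        · exact le_add_self
    _ = _ := by ring

lemma vqVar_le_of_sum_range_le {q : ℝ} (hq : 0 < q) {a : ℝ → ℝ} {D : ℝ≥0∞}
    (h : ∀ u : ℕ → ℝ, StrictMono u → 0 < u 0 → ∀ K,
      ∑ k ∈ Finset.range K, ENNReal.ofReal |a (u (k + 1)) - a (u k)| ^ q ≤ D) :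
    vqVar q a ≤ D ^ (1 / q) := by
  unfold vqVar
  refine iSup_le fun u => iSup_le fun hu => iSup_le fun hu0 => ?_
  gcongr
  rw [ENNReal.tsum_eq_iSup_nat]
  exact iSup_le fun K => h u hu hu0 K

lemma sum_rpow_le_rpow_sum {ι : Type*} (s : Finset ι) (a : ι → ℝ≥0∞) {t : ℝ} (ht : 1 ≤ t) :
    ∑ i ∈ s, a i ^ t ≤ (∑ i ∈ s, a i) ^ t := by
  classical
  induction s using Finset.induction_on with
  | empty => simp
  | insert i s hi ih =>
    rw [Finset.sum_insert hi, Finset.sum_insert hi]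
    exact (add_le_add le_rfl ih).trans (ENNReal.add_rpow_le_rpow_add _ _ ht)

/-- The linear variation majorant. -/
def varFn (ρ γ q : ℝ) (f : (Fin d → ℤ) → ℝ) (x : Fin d → ℤ) : ℝ≥0∞ :=
  (sqFnA ρ (ENNReal.ofReal γ) f x + sqFnB f x) ^ (q / 2) + martVarPow q f x

lemma discAvg_eq {Λ : ℝ → Finset ((Fin d → ℤ) × (Fin d → ℤ))} {G : Set ((Fin d → ℝ) × (Fin d → ℝ))}
    {t : ℝ} (h : (Λ t : Set _) = latticePts d G t) (f g : (Fin d → ℤ) → ℝ) (x : Fin d → ℤ) :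
    discAvg d G f g t x = ((Λ t).card : ℝ)⁻¹ * ∑ z ∈ Λ t, f (x - z.1) * g (x - z.2) := by
  unfold discAvg
  rw [← h, ← tsum_subtype, ← tsum_subtype]
  rw [Finset.tsum_subtype' (Λ t) (fun _ => (1 : ℝ)),
    Finset.tsum_subtype' (Λ t) (fun z => f (x - z.1) * g (x - z.2))]
  simp

lemma sum_mul_rpow_le {ι : Type*} (s : Finset ι) {q : ℝ} (hq : 0 ≤ q) (a b : ι → ℝ≥0∞)
    (A B : ℝ≥0∞) :
    ∑ k ∈ s, (a k * B + A * b k) ^ q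
      ≤ 2 ^ q * ((∑ k ∈ s, a k ^ q) * B ^ q + A ^ q * ∑ k ∈ s, b k ^ q) := by
  rw [Finset.sum_mul, Finset.mul_sum, ← Finset.sum_add_distrib, Finset.mul_sum]
  refine Finset.sum_le_sum fun k _ => (ennreal_add_rpow_le _ _ hq).trans_eq ?_
  rw [ENNReal.mul_rpow_of_nonneg _ _ hq, ENNReal.mul_rpow_of_nonneg _ _ hq]

lemma sum_cExp_mul_cExp_le {q ρ : ℝ} (hq : 2 < q) (hρ : 0 < ρ) {f g : (Fin d → ℤ) → ℝ}
    (hf : ∀ x, 0 < f x) (hg : ∀ x, 0 < g x) (x : Fin d → ℤ) {n : ℕ → ℕ} (hn : Monotone n) (K : ℕ) :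
    ∑ k ∈ Finset.range K, ENNReal.ofReal |cExp (n (k + 1)) f x * cExp (n (k + 1)) g x -
        cExp (n k) f x * cExp (n k) g x| ^ q
      ≤ 2 ^ q * (martVarPow q f x * maxRho ρ g x ^ q + maxRho ρ f x ^ q * martVarPow q g x) := by
  have hq0 : 0 ≤ q := by linarith
  have hM : ∀ h : (Fin d → ℤ) → ℝ, (∀ x, 0 < h x) → ∀ k, ENNReal.ofReal (cExp k h x)
      ≤ maxRho ρ h x := fun h hh k => (ofReal_cExp_le_maxFn hh k x).trans (maxFn_le_maxRho hρ h x)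
  calc _ ≤ ∑ k ∈ Finset.range K,
        (ENNReal.ofReal |cExp (n (k + 1)) f x - cExp (n k) f x| * maxRho ρ g x +
          maxRho ρ f x * ENNReal.ofReal |cExp (n (k + 1)) g x - cExp (n k) g x|) ^ q := by
        gcongr with k
        have h1 := cExp_pos hg (n (k + 1)) x
        have h2 := cExp_pos hf (n k) x
        calc _ ≤ ENNReal.ofReal (|cExp (n (k + 1)) f x - cExp (n k) f x| * cExp (n (k + 1)) g x +
              cExp (n k) f x * |cExp (n (k + 1)) g x - cExp (n k) g x|) := by
              apply ENNReal.ofReal_le_ofReal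
              rw [show cExp (n (k + 1)) f x * cExp (n (k + 1)) g x - cExp (n k) f x * cExp (n k) g x
                = (cExp (n (k + 1)) f x - cExp (n k) f x) * cExp (n (k + 1)) g x +
                  cExp (n k) f x * (cExp (n (k + 1)) g x - cExp (n k) g x) by ring]
              refine (abs_add_le _ _).trans ?_
              rw [abs_mul, abs_mul, abs_of_pos h1, abs_of_pos h2]
          _ ≤ _ := by
              rw [ENNReal.ofReal_add (by positivity) (by positivity),
                ENNReal.ofReal_mul (by positivity), ENNReal.ofReal_mul h2.le]
              gcongr
              · exact hM g hg _
              · exact hM f hf _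
    _ ≤ _ := sum_mul_rpow_le _ hq0 _ _ _ _
    _ ≤ _ := by
        gcongr _ * (?_ * _ + _ * ?_)
        · exact sum_range_le_martVarPow q f x hn K
        · exact sum_range_le_martVarPow q g x hn K

/-- Pointwise domination of the variation of bilinear averages. -/
theorem exists_vqVar_discAvg_le {Λ : ℝ → Finset ((Fin d → ℤ) × (Fin d → ℤ))} {n : ℝ → ℕ} {c L : ℝ}
    (h : IsAdmissible Λ n c L) {G : Set ((Fin d → ℝ) × (Fin d → ℝ))}
    (hΛ : ∀ t, 0 < t → (Λ t : Set _) = latticePts d G t) {q ρ γ : ℝ} (hq : 2 < q) (hρ : 1 < ρ)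
    (hγ : 0 < γ) (hγ1 : γ < 1) (hγρ : (2 : ℝ)⁻¹ ^ (1 - ρ⁻¹) = γ ^ 2) :
    ∃ C : ℝ≥0∞, C ≠ ∞ ∧ ∀ f g : (Fin d → ℤ) → ℝ, (∀ x, 0 < f x) → (∀ x, 0 < g x) → ∀ x,
      vqVar q (fun t => discAvg d G f g t x) ≤ (C * (varFn ρ γ q f x * maxRho ρ g x ^ q +
        maxRho ρ f x ^ q * varFn ρ γ q g x)) ^ (1 / q) := by
  have hq0 : 0 < q := by linarith
  have hρ0 : 0 < ρ := by linarith
  have hq2 : 1 ≤ q / 2 := by linarith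
  have hq20 : 0 ≤ q / 2 := by linarith
  have hL : 0 < L := lt_of_lt_of_le (by positivity) h.le_L
  obtain ⟨C, hC, hsq⟩ := exists_tsum_scaleSq_le (d := d) h.c_pos hL hρ0 hγ hγ1
  set D : ℝ≥0∞ := (5 * C) ^ (q / 2) * 2 ^ (q / 2) + 2 ^ q with hD
  have hD' : D ≠ ∞ := ENNReal.add_ne_top.2 ⟨ENNReal.mul_ne_top
    (ENNReal.rpow_ne_top_of_nonneg hq20 (ENNReal.mul_ne_top (by simp) hC))
    (ENNReal.rpow_ne_top_of_nonneg hq20 (by simp)), ENNReal.rpow_ne_top_of_nonneg hq0.le (by simp)⟩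
  refine ⟨2 ^ q * D, ENNReal.mul_ne_top (ENNReal.rpow_ne_top_of_nonneg hq0.le (by simp)) hD',
    fun f g hf hg x => vqVar_le_of_sum_range_le hq0 fun u hu hu0 K => ?_⟩
  set P := maxRho ρ f x with hP
  set Q := maxRho ρ g x with hQ
  set S := sqFnA ρ (ENNReal.ofReal γ) f x + sqFnB f x with hS
  set T := sqFnA ρ (ENNReal.ofReal γ) g x + sqFnB g x with hT
  set b : ℝ → ℝ := fun t => ((Λ t).card : ℝ)⁻¹ * ∑ z ∈ Λ t, f (x - z.1) * g (x - z.2)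
      - cExp (n t) f x * cExp (n t) g x with hb
  have hpos : ∀ k, 0 < u k := fun k => hu0.trans_le (hu.monotone (Nat.zero_le k))
  have hdecomp : ∀ k, discAvg d G f g (u k) x = b (u k) + cExp (n (u k)) f x * cExp (n (u k)) g x := by
    intro k
    rw [discAvg_eq (hΛ _ (hpos k))]
    simp only [hb]
    ring
  have hbsq : ∑ k ∈ Finset.range K, ENNReal.ofReal |b (u (k + 1)) - b (u k)| ^ q
      ≤ (5 * C) ^ (q / 2) * 2 ^ (q / 2) * (S ^ (q / 2) * Q ^ q + P ^ q * T ^ (q / 2)) := by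
    have h1 := sum_sq_sub_le_scaleSq h hρ hγ hγ1 hγρ f g x (b := b) (fun t _ => rfl) hu.monotone hu0 K
    have h2 : ∑ k ∈ Finset.range K, ENNReal.ofReal |b (u (k + 1)) - b (u k)| ^ (2 : ℝ)
        ≤ 5 * C * (S * Q ^ (2 : ℝ) + P ^ (2 : ℝ) * T) := by
      calc _ = ENNReal.ofReal (∑ k ∈ Finset.range K, (b (u (k + 1)) - b (u k)) ^ 2) := by
            rw [ENNReal.ofReal_sum_of_nonneg fun _ _ => sq_nonneg _]
            refine Finset.sum_congr rfl fun k _ => ?_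
            rw [ENNReal.ofReal_rpow_of_nonneg (abs_nonneg _) (by norm_num), Real.rpow_two, sq_abs]
        _ ≤ ENNReal.ofReal (5 * ∑ m ∈ Finset.range (n (u K) + 1), scaleSq c L ρ γ f g x m) :=
            ENNReal.ofReal_le_ofReal h1
        _ ≤ 5 * ∑ m ∈ Finset.range (n (u K) + 1), ENNReal.ofReal (scaleSq c L ρ γ f g x m) := by
            rw [ENNReal.ofReal_mul (by norm_num), ENNReal.ofReal_ofNat]
            rw [ENNReal.ofReal_sum_of_nonneg fun m _ => scaleSq_nonneg c L ρ hγ hγ1 f g x m]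
        _ ≤ 5 * ∑' m, ENNReal.ofReal (scaleSq c L ρ γ f g x m) := by
            gcongr
            exact ENNReal.sum_le_tsum _
        _ ≤ _ := by
            rw [mul_assoc]
            gcongr
            exact hsq f g hf hg x
    calc _ = ∑ k ∈ Finset.range K,
          (ENNReal.ofReal |b (u (k + 1)) - b (u k)| ^ (2 : ℝ)) ^ (q / 2) := by
          refine Finset.sum_congr rfl fun k _ => ?_
          rw [← ENNReal.rpow_mul, mul_div_cancel₀ _ (by norm_num)]
      _ ≤ (5 * C * (S * Q ^ (2 : ℝ) + P ^ (2 : ℝ) * T)) ^ (q / 2) :=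
          (sum_rpow_le_rpow_sum _ _ hq2).trans (by gcongr)
      _ ≤ _ := by
          rw [ENNReal.mul_rpow_of_nonneg _ _ hq20, mul_assoc]
          gcongr _ * ?_
          refine (ennreal_add_rpow_le _ _ hq20).trans_eq ?_
          rw [ENNReal.mul_rpow_of_nonneg _ _ hq20, ENNReal.mul_rpow_of_nonneg _ _ hq20,
            ← ENNReal.rpow_mul, ← ENNReal.rpow_mul, mul_div_cancel₀ _ (by norm_num)]
  have hcq := sum_cExp_mul_cExp_le hq hρ0 hf hg x (n := fun k => n (u k))
    (fun i j hij => h.scale_mono _ _ (hu.monotone hij)) K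
  calc _ ≤ ∑ k ∈ Finset.range K, 2 ^ q * (ENNReal.ofReal |b (u (k + 1)) - b (u k)| ^ q +
        ENNReal.ofReal |cExp (n (u (k + 1))) f x * cExp (n (u (k + 1))) g x -
        cExp (n (u k)) f x * cExp (n (u k)) g x| ^ q) := by
        refine Finset.sum_le_sum fun k _ => ?_
        refine le_trans ?_ (ennreal_add_rpow_le _ _ hq0.le)
        gcongr
        rw [← ENNReal.ofReal_add (abs_nonneg _) (abs_nonneg _)]
        apply ENNReal.ofReal_le_ofReal
        rw [hdecomp, hdecomp, add_sub_add_comm]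
        exact abs_add_le _ _
    _ ≤ 2 ^ q * ((5 * C) ^ (q / 2) * 2 ^ (q / 2) * (S ^ (q / 2) * Q ^ q + P ^ q * T ^ (q / 2)) +
        2 ^ q * (martVarPow q f x * Q ^ q + P ^ q * martVarPow q g x)) := by
        rw [← Finset.mul_sum, Finset.sum_add_distrib]
        gcongr
    _ ≤ 2 ^ q * (D * (S ^ (q / 2) * Q ^ q + P ^ q * T ^ (q / 2)) +
        D * (martVarPow q f x * Q ^ q + P ^ q * martVarPow q g x)) := by
        gcongr _ * (?_ * _ + ?_ * _)
        · exact le_self_add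
        · exact le_add_self
    _ = _ := by
        simp only [varFn]
        ring

lemma exists_tsum_varFn_le (hd : 1 ≤ d) {κ ρ γ q p : ℝ} (h1 : 1 < κ) (h2 : κ < 2) (hp : κ < p)
    (hρ : ρ * (3 - κ) = 2) (hγ1 : γ < 1) (hq : 2 < q) :
    ∃ C : ℝ≥0∞, C ≠ ∞ ∧ ∀ f : (Fin d → ℤ) → ℝ, (∀ x, 0 < f x) →
      ∑' x, ENNReal.ofReal (f x) ^ p ≠ ∞ →
      ∑' x, varFn ρ γ q f x ^ (p / q) ≤ C * ∑' x, ENNReal.ofReal (f x) ^ p := by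
  have hp0 : 0 < p := by linarith
  have hq0 : 0 < q := by linarith
  have hpq : 0 ≤ p / q := by positivity
  have hp2 : 0 ≤ p / 2 := by positivity
  obtain ⟨C₁, hC₁, hA⟩ := exists_tsum_sqFnA_le d h1 h2 hp hρ (b := ENNReal.ofReal γ)
    (ENNReal.ofReal_lt_one.2 hγ1)
  obtain ⟨C₂, hC₂, hB⟩ := exists_tsum_sqFnB_le hd h1 h2 hp
  obtain ⟨C₃, hC₃, hV⟩ := exists_tsum_martVarPow_le d hq (h1.trans hp)
  refine ⟨2 ^ (p / q) * (2 ^ (p / 2) * (C₁ + C₂) + C₃), ?_, fun f hf hfp => ?_⟩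
  · have e1 : (2 : ℝ≥0∞) ^ (p / q) ≠ ∞ := ENNReal.rpow_ne_top_of_nonneg hpq (by simp)
    have e2 : (2 : ℝ≥0∞) ^ (p / 2) ≠ ∞ := ENNReal.rpow_ne_top_of_nonneg hp2 (by simp)
    finiteness
  · set N := ∑' x, ENNReal.ofReal (f x) ^ p with hN
    calc _ ≤ ∑' x, 2 ^ (p / q) * (2 ^ (p / 2) * (sqFnA ρ (ENNReal.ofReal γ) f x ^ (p / 2) +
          sqFnB f x ^ (p / 2)) + martVarPow q f x ^ (p / q)) := by
          refine ENNReal.tsum_le_tsum fun x => (ennreal_add_rpow_le _ _ hpq).trans ?_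
          gcongr _ * (?_ + _)
          rw [← ENNReal.rpow_mul, show q / 2 * (p / q) = p / 2 by field_simp]
          exact ennreal_add_rpow_le _ _ hp2
      _ = 2 ^ (p / q) * (2 ^ (p / 2) * ((∑' x, sqFnA ρ (ENNReal.ofReal γ) f x ^ (p / 2)) +
          ∑' x, sqFnB f x ^ (p / 2)) + ∑' x, martVarPow q f x ^ (p / q)) := by
          rw [ENNReal.tsum_mul_left, ENNReal.tsum_add, ENNReal.tsum_mul_left, ENNReal.tsum_add]
      _ ≤ 2 ^ (p / q) * (2 ^ (p / 2) * (C₁ * N + C₂ * N) + C₃ * N) := by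
          gcongr
          · exact hA f hf
          · exact hB f ⟨hf, hfp⟩
          · exact hV f hf
      _ = _ := by ring

lemma exists_tsum_maxRho_le (d : ℕ) {ρ p : ℝ} (hρ : 1 < ρ) (hp : ρ < p) :
    ∃ C : ℝ≥0∞, C ≠ ∞ ∧ ∀ f : (Fin d → ℤ) → ℝ,
      ∑' x, maxRho ρ f x ^ p ≤ C * ∑' x, ENNReal.ofReal (f x) ^ p := by
  have hρ0 : 0 < ρ := by linarith
  obtain ⟨C₁, hC₁, h1⟩ := exists_tsum_maxFn_rpow_le d ((one_lt_div hρ0).2 hp)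
  obtain ⟨C₂, hC₂, h2⟩ := exists_tsum_maxFn_rpow_le d (hρ.trans hp)
  refine ⟨C₁ * C₂, ENNReal.mul_ne_top hC₁ hC₂, fun f => ?_⟩
  calc _ = ∑' x, maxFn (fun y => maxFn (fun w => ENNReal.ofReal (f w)) y ^ ρ) x ^ (p / ρ) := by
        refine tsum_congr fun x => ?_
        rw [maxRho, ← ENNReal.rpow_mul, one_div_mul_eq_div]
    _ ≤ C₁ * ∑' x, (maxFn (fun w => ENNReal.ofReal (f w)) x ^ ρ) ^ (p / ρ) := h1 _
    _ = C₁ * ∑' x, maxFn (fun w => ENNReal.ofReal (f w)) x ^ p := by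
        congr 1
        refine tsum_congr fun x => ?_
        rw [← ENNReal.rpow_mul, mul_div_cancel₀ _ hρ0.ne']
    _ ≤ _ := by
        rw [mul_assoc]
        gcongr
        exact h2 _

lemma tsum_mul_rpow_le {α : Type*} {p p1 p2 a b : ℝ} (hp : 0 < p) (hp1 : 0 < p1) (hp2 : 0 < p2)
    (h : 1 / p = 1 / p1 + 1 / p2) (ha : a * p1 = b * p) (u v : α → ℝ≥0∞) :
    ∑' x, u x ^ a * v x ^ p ≤ (∑' x, u x ^ b) ^ (p / p1) * (∑' x, v x ^ p2) ^ (p / p2) := by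
  have hc : (p1 / p).HolderConjugate (p2 / p) := by
    rw [Real.holderConjugate_iff]
    constructor
    · rw [one_lt_div hp]
      have h3 : 0 < 1 / p2 := by positivity
      exact lt_of_one_div_lt_one_div hp1 (by linarith)
    · rw [inv_div, inv_div]
      have : p * (1 / p) = p * (1 / p1 + 1 / p2) := by rw [h]
      rw [mul_one_div_cancel hp.ne'] at this
      rw [this]; ring
  refine (tsum_mul_le_Lp_mul_Lq hc _ _).trans_eq ?_
  simp only [← ENNReal.rpow_mul, one_div_div]
  rw [mul_div_cancel₀ _ hp.ne', show a * (p1 / p) = b by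
    rw [← mul_div_assoc, ha, mul_div_cancel_right₀ _ hp.ne']]

/-- The variational inequality for positive functions. -/
theorem exists_tsum_vqVar_discAvg_le (hd : 1 ≤ d) {G : Set ((Fin d → ℝ) × (Fin d → ℝ))}
    (hG : IsConvexBody G) (h0 : (0 : (Fin d → ℝ) × (Fin d → ℝ)) ∈ G) {q p p1 p2 : ℝ} (hq : 2 < q)
    (hp1 : 1 < p1) (hp2 : 1 < p2) (hp0 : 0 < p) (hp : 1 / p = 1 / p1 + 1 / p2) :
    ∃ C : ℝ≥0∞, C ≠ ∞ ∧ ∀ f g : (Fin d → ℤ) → ℝ, (∀ x, 0 < f x) → (∀ x, 0 < g x) →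
      ∑' x, ENNReal.ofReal (f x) ^ p1 ≠ ∞ → ∑' x, ENNReal.ofReal (g x) ^ p2 ≠ ∞ →
      ∑' x, vqVar q (fun t => discAvg d G f g t x) ^ p
        ≤ C * ((∑' x, ENNReal.ofReal (f x) ^ p1) ^ (p / p1) *
          (∑' x, ENNReal.ofReal (g x) ^ p2) ^ (p / p2)) := by
  have hq0 : 0 < q := by linarith
  have hp10 : 0 < p1 := by linarith
  have hp20 : 0 < p2 := by linarith
  obtain ⟨κ, h1, h⟩ := exists_between (lt_min one_lt_two (lt_min hp1 hp2))
  obtain ⟨h2, h3, h4⟩ : κ < 2 ∧ κ < p1 ∧ κ < p2 := by simpa using h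
  have hκ3 : 0 < 3 - κ := by linarith
  set ρ := 2 / (3 - κ) with hρ
  have hρκ : ρ * (3 - κ) = 2 := div_mul_cancel₀ _ hκ3.ne'
  have hρ1 : 1 < ρ := by rw [hρ, one_lt_div hκ3]; linarith
  have hρk : ρ < κ := by rw [hρ, div_lt_iff₀ hκ3]; nlinarith
  have he : 0 < 1 - ρ⁻¹ := by
    have := inv_lt_one_of_one_lt₀ hρ1
    linarith
  set γ := √((2 : ℝ)⁻¹ ^ (1 - ρ⁻¹)) with hγ
  have hγ0 : 0 < γ := Real.sqrt_pos.2 (by positivity)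
  have hγ2 : (2 : ℝ)⁻¹ ^ (1 - ρ⁻¹) = γ ^ 2 := (Real.sq_sqrt (by positivity)).symm
  have hγ1 : γ < 1 := by
    rw [hγ, Real.sqrt_lt' one_pos, one_pow]
    exact Real.rpow_lt_one (by norm_num) (by norm_num) he
  obtain ⟨Λ, n, c, L, hadm, hΛ⟩ := exists_isAdmissible hd hG h0
  obtain ⟨C, hC, hpt⟩ := exists_vqVar_discAvg_le hadm hΛ hq hρ1 hγ0 hγ1 hγ2
  obtain ⟨A₁, hA₁, hZ₁⟩ := exists_tsum_varFn_le hd h1 h2 h3 hρκ hγ1 hq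
  obtain ⟨A₂, hA₂, hZ₂⟩ := exists_tsum_varFn_le hd h1 h2 h4 hρκ hγ1 hq
  obtain ⟨B₁, hB₁, hH₁⟩ := exists_tsum_maxRho_le d hρ1 (hρk.trans h3)
  obtain ⟨B₂, hB₂, hH₂⟩ := exists_tsum_maxRho_le d hρ1 (hρk.trans h4)
  have hpq : 0 ≤ p / q := by positivity
  have hr1 : 0 ≤ p / p1 := by positivity
  have hr2 : 0 ≤ p / p2 := by positivity
  refine ⟨C ^ (p / q) * 2 ^ (p / q) * (A₁ ^ (p / p1) * B₂ ^ (p / p2) + B₁ ^ (p / p1) * A₂ ^ (p / p2)),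
    ?_, fun f g hf hg hfp hgp => ?_⟩
  · have e : ∀ (a : ℝ≥0∞) (t : ℝ), a ≠ ∞ → 0 ≤ t → a ^ t ≠ ∞ := fun a t ha ht =>
      ENNReal.rpow_ne_top_of_nonneg ht ha
    exact ENNReal.mul_ne_top (ENNReal.mul_ne_top (e _ _ hC hpq) (e _ _ (by simp) hpq))
      (ENNReal.add_ne_top.2 ⟨ENNReal.mul_ne_top (e _ _ hA₁ hr1) (e _ _ hB₂ hr2),
        ENNReal.mul_ne_top (e _ _ hB₁ hr1) (e _ _ hA₂ hr2)⟩)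
  · set M := ∑' x, ENNReal.ofReal (f x) ^ p1 with hM
    set N := ∑' x, ENNReal.ofReal (g x) ^ p2 with hN
    calc _ ≤ ∑' x, C ^ (p / q) * (2 ^ (p / q) * (varFn ρ γ q f x ^ (p / q) * maxRho ρ g x ^ p +
          varFn ρ γ q g x ^ (p / q) * maxRho ρ f x ^ p)) := by
          refine ENNReal.tsum_le_tsum fun x => (ENNReal.rpow_le_rpow (hpt f g hf hg x) hp0.le).trans ?_
          rw [← ENNReal.rpow_mul, one_div_mul_eq_div, ENNReal.mul_rpow_of_nonneg _ _ hpq]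
          gcongr _ * ?_
          refine (ennreal_add_rpow_le _ _ hpq).trans_eq ?_
          rw [ENNReal.mul_rpow_of_nonneg _ _ hpq, ENNReal.mul_rpow_of_nonneg _ _ hpq,
            ← ENNReal.rpow_mul, ← ENNReal.rpow_mul, mul_div_cancel₀ _ hq0.ne',
            mul_comm (maxRho ρ f x ^ p)]
      _ = C ^ (p / q) * (2 ^ (p / q) * (∑' x, varFn ρ γ q f x ^ (p / q) * maxRho ρ g x ^ p +
          ∑' x, varFn ρ γ q g x ^ (p / q) * maxRho ρ f x ^ p)) := by
          rw [ENNReal.tsum_mul_left, ENNReal.tsum_mul_left, ENNReal.tsum_add]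
      _ ≤ C ^ (p / q) * (2 ^ (p / q) * ((A₁ * M) ^ (p / p1) * (B₂ * N) ^ (p / p2) +
          (A₂ * N) ^ (p / p2) * (B₁ * M) ^ (p / p1))) := by
          gcongr _ * (_ * (?_ + ?_))
          · refine (tsum_mul_rpow_le hp0 hp10 hp20 hp (b := p1 / q) (by ring) _ _).trans ?_
            gcongr
            · exact hZ₁ f hf hfp
            · exact hH₂ g
          · refine (tsum_mul_rpow_le hp0 hp20 hp10 (by rw [hp, add_comm]) (b := p2 / q)
              (by ring) _ _).trans ?_
            gcongr
            · exact hZ₂ g hg hgp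
            · exact hH₁ f
      _ = _ := by
          rw [ENNReal.mul_rpow_of_nonneg _ _ hr1, ENNReal.mul_rpow_of_nonneg _ _ hr2,
            ENNReal.mul_rpow_of_nonneg _ _ hr2, ENNReal.mul_rpow_of_nonneg _ _ hr1]
          ring

/-- Minkowski's inequality for the variation seminorm. -/
lemma vqVar_le_add {q : ℝ} (hq : 1 ≤ q) {a b c : ℝ → ℝ}
    (h : ∀ s t, 0 < s → 0 < t → |a t - a s| ≤ |b t - b s| + |c t - c s|) :
    vqVar q a ≤ vqVar q b + vqVar q c := by
  have hq0 : 0 < q := by linarith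
  have hone : 0 ≤ 1 / q := by positivity
  have key : ∀ (e : ℝ → ℝ) (u : ℕ → ℝ), StrictMono u → 0 < u 0 → ∀ K,
      (∑ k ∈ Finset.range K, ENNReal.ofReal |e (u (k + 1)) - e (u k)| ^ q) ^ (1 / q)
        ≤ vqVar q e := by
    intro e u hu hu0 K
    refine le_trans ?_ (le_iSup₂_of_le u hu (le_iSup_of_le hu0 le_rfl))
    exact ENNReal.rpow_le_rpow (ENNReal.sum_le_tsum _) hone
  have hD : vqVar q a ≤ ((vqVar q b + vqVar q c) ^ q) ^ (1 / q) := by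
    refine vqVar_le_of_sum_range_le hq0 fun u hu hu0 K => ?_
    have hpos : ∀ k, 0 < u k := fun k => hu0.trans_le (hu.monotone (Nat.zero_le k))
    have h1 : (∑ k ∈ Finset.range K, ENNReal.ofReal |a (u (k + 1)) - a (u k)| ^ q) ^ (1 / q)
        ≤ vqVar q b + vqVar q c := by
      refine le_trans ?_ (add_le_add (key b u hu hu0 K) (key c u hu hu0 K))
      refine le_trans ?_ (ENNReal.Lp_add_le _ _ _ hq)
      refine ENNReal.rpow_le_rpow (Finset.sum_le_sum fun k _ => ?_) hone
      refine ENNReal.rpow_le_rpow ?_ hq0.le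
      rw [← ENNReal.ofReal_add (abs_nonneg _) (abs_nonneg _)]
      exact ENNReal.ofReal_le_ofReal (h _ _ (hpos _) (hpos _))
    have h2 := ENNReal.rpow_le_rpow h1 hq0.le
    rwa [← ENNReal.rpow_mul, one_div_mul_cancel hq0.ne', ENNReal.rpow_one] at h2
  rwa [← ENNReal.rpow_mul, mul_one_div_cancel hq0.ne', ENNReal.rpow_one] at hD

lemma vqVar_discAvg_le (hd : 1 ≤ d) {G : Set ((Fin d → ℝ) × (Fin d → ℝ))} (hG : IsConvexBody G)
    (h0 : (0 : (Fin d → ℝ) × (Fin d → ℝ)) ∈ G) {q : ℝ} (hq : 1 ≤ q)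
    (f f' g g' : (Fin d → ℤ) → ℝ) (x : Fin d → ℤ) :
    vqVar q (fun t => discAvg d G (fun y => f y - f' y) (fun y => g y - g' y) t x)
      ≤ (vqVar q (fun t => discAvg d G f g t x) + vqVar q (fun t => discAvg d G f' g t x)) +
        (vqVar q (fun t => discAvg d G f g' t x) + vqVar q (fun t => discAvg d G f' g' t x)) := by
  obtain ⟨Λ, n, c, L, -, hΛ⟩ := exists_isAdmissible hd hG h0
  have hl : ∀ (k : (Fin d → ℤ) → ℝ) (t : ℝ), 0 < t →
      discAvg d G (fun y => f y - f' y) k t x = discAvg d G f k t x - discAvg d G f' k t x := by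
    intro k t ht
    simp only [discAvg_eq (hΛ t ht), sub_mul, Finset.sum_sub_distrib, mul_sub]
  have hr : ∀ (k : (Fin d → ℤ) → ℝ) (t : ℝ), 0 < t →
      discAvg d G k (fun y => g y - g' y) t x = discAvg d G k g t x - discAvg d G k g' t x := by
    intro k t ht
    simp only [discAvg_eq (hΛ t ht), mul_sub, Finset.sum_sub_distrib]
  refine (vqVar_le_add hq (b := fun t => discAvg d G (fun y => f y - f' y) g t x)
    (c := fun t => discAvg d G (fun y => f y - f' y) g' t x) fun s t hs ht => ?_).trans
    (add_le_add (vqVar_le_add hq fun s t hs ht => ?_) (vqVar_le_add hq fun s t hs ht => ?_))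
  · rw [hr _ _ ht, hr _ _ hs, sub_sub_sub_comm]
    exact abs_sub _ _
  · rw [hl _ _ ht, hl _ _ hs, sub_sub_sub_comm]
    exact abs_sub _ _
  · rw [hl _ _ ht, hl _ _ hs, sub_sub_sub_comm]
    exact abs_sub _ _

/-- A function with positive `ℓ^p` norm is a difference of two strictly positive functions of
comparable norm. -/
lemma exists_pos_sub_eq {p : ℝ} (hp : 0 < p) (f : (Fin d → ℤ) → ℝ)
    (h0 : ∑' x, ENNReal.ofReal |f x| ^ p ≠ 0) :
    ∃ g g' : (Fin d → ℤ) → ℝ, (∀ x, 0 < g x) ∧ (∀ x, 0 < g' x) ∧ f = (fun x => g x - g' x) ∧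
      ∑' x, ENNReal.ofReal (g x) ^ p ≤ 2 ^ p * 2 * ∑' x, ENNReal.ofReal |f x| ^ p ∧
      ∑' x, ENNReal.ofReal (g' x) ^ p ≤ 2 ^ p * 2 * ∑' x, ENNReal.ofReal |f x| ^ p := by
  obtain ⟨ε, hε, hsum⟩ := ENNReal.exists_pos_sum_of_countable h0 (Fin d → ℤ)
  set h : (Fin d → ℤ) → ℝ := fun x => (ε x : ℝ) ^ (1 / p) with hh
  have hpos : ∀ x, 0 < h x := fun x => Real.rpow_pos_of_pos (NNReal.coe_pos.2 (hε x)) _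
  have hhp : ∀ x, ENNReal.ofReal (h x) ^ p = ε x := by
    intro x
    rw [ENNReal.ofReal_rpow_of_nonneg (hpos x).le hp.le, hh, ← Real.rpow_mul (NNReal.coe_nonneg _),
      one_div_mul_cancel hp.ne', Real.rpow_one, ENNReal.ofReal_coe_nnreal]
  have key : ∀ k : (Fin d → ℤ) → ℝ, (∀ x, k x ≤ |f x| + h x) →
      ∑' x, ENNReal.ofReal (k x) ^ p ≤ 2 ^ p * 2 * ∑' x, ENNReal.ofReal |f x| ^ p := by
    intro k hk
    calc ∑' x, ENNReal.ofReal (k x) ^ p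
        ≤ ∑' x, 2 ^ p * (ENNReal.ofReal |f x| ^ p + ε x) := by
          refine ENNReal.tsum_le_tsum fun x => ?_
          rw [← hhp x]
          refine le_trans (ENNReal.rpow_le_rpow ?_ hp.le) (ennreal_add_rpow_le _ _ hp.le)
          rw [← ENNReal.ofReal_add (abs_nonneg _) (hpos x).le]
          exact ENNReal.ofReal_le_ofReal (hk x)
      _ ≤ _ := by
          rw [ENNReal.tsum_mul_left, ENNReal.tsum_add, mul_assoc, two_mul]
          gcongr
  refine ⟨fun x => max (f x) 0 + h x, fun x => max (-f x) 0 + h x,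
    fun x => add_pos_of_nonneg_of_pos (le_max_right _ _) (hpos x),
    fun x => add_pos_of_nonneg_of_pos (le_max_right _ _) (hpos x), ?_,
    key _ fun x => ?_, key _ fun x => ?_⟩
  · ext x
    beta_reduce
    rcases le_total (f x) 0 with hx | hx
    · rw [max_eq_right hx, max_eq_left (by linarith)]
      ring
    · rw [max_eq_left hx, max_eq_right (by linarith)]
      ring
  · gcongr
    exact max_le (le_abs_self _) (abs_nonneg _)
  · gcongr
    exact max_le (neg_le_abs _) (abs_nonneg _)

lemma vqVar_eq_zero {q : ℝ} (hq : 0 < q) {a : ℝ → ℝ} (h : ∀ t, 0 < t → a t = 0) :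
    vqVar q a = 0 := by
  have h1 : vqVar q a ≤ 0 ^ (1 / q) := by
    refine vqVar_le_of_sum_range_le hq fun u hu hu0 K => ?_
    have hpos : ∀ k, 0 < u k := fun k => hu0.trans_le (hu.monotone (Nat.zero_le k))
    simp [h _ (hpos _), hq]
  rwa [ENNReal.zero_rpow_of_pos (by positivity), nonpos_iff_eq_zero] at h1

lemma eq_zero_of_tsum_rpow_eq_zero {p : ℝ} (hp : 0 < p) {f : (Fin d → ℤ) → ℝ}
    (h0 : ∑' x, ENNReal.ofReal |f x| ^ p = 0) (x : Fin d → ℤ) : f x = 0 := by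
  have := ENNReal.tsum_eq_zero.1 h0 x
  rwa [ENNReal.rpow_eq_zero_iff_of_pos hp, ENNReal.ofReal_eq_zero, abs_nonpos_iff] at this

lemma exists_tsum_vqVar_discAvg_signed_le (hd : 1 ≤ d) {G : Set ((Fin d → ℝ) × (Fin d → ℝ))}
    (hG : IsConvexBody G) (h0 : (0 : (Fin d → ℝ) × (Fin d → ℝ)) ∈ G) {q p p₁ p₂ : ℝ} (hq : 2 < q)
    (hp1 : 1 < p₁) (hp2 : 1 < p₂) (hp0 : 0 < p) (hp : 1 / p = 1 / p₁ + 1 / p₂) :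
    ∃ C : ℝ≥0∞, C ≠ ∞ ∧ ∀ f g : (Fin d → ℤ) → ℝ,
      ∑' x, ENNReal.ofReal |f x| ^ p₁ ≠ ∞ → ∑' x, ENNReal.ofReal |g x| ^ p₂ ≠ ∞ →
      ∑' x, vqVar q (fun t => discAvg d G f g t x) ^ p
        ≤ C * ((∑' x, ENNReal.ofReal |f x| ^ p₁) ^ (p / p₁) *
          (∑' x, ENNReal.ofReal |g x| ^ p₂) ^ (p / p₂)) := by
  obtain ⟨C, hC, H⟩ := exists_tsum_vqVar_discAvg_le hd hG h0 hq hp1 hp2 hp0 hp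
  have hp10 : 0 < p₁ := by linarith
  have hp20 : 0 < p₂ := by linarith
  have he1 : 0 ≤ p / p₁ := by positivity
  have he2 : 0 ≤ p / p₂ := by positivity
  have h2 : ∀ r : ℝ, 0 < r → (2 : ℝ≥0∞) ^ r ≠ ∞ := fun r hr =>
    ENNReal.rpow_ne_top_of_nonneg hr.le (by norm_num)
  have h22 : ∀ r : ℝ, 0 < r → (2 : ℝ≥0∞) ^ r * 2 ≠ ∞ := fun r hr =>
    ENNReal.mul_ne_top (h2 r hr) (by norm_num)
  set A : ℝ≥0∞ := (2 ^ p₁ * 2) ^ (p / p₁) with hA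
  set B : ℝ≥0∞ := (2 ^ p₂ * 2) ^ (p / p₂) with hB
  have hAt : A ≠ ∞ := ENNReal.rpow_ne_top_of_nonneg he1 (h22 _ hp10)
  have hBt : B ≠ ∞ := ENNReal.rpow_ne_top_of_nonneg he2 (h22 _ hp20)
  refine ⟨2 ^ p * (2 ^ p * 4) * (C * (A * B)), ENNReal.mul_ne_top (ENNReal.mul_ne_top (h2 _ hp0)
    (ENNReal.mul_ne_top (h2 _ hp0) (by norm_num)))
    (ENNReal.mul_ne_top hC (ENNReal.mul_ne_top hAt hBt)), fun f g hf hg => ?_⟩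
  have hzero : (∀ x, f x = 0) ∨ (∀ x, g x = 0) →
      ∑' x, vqVar q (fun t => discAvg d G f g t x) ^ p = 0 := by
    intro h
    have hd0 : ∀ t x, discAvg d G f g t x = 0 := by
      intro t x
      rcases h with h | h <;> simp [discAvg, h]
    simp [hd0, vqVar_eq_zero (show 0 < q by linarith), hp0]
  by_cases hf0 : ∑' x, ENNReal.ofReal |f x| ^ p₁ = 0
  · rw [hzero (Or.inl (eq_zero_of_tsum_rpow_eq_zero hp10 hf0))]
    exact bot_le
  by_cases hg0 : ∑' x, ENNReal.ofReal |g x| ^ p₂ = 0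
  · rw [hzero (Or.inr (eq_zero_of_tsum_rpow_eq_zero hp20 hg0))]
    exact bot_le
  obtain ⟨f₁, f₂, hf1, hf2, hfe, hn1, hn2⟩ := exists_pos_sub_eq hp10 f hf0
  obtain ⟨g₁, g₂, hg1, hg2, hge, hm1, hm2⟩ := exists_pos_sub_eq hp20 g hg0
  set M := ∑' x, ENNReal.ofReal |f x| ^ p₁ with hM
  set N := ∑' x, ENNReal.ofReal |g x| ^ p₂ with hN
  have hb : ∀ u v : (Fin d → ℤ) → ℝ, (∀ x, 0 < u x) → (∀ x, 0 < v x) →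
      ∑' x, ENNReal.ofReal (u x) ^ p₁ ≤ 2 ^ p₁ * 2 * M →
      ∑' x, ENNReal.ofReal (v x) ^ p₂ ≤ 2 ^ p₂ * 2 * N →
      ∑' x, vqVar q (fun t => discAvg d G u v t x) ^ p
        ≤ C * (A * B) * (M ^ (p / p₁) * N ^ (p / p₂)) := by
    intro u v hu hv hun hvn
    refine (H u v hu hv (ne_top_of_le_ne_top (ENNReal.mul_ne_top (h22 _ hp10) hf) hun)
      (ne_top_of_le_ne_top (ENNReal.mul_ne_top (h22 _ hp20) hg) hvn)).trans ?_
    calc _ ≤ C * ((2 ^ p₁ * 2 * M) ^ (p / p₁) * (2 ^ p₂ * 2 * N) ^ (p / p₂)) := by gcongr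
      _ = _ := by
        rw [ENNReal.mul_rpow_of_nonneg _ M he1, ENNReal.mul_rpow_of_nonneg _ N he2]
        ring
  have hpt : ∀ x, vqVar q (fun t => discAvg d G f g t x) ^ p ≤ 2 ^ p * (2 ^ p *
      ((vqVar q (fun t => discAvg d G f₁ g₁ t x) ^ p +
        vqVar q (fun t => discAvg d G f₂ g₁ t x) ^ p) +
      (vqVar q (fun t => discAvg d G f₁ g₂ t x) ^ p +
        vqVar q (fun t => discAvg d G f₂ g₂ t x) ^ p))) := by
    intro x
    rw [hfe, hge]
    refine (ENNReal.rpow_le_rpow (vqVar_discAvg_le hd hG h0 (by linarith) f₁ f₂ g₁ g₂ x)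
      hp0.le).trans ((ennreal_add_rpow_le _ _ hp0.le).trans ?_)
    gcongr _ * ?_
    rw [mul_add (2 ^ p)]
    exact add_le_add (ennreal_add_rpow_le _ _ hp0.le) (ennreal_add_rpow_le _ _ hp0.le)
  refine (ENNReal.tsum_le_tsum hpt).trans ?_
  rw [ENNReal.tsum_mul_left, ENNReal.tsum_mul_left, ENNReal.tsum_add, ENNReal.tsum_add,
    ENNReal.tsum_add]
  refine (mul_le_mul_right (mul_le_mul_right (add_le_add
    (add_le_add (hb _ _ hf1 hg1 hn1 hm1) (hb _ _ hf2 hg1 hn2 hm1))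
    (add_le_add (hb _ _ hf1 hg2 hn1 hm2) (hb _ _ hf2 hg2 hn2 hm2))) _) _).trans_eq ?_
  ring

lemma tsum_ofReal_abs_rpow {p : ℝ} (hp : 0 < p) {f : (Fin d → ℤ) → ℝ}
    (hf : Summable fun x => |f x| ^ p) :
    ∑' x, ENNReal.ofReal |f x| ^ p = ENNReal.ofReal (∑' x, |f x| ^ p) := by
  rw [ENNReal.ofReal_tsum_of_nonneg (fun x => by positivity) hf]
  exact tsum_congr fun x => ENNReal.ofReal_rpow_of_nonneg (abs_nonneg _) hp.le

end LatticeVariation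

/-- `ℓ^{p1} × ℓ^{p2} → ℓ^p` variational inequality for discrete
bilinear averages over a convex body, `2 < q < ∞`, `1 < p1, p2 < ∞`,
`1/2 < p`, `1/p = 1/p1 + 1/p2`. -/
theorem statement17 (d : ℕ) (hd : 1 ≤ d)
    (G : Set ((Fin d → ℝ) × (Fin d → ℝ))) (hG : IsConvexBody G) (hG0 : (0:(Fin d → ℝ) × (Fin d → ℝ)) ∈ G)
    (q : ℝ) (hq : 2 < q) (p p1 p2 : ℝ)
    (hp1 : 1 < p1) (hp2 : 1 < p2) (hpl : 1/2 < p) (hp : 1/p = 1/p1 + 1/p2) :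
    ∃ C : ℝ, 0 < C ∧ ∀ f1 f2 : (Fin d → ℤ) → ℝ,
      Summable (fun j => |f1 j| ^ p1) → Summable (fun j => |f2 j| ^ p2) →
      (∑' j : Fin d → ℤ, vqVar q (fun t => discAvg d G f1 f2 t j) ^ p) ^ (1/p)
        ≤ ENNReal.ofReal (C * (∑' j : Fin d → ℤ, |f1 j| ^ p1) ^ (1/p1) *
            (∑' j : Fin d → ℤ, |f2 j| ^ p2) ^ (1/p2)) := by
  have hp0 : 0 < p := by linarith
  have hp10 : 0 < p1 := by linarith
  have hp20 : 0 < p2 := by linarith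
  have hpi : 0 ≤ 1 / p := by positivity
  obtain ⟨C, hC, H⟩ :=
    LatticeVariation.exists_tsum_vqVar_discAvg_signed_le hd hG hG0 hq hp1 hp2 hp0 hp
  have hCt : C ^ (1 / p) ≠ ∞ := ENNReal.rpow_ne_top_of_nonneg hpi hC
  refine ⟨(C ^ (1 / p)).toReal + 1, by positivity, fun f1 f2 hf1 hf2 => ?_⟩
  have e1 := LatticeVariation.tsum_ofReal_abs_rpow hp10 hf1
  have e2 := LatticeVariation.tsum_ofReal_abs_rpow hp20 hf2
  have hM : 0 ≤ ∑' j, |f1 j| ^ p1 := tsum_nonneg fun j => by positivity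
  have hN : 0 ≤ ∑' j, |f2 j| ^ p2 := tsum_nonneg fun j => by positivity
  have h := H f1 f2 (by rw [e1]; exact ENNReal.ofReal_ne_top) (by rw [e2]; exact ENNReal.ofReal_ne_top)
  rw [e1, e2] at h
  refine (ENNReal.rpow_le_rpow h hpi).trans ?_
  have x1 : p / p1 * (1 / p) = 1 / p1 := by field_simp
  have x2 : p / p2 * (1 / p) = 1 / p2 := by field_simp
  rw [ENNReal.mul_rpow_of_nonneg _ _ hpi, ENNReal.mul_rpow_of_nonneg _ _ hpi, ← ENNReal.rpow_mul,
    ← ENNReal.rpow_mul, x1, x2, ENNReal.ofReal_rpow_of_nonneg hM (by positivity),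
    ENNReal.ofReal_rpow_of_nonneg hN (by positivity), mul_assoc, ENNReal.ofReal_mul (by positivity),
    ENNReal.ofReal_mul (by positivity)]
  gcongr
  rw [← ENNReal.ofReal_toReal hCt, ENNReal.toReal_ofReal ENNReal.toReal_nonneg]
  exact ENNReal.ofReal_le_ofReal (by linarith)
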